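/- arXiv:0807.1141 — 2 statements merged into one kernel-verified Lean document; each statement's English description precedes it below -/
import Mathlib

section
/- A countable group G endowed with a proper left-invariant metric is bijectively coarsely equivalent to ℤ^∞ = ⊕_{i∈ℕ} ℤ (endowed with a proper left-invariant metric) if and only if G is bijectively coarsely equivalent to some countable abelian group (with a proper left-invariant metric) and asdim(G) = ∞. -/
/-- `d` is a metric (as a two-variable real function). -/
def IsMetricFun {X : Type*} (d : X → X → ℝ) : Prop :=
  (∀ x y : X, d x y = 0 ↔ x = y) ∧ (∀ x y : X, d x y = d y x) ∧
    (∀ x y z : X, d x z ≤ d x y + d y z)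

/-- `asdim X ≤ n`: for every `D ≥ 0` there is a cover of `X` of finite mesh that splits
into `n+1` many `D`-discrete subfamilies. -/
def ASDimLE (X : Type*) [MetricSpace X] (n : ℕ) : Prop :=
  ∀ D : ℝ, 0 ≤ D → ∃ U : Fin (n + 1) → Set (Set X),
    (∀ x : X, ∃ i : Fin (n + 1), ∃ u ∈ U i, x ∈ u) ∧
    (∃ m : ℝ, ∀ i : Fin (n + 1), ∀ u ∈ U i, EMetric.diam u ≤ ENNReal.ofReal m) ∧
    (∀ i : Fin (n + 1), ∀ u ∈ U i, ∀ v ∈ U i, u ≠ v → ∀ x ∈ u, ∀ y ∈ v, D ≤ dist x y)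

/-- A bijective coarse equivalence between a metric space `X` and a set with a metric
given as a two-variable function `d`. -/
def BijCoarseEquivTo (X : Type*) [MetricSpace X] {A : Type*} (d : A → A → ℝ) : Prop :=
  ∃ F : X → A, Function.Bijective F ∧
    (∀ δ : ℝ, 0 ≤ δ → ∃ ε : ℝ, 0 ≤ ε ∧ ∀ x y : X, dist x y ≤ δ → d (F x) (F y) ≤ ε) ∧
    (∀ δ : ℝ, 0 ≤ δ → ∃ ε : ℝ, 0 ≤ ε ∧ ∀ x y : X, d (F x) (F y) ≤ δ → dist x y ≤ ε)

namespace ZInf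
abbrev X := ℕ →₀ ℤ
abbrev Co := List X → ZMod 2

def dl (φ : Co) : Co
  | [] => 0
  | a :: l => φ l + dl (fun m => φ (a :: m)) l

noncomputable def Qp (e : X) (φ : Co) : Co
  | [] => 0
  | a :: l => φ (a :: (a + e) :: l.map (· + e)) + Qp e (fun m => φ (a :: m)) l

lemma z2 (a : ZMod 2) : a + a = 0 := CharTwo.add_self_eq_zero a

lemma dl_add (l : List X) : ∀ φ ψ : Co, dl (fun m => φ m + ψ m) l = dl φ l + dl ψ l := by
  induction l with
  | nil => intro φ ψ; simp [dl]
  | cons a l ih => intro φ ψ; simp only [dl, ih]; ring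

lemma dl_mul (c : ZMod 2) (l : List X) : ∀ φ : Co, dl (fun m => c * φ m) l = c * dl φ l := by
  induction l with
  | nil => intro φ; simp [dl]
  | cons a l ih => intro φ; simp only [dl, ih]; ring

lemma dl_zero (l : List X) : dl (fun _ => 0) l = 0 := by
  induction l with
  | nil => simp [dl]
  | cons a l ih => simp [dl, ih]

lemma dl_map (f : X → X) (l : List X) : ∀ φ : Co,
    dl (fun m => φ (m.map f)) l = dl φ (l.map f) := by
  induction l with
  | nil => intro φ; simp [dl]
  | cons a l ih =>
    intro φ
    simp only [dl, List.map_cons]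
    rw [← ih]

lemma dl_dl (l : List X) : ∀ φ : Co, dl (dl φ) l = 0 := by
  induction l with
  | nil => intro φ; simp [dl]
  | cons a l ih =>
    intro φ
    simp only [dl, dl_add, ih]
    rw [← add_assoc, z2]; simp

lemma Qp_add (e : X) (l : List X) : ∀ φ ψ : Co,
    Qp e (fun m => φ m + ψ m) l = Qp e φ l + Qp e ψ l := by
  induction l with
  | nil => intro φ ψ; simp [Qp]
  | cons a l ih => intro φ ψ; simp only [Qp, ih]; ring

lemma Qp_hom (e : X) (l : List X) : ∀ φ : Co,
    Qp e (dl φ) l + dl (Qp e φ) l = φ (l.map (· + e)) + φ l := by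
  induction l with
  | nil => intro φ; simp [Qp, dl, z2]
  | cons a l ih =>
    intro φ
    have h := ih (fun m => φ (a :: m))
    simp only [Qp, dl, dl_add, Qp_add, List.map_cons]
    rw [dl_map (· + e) l (fun m => φ (a :: (a + e) :: m))]
    generalize φ (List.map (· + e) l) = x0 at *
    have e1 := z2 (Qp e φ l)
    have e2 := z2 (dl (fun m => φ (a :: (a + e) :: m)) (List.map (· + e) l))
    have e3 := z2 (φ (a :: List.map (· + e) l))
    linear_combination h + e1 + e2 + e3

noncomputable def QS (e : X) (φ : Co) : ℕ → Co
  | 0 => fun _ => 0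
  | t + 1 => fun l => QS e φ t l + Qp e φ (l.map (· + t • e))

lemma QS_add (e : X) (t : ℕ) (φ ψ : Co) (l : List X) :
    QS e (fun m => φ m + ψ m) t l = QS e φ t l + QS e ψ t l := by
  induction t with
  | zero => simp [QS]
  | succ t ih => simp only [QS, ih, Qp_add]; ring

lemma QS_hom (e : X) (t : ℕ) (φ : Co) (l : List X) :
    QS e (dl φ) t l + dl (QS e φ t) l = φ (l.map (· + t • e)) + φ l := by
  induction t with
  | zero => simp [QS, dl_zero, z2]
  | succ t ih =>
    simp only [QS, dl_add]
    rw [dl_map (· + t • e) l (Qp e φ)]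
    have h := Qp_hom e (l.map (· + t • e)) φ
    have h2 : (List.map (· + t • e) l).map (· + e) = l.map (· + (t + 1) • e) := by
      simp [List.map_map, Function.comp_def, add_smul, add_assoc]
    rw [h2] at h
    have e1 := z2 (φ (l.map (· + t • e)))
    linear_combination h + ih + e1

noncomputable def J (M : ℕ) : List ℕ → Co → ZMod 2
  | [], φ => φ [0]
  | i :: is, φ => J M is (QS (Finsupp.single i 1) φ M)

lemma J_add (M : ℕ) (is : List ℕ) : ∀ φ ψ : Co,
    J M is (fun m => φ m + ψ m) = J M is φ + J M is ψ := by
  induction is with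
  | nil => intro φ ψ; simp [J]
  | cons i is ih =>
    intro φ ψ
    simp only [J]
    rw [← ih]; congr 1; funext l; exact QS_add _ _ _ _ _

lemma Qp_zero (e : X) (l : List X) : ∀ φ : Co,
    (∀ m : List X, (∀ p ∈ m, ∃ q ∈ l, p = q ∨ p = q + e) → φ m = 0) → Qp e φ l = 0 := by
  induction l with
  | nil => intro φ h; rfl
  | cons a l ih =>
    intro φ h
    simp only [Qp]
    rw [ih, h]
    · simp
    · intro p hp
      simp only [List.mem_cons, List.mem_map] at hp
      rcases hp with rfl | rfl | ⟨q, hq, rfl⟩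
      · exact ⟨p, by simp, by simp⟩
      · exact ⟨a, by simp, by simp⟩
      · exact ⟨q, by simp [hq], by simp⟩
    · intro m hm
      apply h
      intro p hp
      rcases List.mem_cons.1 hp with rfl | hp
      · exact ⟨p, by simp, by simp⟩
      · obtain ⟨q, hq, h⟩ := hm p hp
        exact ⟨q, by simp [hq], h⟩

lemma QS_zero (i : ℕ) (t : ℕ) (φ : Co) (l : List X)
    (h : ∀ m : List X, ∀ s : ℕ, (∀ p ∈ m, ∃ q ∈ l, p = q + Finsupp.single i (s : ℤ) ∨
      p = q + Finsupp.single i (s + 1 : ℤ)) → φ m = 0) :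
    QS (Finsupp.single i 1) φ t l = 0 := by
  induction t with
  | zero => simp [QS]
  | succ t ih =>
    simp only [QS, ih, zero_add]
    apply Qp_zero
    intro m hm
    apply h m t
    intro p hp
    obtain ⟨q, hq, h⟩ := hm p hp
    obtain ⟨q', hq', rfl⟩ := List.mem_map.1 hq
    refine ⟨q', hq', ?_⟩
    simpa [add_assoc, ← Finsupp.single_add] using h

def Good (is : List ℕ) (l : List X) : Prop :=
  ∀ p ∈ l, (∀ j, j ∉ is → p j = 0) ∧ ∀ q ∈ l, ∀ j, |p j - q j| ≤ is.length

lemma single_cases (i j : ℕ) (a : ℤ) : (i = j ∧ Finsupp.single i a j = a) ∨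
    (i ≠ j ∧ Finsupp.single i a j = 0) := by
  by_cases h : i = j
  · left; subst h; simp
  · right; simp [h]

lemma J_zero (M : ℕ) (is : List ℕ) : ∀ φ : Co, (∀ l, Good is l → φ l = 0) → J M is φ = 0 := by
  induction is with
  | nil =>
    intro φ h
    apply h
    intro p hp
    simp at hp
    subst hp
    simp
  | cons i is ih =>
    intro φ h
    simp only [J]
    apply ih
    intro l hl
    apply QS_zero
    intro m s hm
    apply h
    intro p hp
    obtain ⟨p', hp', hpp⟩ := hm p hp
    obtain ⟨h1, h2⟩ := hl p' hp'
    constructor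
    · intro j hj
      simp only [List.mem_cons, not_or] at hj
      have := h1 j hj.2
      rcases hpp with rfl | rfl <;> simp [this, Ne.symm hj.1]
    · intro q hq j
      obtain ⟨q', hq', hqq⟩ := hm q hq
      have h3 := h2 q' hq' j
      rw [abs_le] at h3 ⊢
      simp only [List.length_cons]
      push_cast
      have s1 := single_cases i j (s : ℤ)
      have s2 := single_cases i j (s + 1 : ℤ)
      rcases hpp with rfl | rfl <;> rcases hqq with rfl | rfl <;>
        simp only [Finsupp.add_apply] <;> omega

lemma J_cong (M : ℕ) (is : List ℕ) (φ ψ : Co) (h : ∀ l, Good is l → φ l = ψ l) :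
    J M is φ = J M is ψ := by
  have h1 : J M is (fun m => φ m + ψ m) = 0 := J_zero _ _ _ (fun l hl => by rw [h l hl, z2])
  rw [J_add] at h1
  have := z2 (J M is ψ)
  linear_combination h1 - this

/-- the list lies in one of the two hyperplanes -/
def Flat (M : ℕ) (is : List ℕ) (l : List X) : Prop :=
  ∃ i ∈ is, (∀ p ∈ l, p i = 0) ∨ (∀ p ∈ l, p i = M)

lemma QS_flat (M : ℕ) (i : ℕ) (is : List ℕ) (hi : i ∉ is) (φ : Co)
    (h : ∀ l, Flat M is l → φ l = 0) (l : List X) (hl : Flat M is l) :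
    QS (Finsupp.single i 1) φ M l = 0 := by
  obtain ⟨j, hj, hh⟩ := hl
  have hij : i ≠ j := fun h => hi (h ▸ hj)
  apply QS_zero
  intro m s hm
  apply h
  refine ⟨j, hj, hh.imp ?_ ?_⟩
  all_goals
    intro hh p hp
    obtain ⟨q, hq, hpq⟩ := hm p hp
    have := hh q hq
    rcases hpq with rfl | rfl <;> simp [this, hij]

lemma QS_nil (e : X) (φ : Co) (t : ℕ) : QS e φ t [] = 0 := by
  induction t with
  | zero => rfl
  | succ t ih => simp [QS, ih, Qp]

lemma J_step (M : ℕ) (i : ℕ) (is : List ℕ) (φ : Co) :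
    J M (i :: is) (dl φ) = J M is (fun l => φ (l.map (· + Finsupp.single i (M : ℤ)))) + J M is φ
      + J M is (dl (QS (Finsupp.single i 1) φ M)) := by
  rw [← J_add, ← J_add]
  simp only [J]
  congr 1
  funext l
  have h := QS_hom (Finsupp.single i 1) M φ l
  have h2 : (M • Finsupp.single i (1 : ℤ)) = Finsupp.single i (M : ℤ) := by simp
  rw [h2] at h
  have := z2 (dl (QS (Finsupp.single i 1) φ M) l)
  linear_combination h - this

lemma J_dl (M : ℕ) (is : List ℕ) : is.Nodup → ∀ φ : Co, φ [] = 0 →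
    (∀ l, Flat M is l → φ l = 0) → J M is (dl φ) = 0 := by
  induction is with
  | nil => intro _ φ h0 h; simp [J, dl, h0]
  | cons i is ih =>
    intro hn φ h0 h
    obtain ⟨hi, hn⟩ := List.nodup_cons.1 hn
    rw [J_step, J_zero, J_zero, ih hn]
    · simp
    · exact QS_nil _ _ _
    · apply QS_flat _ _ _ hi
      rintro l ⟨j, hj, hh⟩
      exact h l ⟨j, by simp [hj], hh⟩
    · intro l hl
      exact h l ⟨i, by simp, Or.inl fun p hp => (hl p hp).1 i hi⟩
    · intro l hl
      apply h
      refine ⟨i, by simp, Or.inr fun p hp => ?_⟩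
      obtain ⟨q, hq, rfl⟩ := List.mem_map.1 hp
      simp [(hl q hq).1 i hi]

def E : List (X → ZMod 2) → Co
  | [], [_] => 1
  | s :: ss, a :: b :: l => (s a + s b) * E ss (b :: l)
  | _, _ => 0

lemma E_nil (ss) : E ss [] = 0 := by cases ss <;> rfl

def Ps (s : X → ZMod 2) (ss : List (X → ZMod 2)) : Co
  | [] => 0
  | a :: l => s a * E ss (a :: l)

lemma dl_Ps (s : X → ZMod 2) (ss) (h : ∀ l, dl (E ss) l = 0) (l : List X) :
    dl (Ps s ss) l = E (s :: ss) l := by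
  match l with
  | [] => rfl
  | [a] => simp [dl, Ps, E]
  | a :: b :: l =>
    have h1 := h (a :: b :: l)
    rw [dl] at h1 ⊢
    simp only [Ps, E]
    rw [dl_mul (s a) (b :: l) (fun m => E ss (a :: m))]
    linear_combination (s a) * h1 - z2 (s a * E ss (b :: l))

lemma dl_E (ss) : ∀ l, dl (E ss) l = 0 := by
  induction ss with
  | nil =>
    intro l
    match l with
    | [] => rfl
    | [a] => simp [dl, E]
    | [a, b] => simp [dl, E, z2]
    | a :: b :: c :: l => simp [dl, E, dl_zero]
  | cons s ss ih =>
    intro l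
    have : E (s :: ss) = dl (Ps s ss) := by funext l; exact (dl_Ps s ss ih l).symm
    rw [this, dl_dl]

lemma E_const (ss : List (X → ZMod 2)) : ∀ l : List X, ∀ s ∈ ss,
    (∀ p ∈ l, ∀ q ∈ l, s p = s q) → E ss l = 0 := by
  induction ss with
  | nil => intro l s hs; simp at hs
  | cons r ss ih =>
    intro l s hs h
    match l with
    | [] => rfl
    | [a] => rfl
    | a :: b :: l =>
      simp only [E]
      rcases List.mem_cons.1 hs with rfl | hs
      · rw [h a (by simp) b (by simp), z2]; simp
      · rw [ih (b :: l) s hs]; · simp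
        intro p hp q hq
        exact h p (List.mem_cons_of_mem _ hp) q (List.mem_cons_of_mem _ hq)

lemma J_E (M : ℕ) (s : ℕ → X → ZMod 2) (h0 : ∀ i p, p i = 0 → s i p = 1)
    (h1 : ∀ i (p : X), p i = M → s i p = 0) (is : List ℕ) : is.Nodup →
    J M is (E (is.map s)) = 1 := by
  induction is with
  | nil => intro _; rfl
  | cons i is ih =>
    intro hn
    obtain ⟨hi, hn⟩ := List.nodup_cons.1 hn
    have e1 : E ((i :: is).map s) = dl (Ps (s i) (is.map s)) := by
      funext l; exact (dl_Ps _ _ (dl_E _) l).symm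
    rw [e1, J_step, J_zero, J_dl M is hn, J_cong M is _ (E (is.map s)), ih hn]
    · simp
    · intro l hl
      cases l with
      | nil => simp [Ps, E_nil]
      | cons a l => simp [Ps, h0 i a ((hl a (by simp)).1 i hi)]
    · exact QS_nil _ _ _
    · apply QS_flat _ _ _ hi
      rintro l ⟨j, hj, hh⟩
      cases l with
      | nil => rfl
      | cons a l =>
        simp only [Ps]
        rw [E_const _ _ (s j) (List.mem_map.2 ⟨j, hj, rfl⟩), mul_zero]
        intro p hp q hq
        rcases hh with hh | hh
        · rw [h0 _ _ (hh p hp), h0 _ _ (hh q hq)]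
        · rw [h1 _ _ (hh p hp), h1 _ _ (hh q hq)]
    · intro l hl
      cases l with
      | nil => rfl
      | cons a l =>
        simp only [Ps, List.map_cons]
        rw [h1 i, zero_mul]
        simp [(hl a (by simp)).1 i hi]

lemma hex0 (N M : ℕ) (s : ℕ → X → ZMod 2) (h0 : ∀ i p, p i = 0 → s i p = 1)
    (h1 : ∀ i (p : X), p i = M → s i p = 0) :
    ∃ l : List X, Good (List.range N) l ∧ l ≠ [] ∧
      ∀ i < N, ∃ p ∈ l, ∃ q ∈ l, s i p ≠ s i q := by
  by_contra hcon
  push Not at hcon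
  have h := J_E M s h0 h1 (List.range N) List.nodup_range
  rw [J_zero] at h
  · exact zero_ne_one h
  · intro l hl
    by_cases hne : l = []
    · rw [hne, E_nil]
    obtain ⟨i, hi, hc⟩ := hcon l hl hne
    exact E_const _ _ (s i) (List.mem_map.2 ⟨i, by simpa using hi, rfl⟩) hc

def Near (N C : ℕ) (p q : X) : Prop := ∀ j, |p j - q j| ≤ C ∧ (N ≤ j → p j = q j)

lemma hex (N M : ℕ) (U : ℕ → Set (Set X)) (hcov : ∀ x, ∃ i < N, ∃ u ∈ U i, x ∈ u)
    (hM : ∀ i, ∀ u ∈ U i, ∀ x ∈ u, ∀ y ∈ u, |x i - y i| ≤ M)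
    (hD : ∀ i, ∀ u ∈ U i, ∀ v ∈ U i, ∀ x ∈ u, ∀ y ∈ v, Near N (2 * N) x y → u = v) : False := by
  classical
  let A : ℕ → Set X := fun i => {x | ∃ u ∈ U i, x ∈ u ∧ ∃ y ∈ u, y i ≤ N}
  let P : ℕ → X → Prop := fun i p => p i ≤ 0 ∨ ∃ x ∈ A i, Near N N p x
  let s : ℕ → X → ZMod 2 := fun i p => if P i p then 1 else 0
  obtain ⟨l, hg, hne, hs⟩ := hex0 N (M + 2 * N + 1) s
    (fun i p hp => if_pos (Or.inl hp.le)) (fun i p hp => by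
      apply if_neg
      rintro (h | ⟨x, ⟨u, hu, hxu, y, hyu, hy⟩, hx⟩)
      · push_cast at hp; omega
      · have h1 := hM i u hu x hxu y hyu
        have h2 := (hx i).1
        rw [abs_le] at h1 h2
        push_cast at hp
        omega)
  obtain ⟨v, hv⟩ := List.exists_mem_of_ne_nil l hne
  have hnear : ∀ p ∈ l, ∀ q ∈ l, Near N N p q := by
    intro p hp q hq j
    refine ⟨by simpa using (hg p hp).2 q hq j, fun hj => ?_⟩
    rw [(hg p hp).1 j (by simpa using hj), (hg q hq).1 j (by simpa using hj)]
  obtain ⟨i, hi, u, hu, hvu⟩ := hcov v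
  obtain ⟨p, hp, q, hq, hpq⟩ := hs i hi
  have key : ∀ p ∈ l, P i p → ∀ q ∈ l, P i q := by
    intro p hp hPp q hq
    refine Or.inr ⟨v, ?_, hnear q hq v hv⟩
    rcases hPp with h | ⟨x, ⟨u', hu', hxu, y, hyu, hy⟩, hx⟩
    · refine ⟨u, hu, hvu, v, hvu, ?_⟩
      have := ((hnear v hv p hp) i).1
      rw [abs_le] at this
      omega
    · have : u = u' := by
        apply hD i u hu u' hu' v hvu x hxu
        intro j
        have h1 := hnear v hv p hp j
        have h2 := hx j
        refine ⟨?_, fun hj => (h1.2 hj).trans (h2.2 hj)⟩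
        have h3 := h1.1
        have h4 := h2.1
        rw [abs_le] at *
        push_cast
        omega
      subst this
      exact ⟨u, hu, hvu, y, hyu, hy⟩
  apply hpq
  simp only [s]
  by_cases h : P i p
  · rw [if_pos h, if_pos (key p hp h q hq)]
  · rw [if_neg h, if_neg (fun h' => h (key q hq h' p hp))]

lemma finbox (N C : ℕ) : {z : X | ∀ j, |z j| ≤ C ∧ (N ≤ j → z j = 0)}.Finite := by
  have h : (Set.pi Set.univ (fun _ : Fin N => Set.Icc (-(C : ℤ)) C)).Finite :=
    Set.Finite.pi (fun _ => Set.finite_Icc _ _)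
  refine Set.Finite.of_finite_image (f := fun (z : X) (j : Fin N) => z j) (h.subset ?_) ?_
  · rintro _ ⟨z, hz, rfl⟩ j _
    exact abs_le.1 (hz j).1
  · intro z hz w hw hzw
    ext j
    by_cases hj : j < N
    · exact congrFun hzw ⟨j, hj⟩
    · rw [(hz j).2 (by omega), (hw j).2 (by omega)]

end ZInf

namespace ZInf
section grp
variable {A : Type} [AddCommGroup A]

lemma mem_closure_insert' {x : A} {S : Set A} {g : A}
    (h : g ∈ AddSubgroup.closure (insert x S)) :
    ∃ k : ℤ, g - k • x ∈ AddSubgroup.closure S := by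
  rw [Set.insert_eq, AddSubgroup.closure_union, AddSubgroup.mem_sup] at h
  obtain ⟨y, hy, z, hz, rfl⟩ := h
  obtain ⟨k, rfl⟩ := AddSubgroup.mem_closure_singleton.1 hy
  exact ⟨k, by simpa using hz⟩

lemma fi (L : AddSubgroup A) (S : Set A) (hS : S.Finite)
    (h : ∀ x ∈ S, ∃ n : ℤ, n ≠ 0 ∧ n • x ∈ L) :
    ∃ T : Set A, T.Finite ∧ T ⊆ AddSubgroup.closure S ∧
      ∀ g ∈ AddSubgroup.closure S, ∃ t ∈ T, g - t ∈ L := by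
  induction S, hS using Set.Finite.induction_on with
  | empty =>
    refine ⟨{0}, by simp, by simp, ?_⟩
    intro g hg
    simp at hg
    simp [hg]
  | @insert x S hxS hS ih =>
    obtain ⟨T, hT, hTS, hg⟩ := ih (fun y hy => h y (Set.mem_insert_of_mem _ hy))
    obtain ⟨n, hn, hnx⟩ := h x (Set.mem_insert _ _)
    have hle : AddSubgroup.closure S ≤ AddSubgroup.closure (insert x S) :=
      AddSubgroup.closure_mono (Set.subset_insert _ _)
    refine ⟨Set.image2 (fun (r : ℤ) t => r • x + t) (Set.Icc 0 |n|) T,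
      Set.Finite.image2 _ (Set.finite_Icc _ _) hT, ?_, ?_⟩
    · rintro _ ⟨r, _, t, ht, rfl⟩
      exact add_mem (zsmul_mem (AddSubgroup.subset_closure (Set.mem_insert _ _)) _)
        (hle (hTS ht))
    · intro g hgm
      obtain ⟨k, hk⟩ := mem_closure_insert' hgm
      obtain ⟨t, ht, hl⟩ := hg _ hk
      refine ⟨_, ⟨k % n, ⟨Int.emod_nonneg _ hn, (Int.emod_lt_abs _ hn).le⟩, t, ht, rfl⟩, ?_⟩
      have e : g - ((k % n) • x + t) = (g - k • x - t) + (k / n) • (n • x) := by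
        have : k • x = (k % n) • x + (k / n) • (n • x) := by
          rw [smul_smul, ← add_smul]
          congr 1
          rw [mul_comm]; exact (Int.emod_add_mul_ediv k n).symm
        rw [this]; abel
      rw [e]
      exact add_mem hl (zsmul_mem hnx _)

lemma exists_section (H K : AddSubgroup A) (hHK : H ≤ K) (a : A) (haK : a ∈ K)
    (ha : ∀ n : ℤ, n • a ∈ H → n = 0) (T : Set A) (hT : T.Finite) 
    (hTK : ∀ x ∈ K, ∃ t ∈ T, ∃ n : ℤ, x - t - n • a ∈ H) :
    ∃ (d : ℤ) (r : ℤ → A), 0 < d ∧ (∀ n, r n ∈ K) ∧ r 0 = 0 ∧ (∀ n, r (n + d) = r n + a) ∧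
      (∀ x ∈ K, ∃ n, x - r n ∈ H) ∧ (∀ n m, r n - r m ∈ H → n = m) := by
  classical
  let M : AddSubgroup A := H ⊔ AddSubgroup.zmultiples a
  have hM : ∀ x, x ∈ M ↔ ∃ n : ℤ, x - n • a ∈ H := by
    intro x
    constructor
    · intro hx
      obtain ⟨y, hy, z, hz, rfl⟩ := AddSubgroup.mem_sup.1 hx
      obtain ⟨k, rfl⟩ := AddSubgroup.mem_zmultiples_iff.1 hz
      exact ⟨k, by simpa using hy⟩
    · rintro ⟨n, hn⟩
      have : x = (x - n • a) + n • a := by abel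
      rw [this]
      exact add_mem (AddSubgroup.mem_sup_left hn)
        (AddSubgroup.mem_sup_right (zsmul_mem (AddSubgroup.mem_zmultiples a) n))
  let Q : Set (A ⧸ M) := (fun x : A => (x : A ⧸ M)) '' K
  have hQ : Q.Finite := by
    apply (hT.image (fun x : A => (x : A ⧸ M))).subset
    rintro _ ⟨x, hx, rfl⟩
    obtain ⟨t, ht, n, hn⟩ := hTK x hx
    refine ⟨t, ht, ?_⟩
    show (t : A ⧸ M) = (x : A ⧸ M)
    rw [QuotientAddGroup.eq, hM]
    exact ⟨n, by rwa [neg_add_eq_sub]⟩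
  have : Finite Q := hQ
  let d := Nat.card Q
  have hd : 0 < d := by
    have : Nonempty Q := ⟨⟨_, 0, zero_mem K, rfl⟩⟩
    exact Nat.card_pos
  let e : Q ≃ Fin d := Finite.equivFin Q
  have ht : ∀ i : Fin d, ∃ t ∈ K, (t : A ⧸ M) = (e.symm i).1 := fun i => (e.symm i).2
  choose t htK ht using ht
  have hdz : (0 : ℤ) < d := by exact_mod_cast hd
  have hmod : ∀ n : ℤ, (n % d).toNat < d := by
    intro n
    have := Int.emod_lt_of_pos n hdz
    have := Int.emod_nonneg n hdz.ne'
    omega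
  let ρ : ℤ → A := fun n => t ⟨(n % d).toNat, hmod n⟩ + (n / d) • a
  have hρK : ∀ n, ρ n ∈ K := fun n => add_mem (htK _) (zsmul_mem haK _)
  refine ⟨d, fun n => ρ n - ρ 0, hdz, fun n => sub_mem (hρK _) (hρK _), sub_self _, ?_, ?_, ?_⟩
  · intro n
    have h1 : (n + d) / d = n / d + 1 := by
      rw [Int.add_ediv_of_dvd_right (dvd_refl _), Int.ediv_self hdz.ne']
    simp only [ρ, Int.add_emod_right, h1, add_smul, one_smul]
    abel
  · intro x hx
    have hx' : x + ρ 0 ∈ K := add_mem hx (hρK 0)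
    let q : Q := ⟨_, x + ρ 0, hx', rfl⟩
    have h1 := ht (e q)
    rw [e.symm_apply_apply] at h1
    replace h1 : (t (e q) : A ⧸ M) = ((x + ρ 0 : A) : A ⧸ M) := h1
    rw [QuotientAddGroup.eq, hM] at h1
    obtain ⟨k, hk⟩ := h1
    refine ⟨(e q : ℕ) + d * k, ?_⟩
    have hlt : ((e q : ℕ) : ℤ) < d := by exact_mod_cast (e q).2
    have h2 : ((e q : ℕ) + d * k : ℤ) % d = (e q : ℕ) := by
      rw [Int.add_mul_emod_self_left]
      exact Int.emod_eq_of_lt (by positivity) hlt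
    have h3 : ((e q : ℕ) + d * k : ℤ) / d = k := by
      rw [Int.add_mul_ediv_left _ _ hdz.ne', Int.ediv_eq_zero_of_lt (by positivity) hlt, zero_add]
    have h4 : ρ ((e q : ℕ) + d * k) = t (e q) + k • a := by
      simp only [ρ, h3]
      congr 2
      apply Fin.ext
      simp [h2]
    simp only [h4]
    convert hk using 1
    abel
  · intro n m h
    rw [sub_sub_sub_cancel_right] at h
    have h1 : t ⟨(m % d).toNat, hmod m⟩ - t ⟨(n % d).toNat, hmod n⟩ ∈ M := by
      rw [hM]
      refine ⟨n / d - m / d, ?_⟩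
      convert neg_mem h using 1
      simp only [ρ, sub_smul]
      abel
    rw [sub_eq_neg_add, ← QuotientAddGroup.eq, ht, ht] at h1
    have h2 := e.symm.injective (Subtype.ext h1)
    have h3 : (n % d).toNat = (m % d).toNat := congrArg Fin.val h2
    have h4 : n % d = m % d := by
      have := Int.emod_nonneg n hdz.ne'
      have := Int.emod_nonneg m hdz.ne'
      omega
    simp only [ρ, h2, add_sub_add_left_eq_sub, ← sub_smul] at h
    have h5 := ha _ h
    rw [← Int.emod_add_mul_ediv n d, ← Int.emod_add_mul_ediv m d, h4, sub_eq_zero.1 h5]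

lemma period_mul (r : ℤ → A) (d : ℤ) (a : A) (hr : ∀ n, r (n + d) = r n + a) (n q : ℤ) :
    r (n + d * q) = r n + q • a := by
  induction q using Int.induction_on with
  | zero => simp
  | succ i ih =>
    rw [mul_add, mul_one, ← add_assoc, hr, ih, add_smul, one_smul]; abel
  | pred i ih =>
    have := hr (n + d * (-i - 1))
    have e : n + d * (-(i : ℤ) - 1) + d = n + d * (-i) := by ring
    rw [e, ih] at this
    rw [sub_smul, one_smul]
    rw [eq_sub_of_add_eq this.symm]; abel

lemma period_mod (r : ℤ → A) (d : ℤ) (a : A) (hr : ∀ n, r (n + d) = r n + a) (n : ℤ) :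
    r n = r (n % d) + (n / d) • a := by
  rw [← period_mul r d a hr, Int.emod_add_mul_ediv]

/-- The output of the classification argument. -/
def GoodMap (Γ : (ℕ →₀ ℤ) → A) : Prop :=
  Function.Bijective Γ ∧ (∀ s, (Set.range fun z => Γ (z + s) - Γ z).Finite) ∧
    ∀ g : A, ∃ S : Set (ℕ →₀ ℤ), S.Finite ∧ ∀ z, ∃ s ∈ S, Γ (z + s) = Γ z + g

lemma build (C : ℕ → AddSubgroup A) (hC0 : C 0 = ⊥) (hCm : Monotone C) (hCu : ∀ x, ∃ k, x ∈ C k)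
    (d : ℕ → ℤ) (r : ℕ → ℤ → A) (a : ℕ → A) (hd : ∀ k, 0 < d k) (hrC : ∀ k n, r k n ∈ C (k + 1))
    (hr0 : ∀ k, r k 0 = 0) (hrd : ∀ k n, r k (n + d k) = r k n + a k)
    (hsur : ∀ k, ∀ x ∈ C (k + 1), ∃ n, x - r k n ∈ C k)
    (hinj : ∀ k n m, r k n - r k m ∈ C k → n = m) :
    GoodMap (fun z : ℕ →₀ ℤ => z.sum r) := by
  classical
  have upd : ∀ (z : ℕ →₀ ℤ) k w, (z + Finsupp.single k w).sum r
      = z.sum r + (r k (z k + w) - r k (z k)) := by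
    intro z k w
    have h1 : z.sum r = ∑ i ∈ insert k z.support, r i (z i) :=
      Finsupp.sum_of_support_subset _ (Finset.subset_insert _ _) _ (fun i _ => hr0 i)
    have h2 : (z + Finsupp.single k w).sum r
        = ∑ i ∈ insert k z.support, r i ((z + Finsupp.single k w) i) := by
      apply Finsupp.sum_of_support_subset _ _ _ (fun i _ => hr0 i)
      intro i hi
      simp only [Finsupp.mem_support_iff, Finsupp.add_apply, Finset.mem_insert] at hi ⊢
      by_contra hcon
      push Not at hcon
      apply hi
      simp [hcon.2, Ne.symm hcon.1]
    rw [h1, h2, ← sub_eq_iff_eq_add', ← Finset.sum_sub_distrib,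
      Finset.sum_eq_single_of_mem k (by simp)]
    · simp
    · intro i _ hik
      simp [Ne.symm hik]
  have step : ∀ k, ∀ g ∈ C k, ∃ S : Set (ℕ →₀ ℤ), S.Finite ∧
      ∀ z : ℕ →₀ ℤ, ∃ s ∈ S, (z + s).sum r = z.sum r + g := by
    intro k
    induction k with
    | zero =>
      intro g hg
      rw [hC0, AddSubgroup.mem_bot] at hg
      exact ⟨{0}, by simp, fun z => ⟨0, by simp, by simp [hg]⟩⟩
    | succ k ih =>
      intro g hg
      have h1 : ∀ n : ℤ, ∃ w, r k n + g - r k (n + w) ∈ C k := by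
        intro n
        obtain ⟨m, hm⟩ := hsur k _ (add_mem (hrC k n) hg)
        exact ⟨m - n, by simpa using hm⟩
      choose w hw using h1
      choose S hS hSz using fun n : ℤ => ih _ (hw n)
      refine ⟨⋃ n ∈ Set.Icc 0 (d k), (fun s => Finsupp.single k (w n) + s) '' S n,
        (Set.finite_Icc _ _).biUnion (fun n _ => (hS n).image _), ?_⟩
      intro z
      obtain ⟨s, hs, he⟩ := hSz (z k % d k) (z + Finsupp.single k (w (z k % d k)))
      refine ⟨Finsupp.single k (w (z k % d k)) + s, ?_, ?_⟩
      · simp only [Set.mem_iUnion]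
        exact ⟨z k % d k, ⟨Int.emod_nonneg _ (hd k).ne', (Int.emod_lt_of_pos _ (hd k)).le⟩,
          s, hs, rfl⟩
      · rw [← add_assoc, he, upd]
        have e1 := period_mod (r k) _ _ (hrd k) (z k)
        have e2 := period_mul (r k) _ _ (hrd k) (z k % d k + w (z k % d k)) (z k / d k)
        have e3 : z k % d k + w (z k % d k) + d k * (z k / d k) = z k + w (z k % d k) := by
          have := Int.emod_add_mul_ediv (z k) (d k)
          linarith
        rw [e3] at e2
        rw [e2]
        generalize r k (z k) = R at *
        rw [e1]
        abel
  have mem : ∀ k (z w : ℕ →₀ ℤ), (∀ j, k ≤ j → z j = w j) → z.sum r - w.sum r ∈ C k := by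
    intro k z w h
    have h1 : z.sum r = ∑ i ∈ z.support ∪ w.support, r i (z i) :=
      Finsupp.sum_of_support_subset _ Finset.subset_union_left _ (fun i _ => hr0 i)
    have h2 : w.sum r = ∑ i ∈ z.support ∪ w.support, r i (w i) :=
      Finsupp.sum_of_support_subset _ Finset.subset_union_right _ (fun i _ => hr0 i)
    rw [h1, h2, ← Finset.sum_sub_distrib]
    apply sum_mem
    intro i _
    by_cases hi : k ≤ i
    · rw [h i hi, sub_self]; exact zero_mem _
    · exact sub_mem (hCm (by omega : i + 1 ≤ k) (hrC i _)) (hCm (by omega : i + 1 ≤ k) (hrC i _))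
  have inj : ∀ k (z w : ℕ →₀ ℤ), z.sum r = w.sum r → (∀ j, k ≤ j → z j = w j) → z = w := by
    intro k
    induction k with
    | zero => intro z w _ h; ext j; exact h j (Nat.zero_le _)
    | succ k ih =>
      intro z w he h
      apply ih z w he
      intro j hj
      rcases hj.eq_or_lt with rfl | hj
      · apply hinj k
        have h1 := mem k (z + Finsupp.single k (w k - z k)) w (by
          intro j hj
          rcases hj.eq_or_lt with rfl | hj
          · simp
          · simp [hj.ne, h j hj])
        rw [upd, he] at h1
        have h2 := neg_mem h1
        convert h2 using 1
        simp
      · exact h j hj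
  refine ⟨⟨?_, ?_⟩, ?_, ?_⟩
  · intro z w he
    refine inj ((z.support ∪ w.support).sup id + 1) z w he ?_
    intro j hj
    have h1 : j ∉ z.support ∪ w.support := by
      intro hjm
      have := Finset.le_sup (f := id) hjm
      simp only [id] at this
      omega
    simp only [Finset.mem_union, Finsupp.mem_support_iff, not_or, not_not] at h1
    rw [h1.1, h1.2]
  · intro g
    obtain ⟨k, hk⟩ := hCu g
    obtain ⟨S, _, h⟩ := step k g hk
    obtain ⟨s, _, hs⟩ := h 0
    exact ⟨s, by simpa using hs⟩
  · intro s
    induction s using Finsupp.induction_linear with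
    | zero => 
      apply (Set.finite_singleton (0 : A)).subset
      rintro _ ⟨z, rfl⟩
      simp
    | add f g hf hg =>
      apply (hf.image2 (fun x y => x + y) hg).subset
      rintro _ ⟨z, rfl⟩
      refine ⟨_, ⟨z + g, rfl⟩, _, ⟨z, rfl⟩, ?_⟩
      simp only
      rw [show z + (f + g) = z + g + f by abel]
      abel
    | single k w =>
      apply ((Set.finite_Icc 0 (d k)).image (fun n => r k (n + w) - r k n)).subset
      rintro _ ⟨z, rfl⟩
      refine ⟨z k % d k, ⟨Int.emod_nonneg _ (hd k).ne', (Int.emod_lt_of_pos _ (hd k)).le⟩, ?_⟩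
      simp only [upd]
      have e1 := period_mod (r k) _ _ (hrd k) (z k)
      have e2 := period_mul (r k) _ _ (hrd k) (z k % d k + w) (z k / d k)
      have e3 : z k % d k + w + d k * (z k / d k) = z k + w := by
        have := Int.emod_add_mul_ediv (z k) (d k)
        linarith
      rw [e3] at e2
      rw [e2]
      generalize r k (z k) = R at *
      rw [e1]
      abel
  · intro g
    obtain ⟨k, hk⟩ := hCu g
    exact step k g hk

lemma exists_coord {ι : Type} [DecidableEq ι] (a : ι → A) (ha : LinearIndependent ℤ a) :
    ∃ π : ι → A →+ ℚ, ∀ i j, π i (a j) = if i = j then 1 else 0 := by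
  have h : ∀ i : ι, ∃ π : A →+ ℚ, ∀ j, π (a j) = if i = j then 1 else 0 := by
    intro i
    obtain ⟨π, hπ⟩ := (Module.Baer.of_divisible ℚ).extension_property
      (Finsupp.linearCombination ℤ a) ha
      (Finsupp.linearCombination ℤ (fun j => if i = j then (1 : ℚ) else 0))
    refine ⟨π.toAddMonoidHom, fun j => ?_⟩
    have := LinearMap.congr_fun hπ (Finsupp.single j 1)
    simpa using this
  choose π hπ using h
  exact ⟨π, hπ⟩

lemma coord_sat (π : A →+ ℚ) (S : Set A) (h : ∀ s ∈ S, π s = 0) (x : A) (n : ℤ) (hn : n ≠ 0)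
    (hx : n • x ∈ AddSubgroup.closure S) : π x = 0 := by
  have h1 : AddSubgroup.closure S ≤ π.ker := (AddSubgroup.closure_le _).2 h
  have h2 : π (n • x) = 0 := h1 hx
  rw [map_zsmul] at h2
  exact (smul_eq_zero.1 h2).resolve_left hn

lemma infinite_rank [Countable A] (a : ℕ → A) (ha : LinearIndependent ℤ a)
    (hmax : ∀ x, ∃ n : ℤ, n ≠ 0 ∧ n • x ∈ AddSubgroup.closure (Set.range a)) :
    ∃ Γ : (ℕ →₀ ℤ) → A, GoodMap Γ := by
  obtain ⟨π, hπ⟩ := exists_coord a ha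
  obtain ⟨g, hg⟩ := exists_surjective_nat A
  let L : ℕ → AddSubgroup A := fun k => AddSubgroup.closure (a '' Set.Iio k)
  have hL : Monotone L := fun i j hij =>
    AddSubgroup.closure_mono (Set.image_mono (Set.Iio_subset_Iio hij))
  let sat : ℕ → Set A := fun k => {x | ∃ n : ℤ, n ≠ 0 ∧ n • x ∈ L k}
  have hsat : Monotone sat := fun i j hij x ⟨n, hn, hx⟩ => ⟨n, hn, hL hij hx⟩
  let gens : ℕ → Set A := fun k => a '' Set.Iio k ∪ (g '' Set.Iio k ∩ sat k)
  have hgm : Monotone gens := fun i j hij =>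
    Set.union_subset_union (Set.image_mono (Set.Iio_subset_Iio hij))
      (Set.inter_subset_inter (Set.image_mono (Set.Iio_subset_Iio hij)) (hsat hij))
  have hgs : ∀ k, gens k ⊆ sat k := by
    rintro k x (hx | hx)
    · exact ⟨1, one_ne_zero, by simpa using AddSubgroup.subset_closure hx⟩
    · exact hx.2
  have hgf : ∀ k, (gens k).Finite := fun k =>
    ((Set.finite_Iio k).image _).union (((Set.finite_Iio k).image _).inter_of_left _)
  let C : ℕ → AddSubgroup A := fun k => AddSubgroup.closure (gens k)
  have hCm : Monotone C := fun i j hij => AddSubgroup.closure_mono (hgm hij)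
  have hLC : ∀ k, L k ≤ C k := fun k => AddSubgroup.closure_mono Set.subset_union_left
  have hC0 : C 0 = ⊥ := by simp [C, gens]
  have haC : ∀ k, a k ∈ C (k + 1) := fun k =>
    AddSubgroup.subset_closure (Or.inl ⟨k, by simp, rfl⟩)
  have key : ∀ k, ∃ (d : ℤ) (r : ℤ → A), 0 < d ∧ (∀ n, r n ∈ C (k + 1)) ∧ r 0 = 0 ∧
      (∀ n, r (n + d) = r n + a k) ∧
      (∀ x ∈ C (k + 1), ∃ n, x - r n ∈ C k) ∧ (∀ n m, r n - r m ∈ C k → n = m) := by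
    intro k
    obtain ⟨T, hT, _, hTg⟩ := fi (L (k + 1)) (gens (k + 1)) (hgf _) (fun x hx => hgs _ hx)
    apply exists_section (C k) (C (k + 1)) (hCm (Nat.le_succ k)) (a k) (haC k) _ T hT
    · intro x hx
      obtain ⟨t, ht, hl⟩ := hTg x hx
      have e : a '' Set.Iio (k + 1) = insert (a k) (a '' Set.Iio k) := by
        rw [← Set.image_insert_eq]; congr 1; ext i; simp
      simp only [L, e] at hl
      obtain ⟨n, hn⟩ := mem_closure_insert' hl
      exact ⟨t, ht, n, hLC k hn⟩
    · intro n hn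
      have h1 : C k ≤ (π k).ker := by
        refine (AddSubgroup.closure_le _).2 (fun x hx => ?_)
        obtain ⟨m, hm, hx⟩ := hgs k hx
        refine coord_sat (π k) _ ?_ x m hm hx
        rintro _ ⟨i, hi, rfl⟩
        rw [hπ, if_neg (Set.mem_Iio.1 hi).ne']
      have h2 : π k (n • a k) = 0 := h1 hn
      rw [map_zsmul, hπ, if_pos rfl] at h2
      simpa using h2
  choose d r h1 h2 h3 h4 h5 h6 using key
  refine ⟨_, build C hC0 hCm ?_ d r a h1 h2 h3 h4 h5 h6⟩
  have hun : ∀ x ∈ AddSubgroup.closure (Set.range a), ∃ k, x ∈ L k := by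
    intro x hx
    induction hx using AddSubgroup.closure_induction with
    | mem x hx =>
      obtain ⟨k, rfl⟩ := hx
      exact ⟨k + 1, AddSubgroup.subset_closure ⟨k, by simp, rfl⟩⟩
    | zero => exact ⟨0, zero_mem _⟩
    | add x y _ _ ihx ihy =>
      obtain ⟨i, hi⟩ := ihx
      obtain ⟨j, hj⟩ := ihy
      exact ⟨max i j, add_mem (hL (le_max_left _ _) hi) (hL (le_max_right _ _) hj)⟩
    | neg x _ ih =>
      obtain ⟨i, hi⟩ := ih
      exact ⟨i, neg_mem hi⟩
  intro x
  obtain ⟨j, rfl⟩ := hg x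
  obtain ⟨n, hn, hx⟩ := hmax (g j)
  obtain ⟨k, hk⟩ := hun _ hx
  refine ⟨max k (j + 1), AddSubgroup.subset_closure (Or.inr ⟨⟨j, ?_, rfl⟩, n, hn, ?_⟩)⟩
  · simp
  · exact hL (le_max_left _ _) hk

lemma finite_rank {ι : Type} [Finite ι] (a : ι → A) (ha : LinearIndependent ℤ a)
    (hmax : ∀ x, ∃ n : ℤ, n ≠ 0 ∧ n • x ∈ AddSubgroup.closure (Set.range a))
    (S : Set A) (hS : S.Finite) :
    ∃ V : (ι → Bool) → Set (Set A), (∀ x, ∃ c, ∃ u ∈ V c, x ∈ u) ∧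
      (∃ B : Set A, B.Finite ∧ ∀ c, ∀ u ∈ V c, ∀ x ∈ u, ∀ y ∈ u, y - x ∈ B) ∧
      ∀ c, ∀ u ∈ V c, ∀ v ∈ V c, u ≠ v → ∀ x ∈ u, ∀ y ∈ v, y - x ∉ S := by
  classical
  have := Fintype.ofFinite ι
  obtain ⟨π, hπ⟩ := exists_coord a ha
  let K := AddSubgroup.closure (S ∪ Set.range a)
  let L := AddSubgroup.closure (Set.range a)
  have hSK : ∀ s ∈ S, s ∈ K := fun s hs => AddSubgroup.subset_closure (Or.inl hs)
  obtain ⟨R, hR0, hR⟩ : ∃ R : ℚ, 0 < R ∧ ∀ i, ∀ s ∈ S, |π i s| ≤ R := by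
    have hf : (⋃ i : ι, (fun s => |π i s|) '' S).Finite := Set.finite_iUnion (fun i => hS.image _)
    obtain ⟨R, hR⟩ := hf.bddAbove
    refine ⟨max R 1, by positivity, fun i s hs => le_max_of_le_left (hR ?_)⟩
    exact Set.mem_iUnion.2 ⟨i, s, hs, rfl⟩
  have hLfin : ∀ R' : ℚ, {l | l ∈ L ∧ ∀ i, |π i l| ≤ R'}.Finite := by
    intro R'
    have h : (Set.pi Set.univ (fun _ : ι => Set.Icc (-⌈R'⌉) ⌈R'⌉)).Finite :=
      Set.Finite.pi (fun _ => Set.finite_Icc _ _)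
    apply (h.image (fun n => ∑ i, n i • a i)).subset
    rintro l ⟨hl, hb⟩
    have h1 : l ∈ Submodule.span ℤ (Set.range a) := by
      rw [← Submodule.mem_toAddSubgroup, Submodule.span_int_eq_addSubgroupClosure]; exact hl
    obtain ⟨n, rfl⟩ := (Submodule.mem_span_range_iff_exists_fun ℤ).1 h1
    refine ⟨n, fun i _ => ?_, rfl⟩
    have h2 := hb i
    have h3 : π i (∑ j, n j • a j) = n i := by
      rw [map_sum]
      simp [hπ]
    rw [h3, abs_le] at h2
    have h4 := Int.le_ceil R'
    constructor
    · have : (-⌈R'⌉ : ℚ) ≤ n i := by linarith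
      exact_mod_cast this
    · have : (n i : ℚ) ≤ ⌈R'⌉ := by linarith
      exact_mod_cast this
  have hKfin : {z | z ∈ K ∧ ∀ i, |π i z| ≤ R}.Finite := by
    obtain ⟨T, hT, _, hTg⟩ := fi L (S ∪ Set.range a) (hS.union (Set.finite_range a))
      (fun x _ => hmax x)
    apply (hT.biUnion (t := fun t => (fun l => t + l) ''
      {l | l ∈ L ∧ ∀ i, |π i l| ≤ R + ∑ i, |π i t|}) (fun t _ => (hLfin _).image _)).subset
    rintro z ⟨hz, hzb⟩
    obtain ⟨t, ht, hl⟩ := hTg z hz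
    simp only [Set.mem_iUnion]
    refine ⟨t, ht, z - t, ⟨hl, fun i => ?_⟩, by simp⟩
    rw [map_sub]
    have h1 := abs_sub (π i z) (π i t)
    have h2 : |π i t| ≤ ∑ i, |π i t| :=
      Finset.single_le_sum (f := fun i => |π i t|) (fun _ _ => abs_nonneg _) (Finset.mem_univ i)
    have h3 := hzb i
    linarith
  let W : (ι → ℤ) → A ⧸ K → Set A := fun q κ => {x | (x : A ⧸ K) = κ ∧ ∀ i, ⌊π i x / R⌋ = q i}
  refine ⟨fun c => {u | ∃ q κ, (∀ i, c i = decide (Even (q i))) ∧ u = W q κ}, ?_, ?_, ?_⟩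
  · intro x
    exact ⟨fun i => decide (Even ⌊π i x / R⌋), _, ⟨fun i => ⌊π i x / R⌋, x, fun i => rfl, rfl⟩,
      rfl, fun i => rfl⟩
  · refine ⟨_, hKfin, ?_⟩
    rintro c _ ⟨q, κ, _, rfl⟩ x ⟨hx, hxq⟩ y ⟨hy, hyq⟩
    constructor
    · rw [sub_eq_neg_add, ← QuotientAddGroup.eq, hx, hy]
    · intro i
      have h1 := Int.abs_sub_lt_one_of_floor_eq_floor ((hyq i).trans (hxq i).symm)
      rw [← sub_div, abs_div, abs_of_pos hR0, div_lt_one hR0] at h1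
      rw [map_sub]
      exact h1.le
  · rintro c _ ⟨q, κ, hc, rfl⟩ _ ⟨q', κ', hc', rfl⟩ hne x ⟨hx, hxq⟩ y ⟨hy, hyq⟩ hs
    apply hne
    have e1 : κ = κ' := by
      rw [← hx, ← hy, QuotientAddGroup.eq, neg_add_eq_sub]
      exact hSK _ hs
    have e2 : q = q' := by
      funext i
      have h1 := hR i _ hs
      have hpar : Even (q i) ↔ Even (q' i) := by
        have := (hc i).symm.trans (hc' i)
        simpa using this
      have h2 := hxq i
      have h3 := hyq i
      have h4 : |π i y / R - π i x / R| ≤ 1 := by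
        rw [← sub_div, abs_div, abs_of_pos hR0, div_le_one hR0, ← map_sub]
        exact h1
      rw [Int.floor_eq_iff] at h2 h3
      rw [abs_le] at h4
      have h5 : q' i < q i + 2 := by
        have : (q' i : ℚ) < q i + 2 := by linarith
        exact_mod_cast this
      have h6 : q i < q' i + 2 := by
        have : (q i : ℚ) < q' i + 2 := by linarith
        exact_mod_cast this
      rw [Int.even_iff, Int.even_iff] at hpar
      omega
    rw [e1, e2]

lemma dichotomy [Countable A] : (∃ Γ : (ℕ →₀ ℤ) → A, GoodMap Γ) ∨
    ∃ n : ℕ, ∀ S : Set A, S.Finite → ∃ V : Fin (n + 1) → Set (Set A),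
      (∀ x, ∃ c, ∃ u ∈ V c, x ∈ u) ∧
      (∃ B : Set A, B.Finite ∧ ∀ c, ∀ u ∈ V c, ∀ x ∈ u, ∀ y ∈ u, y - x ∈ B) ∧
      ∀ c, ∀ u ∈ V c, ∀ v ∈ V c, u ≠ v → ∀ x ∈ u, ∀ y ∈ v, y - x ∉ S := by
  obtain ⟨s, hs, hmax⟩ := exists_maximal_linearIndepOn ℤ (id : A → A)
  have hmax' : ∀ x, ∃ n : ℤ, n ≠ 0 ∧ n • x ∈ AddSubgroup.closure s := by
    intro x
    by_cases hx : x ∈ s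
    · exact ⟨1, one_ne_zero, by simpa using AddSubgroup.subset_closure hx⟩
    · obtain ⟨n, hn, h⟩ := hmax x hx
      refine ⟨n, hn, ?_⟩
      rw [← Submodule.span_int_eq_addSubgroupClosure, Submodule.mem_toAddSubgroup]
      simpa using h
  rcases Set.finite_or_infinite s with hf | hi
  · right
    have : Finite s := hf
    have hc : 0 < Nat.card (s → Bool) := Nat.card_pos
    refine ⟨Nat.card (s → Bool) - 1, fun S hS => ?_⟩
    obtain ⟨V, h1, h2, h3⟩ := finite_rank (fun i : s => (i : A)) hs (by simpa using hmax') S hS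
    let e : (s → Bool) ≃ Fin (Nat.card (s → Bool) - 1 + 1) :=
      (Finite.equivFin _).trans (finCongr (by omega))
    refine ⟨fun i => V (e.symm i), ?_, ?_, fun c => h3 _⟩
    · intro x
      obtain ⟨c, u, hu, hx⟩ := h1 x
      exact ⟨e c, u, by simpa using hu, hx⟩
    · obtain ⟨B, hB, h⟩ := h2
      exact ⟨B, hB, fun c => h _⟩
  · left
    have : Infinite s := hi.to_subtype
    obtain ⟨e⟩ : Nonempty (ℕ ≃ s) := by
      have := (nonempty_denumerable s).some
      exact ⟨(Denumerable.eqv s).symm⟩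
    refine infinite_rank (fun n => (e n : A)) (LinearIndependent.comp hs e e.injective) ?_
    have : Set.range (fun n => (e n : A)) = s := by
      have h : (fun n => (e n : A)) = Subtype.val ∘ e := rfl
      rw [h, e.surjective.range_comp]; simp
    rw [this]
    exact hmax'

end grp
end ZInf

namespace ZInf

lemma fin_bound {B : Type} (S : Set B) (hS : S.Finite) (f : B → ℝ) :
    ∃ ε : ℝ, 0 ≤ ε ∧ ∀ b ∈ S, f b ≤ ε := by
  obtain ⟨ε, hε⟩ := (hS.image f).bddAbove
  exact ⟨max ε 0, le_max_right _ _, fun b hb => le_max_of_le_left (hε ⟨b, hb, rfl⟩)⟩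

lemma inv_eq {A : Type} [AddCommGroup A] (d : A → A → ℝ)
    (hd : ∀ a x y : A, d (a + x) (a + y) = d x y) (x y : A) : d x y = d 0 (y - x) := by
  have := hd x 0 (y - x)
  simpa using this

/-- weighted length function on the direct sum -/
noncomputable def nu (z : ℕ →₀ ℤ) : ℝ := z.sum fun i n => ((i : ℝ) + 1) * |(n : ℝ)|

lemma nu_nonneg (z : ℕ →₀ ℤ) : 0 ≤ nu z := Finset.sum_nonneg fun i _ => by positivity

lemma nu_term (z : ℕ →₀ ℤ) (i : ℕ) : ((i : ℝ) + 1) * |(z i : ℝ)| ≤ nu z := by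
  by_cases h : i ∈ z.support
  · exact Finset.single_le_sum (f := fun i : ℕ => ((i : ℝ) + 1) * |(z i : ℝ)|)
      (fun i _ => by positivity) h
  · have : z i = 0 := by simpa using h
    rw [this]; simpa using nu_nonneg z

lemma nu_neg (z : ℕ →₀ ℤ) : nu (-z) = nu z := by
  unfold nu
  rw [Finsupp.sum_neg_index (by simp)]
  simp

lemma nu_add (z w : ℕ →₀ ℤ) : nu (z + w) ≤ nu z + nu w := by
  classical
  have h : ∀ v : ℕ →₀ ℤ, v.support ⊆ z.support ∪ w.support →
      nu v = ∑ i ∈ z.support ∪ w.support, ((i : ℝ) + 1) * |(v i : ℝ)| := fun v hv =>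
    Finsupp.sum_of_support_subset _ hv _ (by simp)
  rw [h _ Finsupp.support_add, h z Finset.subset_union_left, h w Finset.subset_union_right,
    ← Finset.sum_add_distrib]
  apply Finset.sum_le_sum
  intro i _
  rw [← mul_add]
  apply mul_le_mul_of_nonneg_left _ (by positivity)
  simpa using abs_add_le (z i : ℝ) (w i)

lemma nu_zero (z : ℕ →₀ ℤ) : nu z = 0 ↔ z = 0 := by
  constructor
  · intro h
    ext i
    have h1 := nu_term z i
    rw [h] at h1
    have h2 : |(z i : ℝ)| ≤ 0 := by
      by_contra hc
      push Not at hc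
      have : 0 < ((i : ℝ) + 1) * |(z i : ℝ)| := by positivity
      linarith
    have := abs_eq_zero.1 (le_antisymm h2 (abs_nonneg _))
    exact_mod_cast this
  · rintro rfl; simp [nu]

lemma nu_fin (r : ℝ) : {z | nu z ≤ r}.Finite := by
  obtain ⟨N, hN⟩ := exists_nat_ge r
  apply (finbox N N).subset
  intro z hz j
  have h1 := nu_term z j
  have hz' : nu z ≤ r := hz
  constructor
  · have : |(z j : ℝ)| ≤ N := by
      have : 0 ≤ (j : ℝ) * |(z j : ℝ)| := by positivity
      linarith
    exact_mod_cast this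
  · intro hj
    by_contra hne
    have h2 : (1 : ℝ) ≤ |(z j : ℝ)| := by exact_mod_cast Int.one_le_abs hne
    have h3 : (N : ℝ) ≤ j := by exact_mod_cast hj
    nlinarith

lemma asdim_inf (G : Type) [MetricSpace G] (d : (ℕ →₀ ℤ) → (ℕ →₀ ℤ) → ℝ)
    (hd : ∀ a x y : ℕ →₀ ℤ, d (a + x) (a + y) = d x y)
    (hp : ∀ (x : ℕ →₀ ℤ) (r : ℝ), {y : ℕ →₀ ℤ | d x y ≤ r}.Finite)
    (h : BijCoarseEquivTo G d) (n : ℕ) : ¬ ASDimLE G n := by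
  intro has
  obtain ⟨F, hF, h1, h2⟩ := h
  obtain ⟨δ, hδ, hδZ⟩ := fin_bound _ (finbox (n + 1) (2 * (n + 1))) (fun z => d 0 z)
  obtain ⟨ε, hε, hε2⟩ := h2 δ hδ
  obtain ⟨U, hcov, ⟨m, hm⟩, hdis⟩ := has (ε + 1) (by linarith)
  obtain ⟨ε', hε', hm'⟩ := h1 (max m 0) (le_max_right _ _)
  obtain ⟨M, hM⟩ : ∃ M : ℕ, ∀ i < n + 1, ∀ z, d 0 z ≤ ε' → |z i| ≤ (M : ℤ) := by
    have hf : (⋃ i ∈ Set.Iio (n + 1), (fun z : ℕ →₀ ℤ => |z i|) '' {z | d 0 z ≤ ε'}).Finite :=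
      (Set.finite_Iio _).biUnion (fun i _ => (hp 0 ε').image _)
    obtain ⟨M, hM⟩ := hf.bddAbove
    refine ⟨M.toNat, fun i hi z hz => ?_⟩
    have : |z i| ≤ M := hM (by
      simp only [Set.mem_iUnion]
      exact ⟨i, hi, z, hz, rfl⟩)
    omega
  refine hex (n + 1) M (fun i => {w | ∃ hi : i < n + 1, ∃ u ∈ U ⟨i, hi⟩, w = F '' u}) ?_ ?_ ?_
  · intro x
    obtain ⟨g, rfl⟩ := hF.2 x
    obtain ⟨i, u, hu, hg⟩ := hcov g
    exact ⟨i, i.2, _, ⟨i.2, u, hu, rfl⟩, g, hg, rfl⟩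
  · rintro i _ ⟨hi, u, hu, rfl⟩ _ ⟨x, hx, rfl⟩ _ ⟨y, hy, rfl⟩
    have e1 : edist y x ≤ ENNReal.ofReal m :=
      (Metric.edist_le_ediam_of_mem hy hx).trans (hm _ u hu)
    have e2 : dist y x ≤ max m 0 := by
      rw [edist_dist] at e1
      have e1' : ENNReal.ofReal (dist y x) ≤ ENNReal.ofReal (max m 0) :=
        e1.trans (ENNReal.ofReal_le_ofReal (le_max_left _ _))
      exact (ENNReal.ofReal_le_ofReal_iff (le_max_right _ _)).1 e1'
    have e3 := hm' _ _ e2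
    rw [inv_eq d hd] at e3
    simpa using hM i hi _ e3
  · rintro i _ ⟨hi, u, hu, rfl⟩ _ ⟨hi', v, hv, rfl⟩ _ ⟨x, hx, rfl⟩ _ ⟨y, hy, rfl⟩ hn
    by_contra hne
    have huv : u ≠ v := fun h => hne (by rw [h])
    have e1 := hdis _ u hu v hv huv x hx y hy
    have e2 : d (F x) (F y) ≤ δ := by
      rw [inv_eq d hd]
      apply hδZ
      intro j
      have := hn j
      rw [abs_sub_comm] at this
      exact ⟨by simpa using this.1, fun hj => by simp [this.2 hj]⟩
    have := hε2 x y e2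
    linarith

lemma asdim_fin (G : Type) [MetricSpace G] {A : Type} [AddCommGroup A] (d : A → A → ℝ)
    (hd : ∀ a x y : A, d (a + x) (a + y) = d x y)
    (hp : ∀ (x : A) (r : ℝ), {y : A | d x y ≤ r}.Finite)
    (h : BijCoarseEquivTo G d) (n : ℕ)
    (hn : ∀ S : Set A, S.Finite → ∃ V : Fin (n + 1) → Set (Set A),
      (∀ x, ∃ c, ∃ u ∈ V c, x ∈ u) ∧
      (∃ B : Set A, B.Finite ∧ ∀ c, ∀ u ∈ V c, ∀ x ∈ u, ∀ y ∈ u, y - x ∈ B) ∧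
      ∀ c, ∀ u ∈ V c, ∀ v ∈ V c, u ≠ v → ∀ x ∈ u, ∀ y ∈ v, y - x ∉ S) : ASDimLE G n := by
  intro D hD
  obtain ⟨F, hF, h1, h2⟩ := h
  obtain ⟨ε, hε, hε1⟩ := h1 D hD
  obtain ⟨V, hcov, ⟨B, hB, hVB⟩, hV⟩ := hn _ (hp 0 ε)
  obtain ⟨δ, hδ, hδB⟩ := fin_bound B hB (fun z => d 0 z)
  obtain ⟨ε', hε', hε2⟩ := h2 δ hδ
  refine ⟨fun i => {w | ∃ u ∈ V i, w = F ⁻¹' u}, ?_, ⟨ε', ?_⟩, ?_⟩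
  · intro x
    obtain ⟨c, u, hu, hx⟩ := hcov (F x)
    exact ⟨c, _, ⟨u, hu, rfl⟩, hx⟩
  · rintro i _ ⟨u, hu, rfl⟩
    apply Metric.ediam_le
    intro x hx y hy
    rw [edist_dist]
    apply ENNReal.ofReal_le_ofReal
    apply hε2
    rw [inv_eq d hd]
    exact hδB _ (hVB i u hu _ hx _ hy)
  · rintro i _ ⟨u, hu, rfl⟩ _ ⟨v, hv, rfl⟩ hne x hx y hy
    by_contra hlt
    push Not at hlt
    refine hV i u hu v hv (fun h => hne (by rw [h])) _ hx _ hy ?_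
    have := hε1 x y hlt.le
    rw [inv_eq d hd] at this
    exact this

lemma to_zinf (G : Type) [MetricSpace G] {A : Type} [AddCommGroup A] (d : A → A → ℝ)
    (hd : ∀ a x y : A, d (a + x) (a + y) = d x y)
    (hp : ∀ (x : A) (r : ℝ), {y : A | d x y ≤ r}.Finite)
    (h : BijCoarseEquivTo G d) (Γ : (ℕ →₀ ℤ) → A) (hΓ : GoodMap Γ) :
    BijCoarseEquivTo G (fun x y : ℕ →₀ ℤ => nu (y - x)) := by
  obtain ⟨F, hF, h1, h2⟩ := h
  obtain ⟨hb, hf, hg⟩ := hΓ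
  let e := Equiv.ofBijective Γ hb
  have he : ∀ x, Γ (e.symm x) = x := fun x => e.apply_symm_apply x
  refine ⟨fun x => e.symm (F x), e.symm.bijective.comp hF, ?_, ?_⟩
  · intro δ hδ
    obtain ⟨ε, hε, hε1⟩ := h1 δ hδ
    choose S hS hSz using hg
    obtain ⟨ε', hε', hb'⟩ := fin_bound _ ((hp 0 ε).biUnion (fun g _ => hS g)) nu
    refine ⟨ε', hε', fun x y hxy => hb' _ ?_⟩
    have h3 := hε1 x y hxy
    rw [inv_eq d hd] at h3
    obtain ⟨s, hs, hse⟩ := hSz (F y - F x) (e.symm (F x))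
    rw [he, add_sub_cancel, ← he (F y)] at hse
    have h4 := hb.1 hse
    show e.symm (F y) - e.symm (F x) ∈ _
    rw [← h4, add_sub_cancel_left]
    simp only [Set.mem_iUnion]
    refine ⟨F y - F x, h3, ?_⟩
    exact hs
  · intro δ hδ
    obtain ⟨ε, hε, hb'⟩ := fin_bound _ ((nu_fin δ).biUnion (fun s _ => hf s)) (fun g => d 0 g)
    obtain ⟨ε', hε', hε2⟩ := h2 ε hε
    refine ⟨ε', hε', fun x y hxy => hε2 _ _ ?_⟩
    rw [inv_eq d hd]
    apply hb'
    simp only [Set.mem_iUnion]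
    refine ⟨_, hxy, e.symm (F x), ?_⟩
    simp [he]

end ZInf

/-- A countable group `G` with a proper left-invariant metric is bijectively coarsely
equivalent to `ℤ^∞ = ⊕_{i ∈ ℕ} ℤ` (with a proper left-invariant metric) iff `G` is
bijectively coarsely equivalent to some countable abelian group (with a proper
left-invariant metric) and `asdim G = ∞`. -/
theorem bijectively_coarsely_equiv_Zinfty_iff
    (G : Type) [Group G] [Countable G] [MetricSpace G]
    (hinv : ∀ g x y : G, dist (g * x) (g * y) = dist x y)
    (hprop : ∀ (x : G) (r : ℝ), {y : G | dist x y ≤ r}.Finite) :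
    (∃ d : (ℕ →₀ ℤ) → (ℕ →₀ ℤ) → ℝ, IsMetricFun d ∧
      (∀ a x y : ℕ →₀ ℤ, d (a + x) (a + y) = d x y) ∧
      (∀ (x : ℕ →₀ ℤ) (r : ℝ), {y : ℕ →₀ ℤ | d x y ≤ r}.Finite) ∧
      BijCoarseEquivTo G d) ↔
    ((∃ (A : Type) (_ : AddCommGroup A), Countable A ∧
        ∃ d : A → A → ℝ, IsMetricFun d ∧
          (∀ a x y : A, d (a + x) (a + y) = d x y) ∧
          (∀ (x : A) (r : ℝ), {y : A | d x y ≤ r}.Finite) ∧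
          BijCoarseEquivTo G d) ∧
      ∀ n : ℕ, ¬ ASDimLE G n) := by
  constructor
  · rintro ⟨d, hm, hd, hp, hb⟩
    exact ⟨⟨ℕ →₀ ℤ, inferInstance, inferInstance, d, hm, hd, hp, hb⟩,
      ZInf.asdim_inf G d hd hp hb⟩
  · rintro ⟨⟨A, _, _, d, hm, hd, hp, hb⟩, has⟩
    rcases ZInf.dichotomy (A := A) with ⟨Γ, hΓ⟩ | ⟨n, hn⟩
    · refine ⟨fun x y => ZInf.nu (y - x), ⟨?_, ?_, ?_⟩, ?_, ?_,
        ZInf.to_zinf G d hd hp hb Γ hΓ⟩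
      · intro x y
        rw [ZInf.nu_zero, sub_eq_zero, eq_comm]
      · intro x y
        show ZInf.nu (y - x) = ZInf.nu (x - y)
        rw [← ZInf.nu_neg, neg_sub]
      · intro x y z
        have := ZInf.nu_add (y - x) (z - y)
        rwa [show y - x + (z - y) = z - x by abel] at this
      · intro a x y
        simp
      · intro x r
        have h := (ZInf.nu_fin r).image (fun z => z + x)
        apply h.subset
        intro y hy
        exact ⟨y - x, hy, by simp⟩
    · exact absurd (ZInf.asdim_fin G d hd hp hb n hn) (has n)
end

section
/- A finitely generated group G admits a quasi-isometric embedding into a finitely generated abelian group (with respect to word metrics) if and only if G is abelian-by-finite. -/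
/-- The word metric on a group with respect to a set `S` of generators:
`wordDist S x y` is the least `n` such that `x⁻¹ * y` is a product of `n` elements
of `S`. -/
noncomputable def wordDist {K : Type*} [Group K] (S : Set K) (x y : K) : ℕ :=
  sInf {n : ℕ | ∃ l : List K, (∀ a ∈ l, a ∈ S) ∧ l.length = n ∧ l.prod = x⁻¹ * y}

/-- `S` is a finite symmetric generating set of the group `K`. -/
def IsWordGenSet {K : Type*} [Group K] (S : Finset K) : Prop :=
  (∀ a ∈ S, a⁻¹ ∈ S) ∧ Subgroup.closure (S : Set K) = ⊤

/-- A group is abelian-by-finite: it has an abelian normal subgroup with finite quotient. -/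
def AbelianByFinite (G : Type*) [Group G] : Prop :=
  ∃ N : Subgroup G, N.Normal ∧ (∀ a b : G, a ∈ N → b ∈ N → a * b = b * a) ∧ Finite (G ⧸ N)


namespace QI

/-- word length -/
noncomputable def len {K : Type*} [Group K] (S : Set K) (g : K) : ℕ := wordDist S 1 g

section
variable {K : Type*} [Group K] {S : Finset K}

lemma wordDist_eq_len (x y : K) : wordDist (S : Set K) x y = len (S : Set K) (x⁻¹ * y) := by
  simp [len, wordDist]

lemma exists_list (hS : IsWordGenSet S) (g : K) :
    ∃ l : List K, (∀ a ∈ l, a ∈ S) ∧ l.prod = g := by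
  have hg : g ∈ Subgroup.closure (S : Set K) := by rw [hS.2]; trivial
  induction hg using Subgroup.closure_induction with
  | mem x hx => exact ⟨[x], by simpa using hx, by simp⟩
  | one => exact ⟨[], by simp, by simp⟩
  | mul x y _ _ hx hy =>
    obtain ⟨l, hl, rfl⟩ := hx
    obtain ⟨m, hm, rfl⟩ := hy
    refine ⟨l ++ m, ?_, by simp⟩
    intro a ha
    rcases List.mem_append.1 ha with h | h
    · exact hl a h
    · exact hm a h
  | inv x _ hx =>
    obtain ⟨l, hl, rfl⟩ := hx
    refine ⟨(l.map (·⁻¹)).reverse, ?_, by rw [List.prod_inv_reverse]⟩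
    intro a ha
    simp only [List.mem_reverse, List.mem_map] at ha
    obtain ⟨c, hc, rfl⟩ := ha
    exact hS.1 _ (hl c hc)

lemma exists_list_len (hS : IsWordGenSet S) (g : K) :
    ∃ l : List K, (∀ a ∈ l, a ∈ S) ∧ l.length = len (S : Set K) g ∧ l.prod = g := by
  have := Nat.sInf_mem (s := {n : ℕ | ∃ l : List K, (∀ a ∈ l, a ∈ (S : Set K)) ∧ l.length = n ∧
    l.prod = (1:K)⁻¹ * g}) (by
      obtain ⟨l, hl, h⟩ := exists_list hS g
      exact ⟨_, l, hl, rfl, by simpa using h⟩)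
  obtain ⟨l, hl, h1, h2⟩ := this
  exact ⟨l, hl, h1, by simpa using h2⟩

lemma len_le_of_list (l : List K) (hl : ∀ a ∈ l, a ∈ S) : len (S : Set K) l.prod ≤ l.length :=
  Nat.sInf_le ⟨l, hl, rfl, by simp⟩

lemma len_one : len (S : Set K) 1 = 0 := by
  have := len_le_of_list (S := S) [] (by simp)
  simpa using this

lemma len_mul_le (hS : IsWordGenSet S) (g h : K) :
    len (S : Set K) (g * h) ≤ len (S : Set K) g + len (S : Set K) h := by
  obtain ⟨l, hl, h1, h2⟩ := exists_list_len hS g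
  obtain ⟨m, hm, h3, h4⟩ := exists_list_len hS h
  rw [← h1, ← h3, ← List.length_append]
  conv_lhs => rw [← h2, ← h4, ← List.prod_append]
  apply len_le_of_list
  intro a ha
  rcases List.mem_append.1 ha with h | h
  · exact hl a h
  · exact hm a h

lemma len_mem_le {s : K} (hs : s ∈ S) : len (S : Set K) s ≤ 1 := by
  have := len_le_of_list (S := S) [s] (by simpa using hs)
  simpa using this

lemma eq_one_of_len (hS : IsWordGenSet S) {g : K} (h : len (S : Set K) g = 0) : g = 1 := by
  obtain ⟨l, hl, h1, h2⟩ := exists_list_len hS g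
  rw [h, List.length_eq_zero_iff] at h1
  subst h1
  simpa using h2.symm

/-- If `F` grows by at most `c` along multiplication by a generator on the right,
then it is bounded by `c * len`. -/
lemma le_len_of_step (hS : IsWordGenSet S) (F : K → ℝ) (c : ℝ) (h1 : F 1 ≤ 0)
    (hstep : ∀ g, ∀ s ∈ S, F (g * s) ≤ F g + c) (g : K) : F g ≤ c * len (S : Set K) g := by
  obtain ⟨l, hl, h2, h3⟩ := exists_list_len hS g
  have key : ∀ l : List K, (∀ a ∈ l, a ∈ S) → ∀ x, F (x * l.prod) ≤ F x + c * l.length := by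
    intro l
    induction l with
    | nil => intro _ x; simp
    | cons a l ih =>
      intro h x
      have h4 := ih (fun b hb => h b (by simp [hb])) (x * a)
      have h5 := hstep x a (h a (by simp))
      simp only [List.prod_cons, List.length_cons, ← mul_assoc]
      push_cast
      linarith
  have := key l hl 1
  rw [one_mul, h3, h2] at this
  linarith

lemma finite_len_le (hS : IsWordGenSet S) (n : ℕ) : {g : K | len (S : Set K) g ≤ n}.Finite := by
  have : {g : K | len (S : Set K) g ≤ n} ⊆
      ⋃ k ∈ Set.Iic n, (fun v : Fin k → S => (List.ofFn (fun i => (v i : K))).prod) '' Set.univ := by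
    intro g hg
    obtain ⟨l, hl, h1, h2⟩ := exists_list_len hS g
    simp only [Set.mem_iUnion]
    refine ⟨l.length, by rw [h1]; exact hg, fun i => ⟨l.get i, hl _ (List.get_mem _ _)⟩, trivial, ?_⟩
    simp [h2]
  refine Set.Finite.subset (Set.Finite.biUnion (Set.finite_Iic n) fun k _ => Set.toFinite _) this

end
end QI

namespace QI
section walk
variable {G : Type} [Group G] (S : Finset G)

open Classical in
/-- law of the random walk driven by the uniform measure on `S` -/
noncomputable def pw : ℕ → G → ℝ
  | 0 => fun x => if x = 1 then 1 else 0
  | n + 1 => fun x => (∑ s ∈ S, pw n (s⁻¹ * x)) / (S.card : ℝ)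

lemma pw_nonneg (n : ℕ) (x : G) : 0 ≤ pw S n x := by
  induction n generalizing x with
  | zero => simp only [pw]; split_ifs <;> norm_num
  | succ n ih => 
    simp only [pw]
    exact div_nonneg (Finset.sum_nonneg fun s _ => ih _) (Nat.cast_nonneg _)

lemma pw_fin (n : ℕ) : (Function.support (pw S n)).Finite := by
  induction n with
  | zero => 
    refine (Set.finite_singleton (1:G)).subset ?_
    intro x hx
    simp only [pw, Function.mem_support] at hx
    by_contra h
    exact hx (if_neg h)
  | succ n ih =>
    have : Function.support (pw S (n+1)) ⊆ ⋃ s ∈ S, (fun x => s * x) '' Function.support (pw S n) := by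
      intro x hx
      simp only [pw, Function.mem_support] at hx
      have : ∑ s ∈ S, pw S n (s⁻¹ * x) ≠ 0 := by
        intro h; rw [h] at hx; simp at hx
      obtain ⟨s, hs, h⟩ := Finset.exists_ne_zero_of_sum_ne_zero this
      simp only [Set.mem_iUnion]
      exact ⟨s, hs, s⁻¹ * x, h, by simp⟩
    exact (Set.Finite.biUnion S.finite_toSet fun s _ => ih.image _).subset this

lemma pw_fin_translate (n : ℕ) (s : G) : (Function.support (fun x => pw S n (s * x))).Finite := by
  have := (pw_fin S n).preimage (f := fun x => s * x) (mul_right_injective s).injOn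
  exact this

lemma summable_of_supp {f g : G → ℝ} (hf : (Function.support f).Finite)
    (h : ∀ x, f x = 0 → g x = 0) : Summable g := by
  refine summable_of_finite_support (hf.subset ?_)
  intro x hx hx'
  exact hx (h x hx')

lemma pw_summable (n : ℕ) (F : G → ℝ) : Summable fun x => pw S n x * F x :=
  summable_of_supp (pw_fin S n) (by intro x h; simp [h])

lemma pw_summable' (n : ℕ) (s : G) (F : G → ℝ) : Summable fun x => pw S n (s * x) * F x :=
  summable_of_supp (pw_fin_translate S n s) (by intro x h; simp [h])

/-- expectation -/
noncomputable def EE (n : ℕ) (F : G → ℝ) : ℝ := ∑' x, pw S n x * F x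

lemma EE_zero (F : G → ℝ) : EE S 0 F = F 1 := by
  unfold EE
  rw [tsum_eq_single 1]
  · simp [pw]
  · intro x hx; simp [pw, hx]

lemma EE_translate (n : ℕ) (s : G) (F : G → ℝ) :
    ∑' x, pw S n (s⁻¹ * x) * F x = EE S n (fun x => F (s * x)) := by
  unfold EE
  rw [← (Equiv.mulLeft s).tsum_eq]
  simp

lemma EE_succ (n : ℕ) (F : G → ℝ) :
    EE S (n+1) F = (∑ s ∈ S, EE S n (fun x => F (s * x))) / (S.card : ℝ) := by
  simp_rw [← EE_translate]
  rw [← Summable.tsum_finsetSum (fun s _ => pw_summable' S n _ F), ← tsum_div_const]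
  unfold EE
  congr 1
  ext x
  simp only [pw]
  rw [div_mul_eq_mul_div, Finset.sum_mul]

lemma EE_add (n : ℕ) (F F' : G → ℝ) : EE S n (fun x => F x + F' x) = EE S n F + EE S n F' := by
  unfold EE
  rw [← (pw_summable S n F).tsum_add (pw_summable S n F')]
  simp_rw [mul_add]

lemma EE_smul (n : ℕ) (c : ℝ) (F : G → ℝ) : EE S n (fun x => c * F x) = c * EE S n F := by
  unfold EE
  rw [← tsum_mul_left]
  congr 1; ext x; ring

lemma EE_mono (n : ℕ) {F F' : G → ℝ} (h : ∀ x, F x ≤ F' x) : EE S n F ≤ EE S n F' := by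
  unfold EE
  refine (pw_summable S n F).tsum_le_tsum (fun x => ?_) (pw_summable S n F')
  exact mul_le_mul_of_nonneg_left (h x) (pw_nonneg S n x)

lemma EE_const (hS : S.Nonempty) (n : ℕ) (c : ℝ) : EE S n (fun _ => c) = c := by
  induction n with
  | zero => simp [EE_zero]
  | succ n ih => 
    have : (S.card : ℝ) ≠ 0 := by simp [hS.ne_empty]
    rw [EE_succ, ih]; simp; field_simp

lemma EE_nonneg (n : ℕ) {F : G → ℝ} (h : ∀ x, 0 ≤ F x) : 0 ≤ EE S n F :=
  tsum_nonneg fun x => mul_nonneg (pw_nonneg S n x) (h x)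

lemma pw_sum (hS : S.Nonempty) (n : ℕ) : ∑' x, pw S n x = 1 := by
  have := EE_const S hS n 1
  simpa [EE] using this

lemma pw_le (hS : S.Nonempty) (n : ℕ) {t : G} (ht : t ∈ S) (x : G) :
    pw S n (t⁻¹ * x) ≤ S.card * pw S (n+1) x := by
  have : (S.card : ℝ) ≠ 0 := by simp [hS.ne_empty]
  simp only [pw]
  rw [mul_div_cancel₀ _ this]
  exact Finset.single_le_sum (f := fun s => pw S n (s⁻¹ * x)) (fun s _ => pw_nonneg S n _) ht

/-- Hellinger type distance -/
noncomputable def hel (n : ℕ) (t : G) : ℝ :=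
  ∑' x, (Real.sqrt (pw S n (t⁻¹ * x)) - Real.sqrt (pw S (n+1) x))^2

lemma fin_union (n : ℕ) (t : G) : (Function.support (fun x => pw S n (t⁻¹ * x)) ∪ 
    Function.support (pw S (n+1))).Finite := (pw_fin_translate S n t⁻¹).union (pw_fin S (n+1))

lemma summable_union (n : ℕ) (t : G) (g : G → ℝ)
    (h : ∀ x, pw S n (t⁻¹ * x) = 0 → pw S (n+1) x = 0 → g x = 0) : Summable g := by
  refine summable_of_finite_support ((fin_union S n t).subset ?_)
  intro x hx
  by_contra hc
  simp only [Set.mem_union, Function.mem_support, not_or, not_not] at hc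
  exact hx (h x hc.1 hc.2)

lemma hel_summable (n : ℕ) (t : G) : 
    Summable fun x => (Real.sqrt (pw S n (t⁻¹ * x)) - Real.sqrt (pw S (n+1) x))^2 :=
  summable_union S n t _ (by intro x h1 h2; simp [h1, h2])

/-- entropy -/
noncomputable def ent (n : ℕ) : ℝ := ∑' x, Real.negMulLog (pw S n x)

lemma scalar_ineq {a b : ℝ} (ha : 0 ≤ a) (hb : 0 ≤ b) (hab : b = 0 → a = 0) :
    (Real.sqrt a - Real.sqrt b)^2 ≤ a * Real.log a - a * Real.log b - a + b := by
  rcases ha.eq_or_lt with rfl | ha'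
  · simp [Real.sq_sqrt hb]
  have hb' : 0 < b := lt_of_le_of_ne hb (fun h => ha'.ne' (hab h.symm))
  have h1 := Real.log_le_sub_one_of_pos (x := Real.sqrt b / Real.sqrt a) (by positivity)
  rw [Real.log_div (by positivity) (by positivity), Real.log_sqrt hb, Real.log_sqrt ha] at h1
  have h2 : a * (Real.sqrt b / Real.sqrt a) = Real.sqrt a * Real.sqrt b := by
    have := Real.mul_self_sqrt ha
    have h3 : Real.sqrt a ≠ 0 := by positivity
    field_simp
    nlinarith
  have h3 := mul_le_mul_of_nonneg_left h1 ha
  have h4 : a * (Real.sqrt b / Real.sqrt a - 1) = Real.sqrt a * Real.sqrt b - a := by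
    rw [mul_sub, h2, mul_one]
  rw [h4] at h3
  have e1 := Real.sq_sqrt ha
  have e2 := Real.sq_sqrt hb
  nlinarith

lemma ent_step (hS : S.Nonempty) (n : ℕ) :
    ∑ t ∈ S, hel S n t ≤ S.card * (ent S (n+1) - ent S n) := by
  have hk : (S.card : ℝ) ≠ 0 := by simp [hS.ne_empty]
  have hsum : ∀ x, S.card * pw S (n+1) x = ∑ t ∈ S, pw S n (t⁻¹ * x) := by
    intro x; simp only [pw]; rw [mul_div_cancel₀ _ hk]
  -- entropy of translate
  have e1 : ∀ t ∈ S, ent S n = ∑' x, Real.negMulLog (pw S n (t⁻¹ * x)) := by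
    intro t _
    unfold ent
    rw [← (Equiv.mulLeft t⁻¹).tsum_eq]
    simp
  have s1 : ∀ t ∈ S, Summable fun x => Real.negMulLog (pw S n (t⁻¹ * x)) := by
    intro t _
    exact summable_of_supp (pw_fin_translate S n t⁻¹) (by intro x h; simp [h])
  have s2 : Summable fun x => Real.negMulLog (pw S (n+1) x) :=
    summable_of_supp (pw_fin S (n+1)) (by intro x h; simp [h])
  have e2 : S.card * (ent S (n+1) - ent S n) = 
      ∑' x, (S.card * Real.negMulLog (pw S (n+1) x) - ∑ t ∈ S, Real.negMulLog (pw S n (t⁻¹ * x))) := by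
    rw [Summable.tsum_sub (s2.mul_left _) (summable_sum s1), Summable.tsum_finsetSum s1, 
      ← Finset.sum_congr rfl e1, tsum_mul_left]
    simp [ent]
    ring
  rw [e2]
  unfold hel
  rw [← Summable.tsum_finsetSum (fun t _ => hel_summable S n t)]
  refine Summable.tsum_le_tsum ?_ (summable_sum fun t _ => hel_summable S n t) 
    ((s2.mul_left _).sub (summable_sum s1))
  intro x
  have h1 : ∀ t ∈ S, (Real.sqrt (pw S n (t⁻¹ * x)) - Real.sqrt (pw S (n+1) x))^2 ≤ 
      - Real.negMulLog (pw S n (t⁻¹ * x)) - pw S n (t⁻¹ * x) * Real.log (pw S (n+1) x) 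
        - pw S n (t⁻¹ * x) + pw S (n+1) x := by
    intro t ht
    have := scalar_ineq (pw_nonneg S n (t⁻¹ * x)) (pw_nonneg S (n+1) x) (by
      intro h
      have := pw_le S hS n ht x
      rw [h, mul_zero] at this
      exact le_antisymm this (pw_nonneg S n _))
    rw [Real.negMulLog]
    linarith
  refine (Finset.sum_le_sum h1).trans ?_
  rw [Finset.sum_add_distrib, Finset.sum_sub_distrib, Finset.sum_sub_distrib, ← Finset.sum_mul, ← hsum,
    Finset.sum_neg_distrib, Finset.sum_const, nsmul_eq_mul, Real.negMulLog]
  apply le_of_eq; ring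

lemma ent_le (hS : S.Nonempty) (n : ℕ) : 
    ent S n ≤ Real.log ((Function.support (pw S n)).ncard) := by
  have hfin := pw_fin S n
  set B := hfin.toFinset with hB
  have hcard : (Function.support (pw S n)).ncard = B.card := Set.ncard_eq_toFinset_card _ hfin
  have hsum : ∑ x ∈ B, pw S n x = 1 := by
    rw [← pw_sum S hS n, tsum_eq_sum]
    intro x hx
    simpa [hB] using hx
  have hBne : 0 < (B.card : ℝ) := by
    have : B.Nonempty := by
      by_contra h
      rw [Finset.not_nonempty_iff_eq_empty] at h
      rw [h] at hsum
      simp at hsum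
    exact_mod_cast this.card_pos
  have h1 : ent S n = ∑ x ∈ B, Real.negMulLog (pw S n x) := by
    unfold ent
    rw [tsum_eq_sum]
    intro x hx
    have : pw S n x = 0 := by simpa [hB] using hx
    simp [this]
  rw [h1, hcard]
  have h2 : ∀ x ∈ B, Real.negMulLog (pw S n x) ≤ pw S n x * Real.log B.card + ((B.card : ℝ)⁻¹ - pw S n x) := by
    intro x hx
    have hp : 0 < pw S n x := lt_of_le_of_ne (pw_nonneg S n x) (by
      have : pw S n x ≠ 0 := by simpa [hB] using hx
      exact this.symm)
    have := Real.log_le_sub_one_of_pos (x := (B.card : ℝ)⁻¹ / pw S n x) (by positivity)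
    rw [Real.log_div (by positivity) hp.ne', Real.log_inv] at this
    have h3 := mul_le_mul_of_nonneg_left this hp.le
    rw [mul_sub, mul_sub, mul_div_cancel₀ _ hp.ne'] at h3
    rw [Real.negMulLog]
    linarith
  refine (Finset.sum_le_sum h2).trans ?_
  rw [Finset.sum_add_distrib, ← Finset.sum_mul, Finset.sum_sub_distrib, hsum]
  simp
  field_simp
  simp

theorem exists_good (hS : S.Nonempty) (C : ℝ) (d : ℕ) 
    (hgr : ∀ n : ℕ, ((Function.support (pw S n)).ncard : ℝ) ≤ C * ((n:ℝ) + 1)^d) :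
    ∃ K : ℝ, 0 < K ∧ ∃ᶠ n in Filter.atTop, ∀ t ∈ S, hel S n t ≤ K / ((n:ℝ)+1) := by
  have hk : 0 < (S.card : ℝ) := by exact_mod_cast hS.card_pos
  have hent : ∀ n : ℕ, ent S n ≤ Real.log C + d * Real.log ((n:ℝ)+1) := by
    intro n
    have hpos : 0 < ((Function.support (pw S n)).ncard : ℝ) := by
      have : (Function.support (pw S n)).Nonempty := by
        by_contra h
        rw [Set.not_nonempty_iff_eq_empty, Function.support_eq_empty_iff] at h
        have := pw_sum S hS n
        simp [h] at this
      exact_mod_cast (Set.ncard_pos (pw_fin S n)).2 this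
    have hC : 0 < C := by
      have := hpos.trans_le (hgr n)
      by_contra h
      have : C * ((n:ℝ)+1)^d ≤ 0 := mul_nonpos_of_nonpos_of_nonneg (not_lt.1 h) (by positivity)
      linarith
    refine (ent_le S hS n).trans ((Real.log_le_log hpos (hgr n)).trans ?_)
    rw [Real.log_mul hC.ne' (by positivity), Real.log_pow]
  refine ⟨S.card * (d + 1), by positivity, ?_⟩
  rw [Filter.frequently_atTop]
  by_contra hcon
  push Not at hcon
  obtain ⟨n0, hn0⟩ := hcon
  have hstep : ∀ n ≥ n0, (d+1 : ℝ) / (n+1) ≤ ent S (n+1) - ent S n := by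
    intro n hn
    obtain ⟨t, ht, h⟩ := hn0 n hn
    have h1 := ent_step S hS n
    have h2 : hel S n t ≤ ∑ t ∈ S, hel S n t := 
      Finset.single_le_sum (f := fun t => hel S n t) (fun s _ => tsum_nonneg fun x => sq_nonneg _) ht
    have h3 : (S.card : ℝ) * (d+1) / (n+1) < S.card * (ent S (n+1) - ent S n) := by linarith
    rw [mul_div_assoc] at h3
    exact (lt_of_mul_lt_mul_left h3 hk.le).le
  have hmono : ∀ n ≥ n0, ent S n0 - (d+1) * Real.log ((n0:ℝ)+1) ≤ ent S n - (d+1) * Real.log ((n:ℝ)+1) := by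
    intro n hn
    induction n, hn using Nat.le_induction with
    | base => exact le_rfl
    | succ n hn ih =>
      have h1 := hstep n hn
      have h2 := Real.log_le_sub_one_of_pos (x := ((n:ℝ)+1+1)/((n:ℝ)+1)) (by positivity)
      rw [Real.log_div (by positivity) (by positivity)] at h2
      have h3 : ((n:ℝ)+1+1)/((n:ℝ)+1) - 1 = 1 / ((n:ℝ)+1) := by field_simp; ring
      rw [h3] at h2
      have h4 := mul_le_mul_of_nonneg_left h2 (show (0:ℝ) ≤ d+1 by positivity)
      rw [mul_one_div] at h4
      push_cast
      linarith
  have hb : ∀ n ≥ n0, Real.log ((n:ℝ)+1) ≤ Real.log C - (ent S n0 - (d+1) * Real.log ((n0:ℝ)+1)) := by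
    intro n hn
    have := hmono n hn
    have := hent n
    linarith
  have ht : Filter.Tendsto (fun n : ℕ => Real.log ((n:ℝ)+1)) Filter.atTop Filter.atTop :=
    Real.tendsto_log_atTop.comp (Filter.tendsto_atTop_add_const_right _ _ tendsto_natCast_atTop_atTop)
  obtain ⟨n, hn1, hn2⟩ := ((ht.eventually_gt_atTop 
    (Real.log C - (ent S n0 - (d+1) * Real.log ((n0:ℝ)+1)))).and (Filter.eventually_ge_atTop n0)).exists
  exact absurd (hb n hn2) (not_le.2 hn1)

/-- main use of Hellinger estimate -/
lemma hel_cs (hS : S.Nonempty) (n : ℕ) {t : G} (ht : t ∈ S) (F : G → ℝ) :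
    (EE S n (fun x => F (t * x)) - EE S (n+1) F)^2 ≤ 
      hel S n t * (2 * (S.card + 1) * EE S (n+1) (fun x => F x ^ 2)) := by
  have hfin := fin_union S n t
  set B := hfin.toFinset with hB
  have hz : ∀ x ∉ B, pw S n (t⁻¹ * x) = 0 ∧ pw S (n+1) x = 0 := by
    intro x hx
    simpa [hB, not_or] using hx
  have e1 : EE S n (fun x => F (t * x)) - EE S (n+1) F = 
     ∑ x ∈ B, (Real.sqrt (pw S n (t⁻¹ * x)) - Real.sqrt (pw S (n+1) x)) * 
       ((Real.sqrt (pw S n (t⁻¹ * x)) + Real.sqrt (pw S (n+1) x)) * F x) := by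
    rw [← EE_translate]
    unfold EE
    rw [tsum_eq_sum (s := B) (by intro x hx; simp [(hz x hx).1]),
      tsum_eq_sum (s := B) (by intro x hx; simp [(hz x hx).2]), ← Finset.sum_sub_distrib]
    refine Finset.sum_congr rfl fun x _ => ?_
    have e1 := Real.sq_sqrt (pw_nonneg S n (t⁻¹ * x))
    have e2 := Real.sq_sqrt (pw_nonneg S (n+1) x)
    linear_combination (-F x) * e1 + F x * e2
  rw [e1]
  refine (Finset.sum_mul_sq_le_sq_mul_sq _ _ _).trans ?_
  have e2 : hel S n t = ∑ x ∈ B, (Real.sqrt (pw S n (t⁻¹ * x)) - Real.sqrt (pw S (n+1) x))^2 := by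
    unfold hel
    rw [tsum_eq_sum (s := B) (by intro x hx; simp [(hz x hx).1, (hz x hx).2])]
  rw [e2]
  refine mul_le_mul_of_nonneg_left ?_ (Finset.sum_nonneg fun x _ => sq_nonneg _)
  unfold EE
  rw [tsum_eq_sum (s := B) (by intro x hx; simp [(hz x hx).2]), Finset.mul_sum]
  refine Finset.sum_le_sum fun x _ => ?_
  have h1 := Real.sq_sqrt (pw_nonneg S n (t⁻¹ * x))
  have h2 := Real.sq_sqrt (pw_nonneg S (n+1) x)
  have h3 := pw_le S hS n ht x
  rw [mul_pow]
  have h4 : (Real.sqrt (pw S n (t⁻¹ * x)) + Real.sqrt (pw S (n+1) x))^2 ≤ 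
    2 * (S.card + 1) * pw S (n+1) x := by
    nlinarith [sq_nonneg (Real.sqrt (pw S n (t⁻¹ * x)) - Real.sqrt (pw S (n+1) x))]
  calc _ ≤ (2 * (S.card + 1) * pw S (n+1) x) * F x ^ 2 := 
        mul_le_mul_of_nonneg_right h4 (sq_nonneg _)
    _ = _ := by ring

end walk
end QI

namespace QI
section spectral
variable {H : Type} [NormedAddCommGroup H] [InnerProductSpace ℝ H] [CompleteSpace H]
open scoped InnerProductSpace

lemma norm_sq_le_of_pos (T : H →L[ℝ] H) (hsym : ∀ v w, ⟪T v, w⟫_ℝ = ⟪v, T w⟫_ℝ)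
    (hpos : ∀ v, 0 ≤ ⟪T v, v⟫_ℝ) (hT : T ≠ 0) (u : H) : ‖T u‖^2 ≤ ‖T‖ * ⟪T u, u⟫_ℝ := by
  have hn : 0 < ‖T‖ := norm_pos_iff.2 hT
  set c := ‖T‖⁻¹ with hc
  have h := hpos (u - c • T u)
  have e : ⟪T (u - c • T u), u - c • T u⟫_ℝ = ⟪T u, u⟫_ℝ - 2 * c * ‖T u‖^2 + c^2 * ⟪T (T u), T u⟫_ℝ := by
    simp only [map_sub, map_smul, inner_sub_left, inner_sub_right, inner_smul_left, inner_smul_right]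
    rw [hsym (T u) u, real_inner_self_eq_norm_sq]
    simp
    ring
  rw [e] at h
  have h2 : ⟪T (T u), T u⟫_ℝ ≤ ‖T‖ * ‖T u‖^2 := by
    calc _ ≤ ‖T (T u)‖ * ‖T u‖ := real_inner_le_norm _ _
      _ ≤ (‖T‖ * ‖T u‖) * ‖T u‖ := by gcongr; exact T.le_opNorm _
      _ = _ := by ring
  have h3 : c^2 * ⟪T (T u), T u⟫_ℝ ≤ c * ‖T u‖^2 := by
    calc _ ≤ c^2 * (‖T‖ * ‖T u‖^2) := by gcongr
      _ = c * (c * ‖T‖) * ‖T u‖^2 := by ring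
      _ = _ := by rw [hc, inv_mul_cancel₀ hn.ne']; ring
  have h4 : c * ‖T u‖^2 ≤ ⟪T u, u⟫_ℝ := by linarith
  calc ‖T u‖^2 = ‖T‖ * (c * ‖T u‖^2) := by rw [hc]; field_simp
    _ ≤ _ := by gcongr

lemma snoc_orthonormal {k : ℕ} {e : Fin k → H} (he : Orthonormal ℝ e) {w : H} (hw : ‖w‖ = 1)
    (h : ∀ i, ⟪e i, w⟫_ℝ = 0) : Orthonormal ℝ (Fin.snoc e w : Fin (k+1) → H) := by
  constructor
  · intro i
    refine Fin.lastCases ?_ (fun i => ?_) i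
    · simpa using hw
    · simpa using he.1 i
  · intro i j
    refine Fin.lastCases ?_ (fun i => ?_) i <;> refine Fin.lastCases ?_ (fun j => ?_) j
    · intro h; exact absurd rfl h
    · intro _; simp only [Fin.snoc_last, Fin.snoc_castSucc]; rw [real_inner_comm]; exact h j
    · intro _; simp only [Fin.snoc_last, Fin.snoc_castSucc]; exact h i
    · intro hij; simp only [Fin.snoc_castSucc]; exact he.2 (by intro h; exact hij (by rw [h]))

lemma compact_of_trace (T : H →L[ℝ] H) (hsym : ∀ v w, ⟪T v, w⟫_ℝ = ⟪v, T w⟫_ℝ)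
    (hpos : ∀ v, 0 ≤ ⟪T v, v⟫_ℝ) (E : ℝ) 
    (htr : ∀ (k : ℕ) (e : Fin k → H), Orthonormal ℝ e → ∑ i, ⟪T (e i), e i⟫_ℝ ≤ E) : 
    IsCompactOperator T := by
  by_cases hT : T = 0
  · rw [hT]; exact isCompactOperator_zero
  have hn : 0 < ‖T‖ := norm_pos_iff.2 hT
  have hcl : IsClosed {f : H →L[ℝ] H | IsCompactOperator f} := isClosed_setOfPred_isCompactOperator
  have : T ∈ closure {f : H →L[ℝ] H | IsCompactOperator f} := by
    rw [Metric.mem_closure_iff]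
    intro δ hδ
    -- choose ε
    set ε := (δ/2)^2 / ‖T‖ with hε
    have hεpos : 0 < ε := by positivity
    let P : ℕ → Prop := fun k => ∃ e : Fin k → H, Orthonormal ℝ e ∧ ∀ i, ε ≤ ⟪T (e i), e i⟫_ℝ
    have hP0 : P 0 := ⟨fun i => i.elim0, ⟨fun i => i.elim0, fun i => i.elim0⟩, fun i => i.elim0⟩
    have hPb : ∀ k, P k → (k:ℝ) * ε ≤ E := by
      rintro k ⟨e, he, h⟩
      have := htr k e he
      refine le_trans ?_ this
      calc (k:ℝ) * ε = ∑ i : Fin k, ε := by simp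
        _ ≤ _ := Finset.sum_le_sum fun i _ => h i
    obtain ⟨k, hk, hk1⟩ : ∃ k, P k ∧ ¬ P (k+1) := by
      by_contra hcon
      push Not at hcon
      have hall : ∀ k, P k := fun k => by
        induction k with
        | zero => exact hP0
        | succ k ih => exact hcon k ih
      obtain ⟨k, hk⟩ := exists_nat_gt (E / ε)
      have := hPb k (hall k)
      rw [div_lt_iff₀ hεpos] at hk
      linarith
    obtain ⟨e, he, hee⟩ := hk
    let W : Submodule ℝ H := Submodule.span ℝ (Set.range e)
    have : FiniteDimensional ℝ W := FiniteDimensional.span_of_finite ℝ (Set.finite_range e)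
    have hperp : ∀ u ∈ Wᗮ, ⟪T u, u⟫_ℝ ≤ ε * ‖u‖^2 := by
      intro u hu
      by_cases hu0 : u = 0
      · simp [hu0]
      have hun : 0 < ‖u‖ := norm_pos_iff.2 hu0
      by_contra hcon
      push Not at hcon
      apply hk1
      refine ⟨Fin.snoc e (‖u‖⁻¹ • u), snoc_orthonormal he ?_ ?_, ?_⟩
      · rw [norm_smul, norm_inv, norm_norm, inv_mul_cancel₀ hun.ne']
      · intro i
        rw [inner_smul_right, (Submodule.mem_orthogonal W u).1 hu (e i) (Submodule.subset_span ⟨i, rfl⟩),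
          mul_zero]
      · intro i
        refine Fin.lastCases ?_ (fun i => ?_) i
        · simp only [Fin.snoc_last, map_smul, inner_smul_left, inner_smul_right]
          simp
          calc ε = ‖u‖⁻¹ * (‖u‖⁻¹ * (ε * ‖u‖^2)) := by field_simp
            _ ≤ _ := by gcongr
        · simpa using hee i
    let Q : H →L[ℝ] H := T.comp (W.subtypeL.comp W.orthogonalProjectionOnto)
    refine ⟨Q, ?_, ?_⟩
    · have : ProperSpace W := FiniteDimensional.proper ℝ W
      have h1 : IsCompactOperator (T.comp W.subtypeL : W →L[ℝ] H) :=
        isCompactOperator_of_locallyCompactSpace_rng (T.comp W.subtypeL : W →L[ℝ] H)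
      exact h1.comp_clm W.orthogonalProjectionOnto
    · rw [dist_eq_norm]
      have : ‖T - Q‖ ≤ δ / 2 := by
        refine ContinuousLinearMap.opNorm_le_bound _ (by positivity) fun x => ?_
        set u := x - (W.orthogonalProjectionOnto x : H) with hu
        have huW : u ∈ Wᗮ := W.sub_starProjection_mem_orthogonal x
        have e1 : (T - Q) x = T u := by simp [Q, hu]
        rw [e1]
        have hux : ‖u‖ ≤ ‖x‖ := by
          have h1 : ‖x‖^2 = ‖(W.orthogonalProjectionOnto x : H)‖^2 + ‖u‖^2 := by
            have : x = (W.orthogonalProjectionOnto x : H) + u := by simp [hu]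
            conv_lhs => rw [this]
            rw [norm_add_sq_real, (Submodule.mem_orthogonal W u).1 huW _ (W.orthogonalProjectionOnto x).2]
            ring
          exact le_of_sq_le_sq (by nlinarith [sq_nonneg ‖(W.orthogonalProjectionOnto x : H)‖]) (norm_nonneg _)
        have h2 := norm_sq_le_of_pos T hsym hpos hT u
        have h3 : ‖T u‖^2 ≤ (δ/2 * ‖u‖)^2 := by
          refine h2.trans ?_
          calc _ ≤ ‖T‖ * (ε * ‖u‖^2) := by gcongr; exact hperp u huW
            _ = _ := by rw [hε]; field_simp
        have h4 : ‖T u‖ ≤ δ/2 * ‖u‖ := le_of_sq_le_sq h3 (by positivity)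
        exact h4.trans (by gcongr)
      linarith
  rw [hcl.closure_eq] at this
  exact this

theorem top_eigenspace (T : H →L[ℝ] H) (hsym : ∀ v w, ⟪T v, w⟫_ℝ = ⟪v, T w⟫_ℝ)
    (hpos : ∀ v, 0 ≤ ⟪T v, v⟫_ℝ) (E : ℝ) 
    (htr : ∀ (k : ℕ) (e : Fin k → H), Orthonormal ℝ e → ∑ i, ⟪T (e i), e i⟫_ℝ ≤ E) (hT : T ≠ 0) :
    ∃ W : Submodule ℝ H, FiniteDimensional ℝ W ∧ W ≠ ⊥ ∧ (∀ w ∈ W, T w = ‖T‖ • w) ∧ 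
      (∀ w, ‖T‖ * ‖w‖^2 ≤ ⟪T w, w⟫_ℝ → w ∈ W) := by
  have hn : 0 < ‖T‖ := norm_pos_iff.2 hT
  have hc := compact_of_trace T hsym hpos E htr
  have hs : (T : H →ₗ[ℝ] H).IsSymmetric := hsym
  have : Nontrivial H := by
    by_contra h
    rw [not_nontrivial_iff_subsingleton] at h
    exact hT (by ext x; exact Subsingleton.elim _ _)
  have hev : Module.End.HasEigenvalue (T : Module.End ℝ H) ‖T‖ := by
    rcases hc.hasEigenvalue_or_mem_resolventSet hn.ne' with h | h
    · exact h
    · exfalso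
      obtain ⟨ε, hε, h⟩ := T.rayleighQuotient_le_of_norm_mem_resolventSet (by simpa using h)
      have h1 := T.norm_eq_iSup_rayleighQuotient hs
      have : ⨆ x, |T.rayleighQuotient x| ≤ ‖T‖ - ε := by
        refine ciSup_le fun x => ?_
        rw [abs_of_nonneg]
        · exact h x
        · rw [ContinuousLinearMap.rayleighQuotient, ContinuousLinearMap.reApplyInnerSelf_apply]
          exact div_nonneg (hpos x) (by positivity)
      linarith
  refine ⟨Module.End.eigenspace (T : Module.End ℝ H) ‖T‖, 
    ContinuousLinearMap.finite_dimensional_eigenspace hc _ hn.ne', hev, ?_, ?_⟩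
  · intro w hw
    exact Module.End.mem_eigenspace_iff.1 hw
  · intro w hw
    rw [Module.End.mem_eigenspace_iff]
    have : ‖T w - ‖T‖ • w‖^2 ≤ 0 := by
      rw [norm_sub_sq_real, inner_smul_right, norm_smul, norm_norm]
      have := T.le_opNorm w
      have h2 : ‖T w‖^2 ≤ (‖T‖ * ‖w‖)^2 := by gcongr
      nlinarith
    have h3 : ‖T w - ‖T‖ • w‖ = 0 := by
      have := le_antisymm this (sq_nonneg _)
      exact pow_eq_zero_iff (two_ne_zero) |>.1 this
    rw [norm_eq_zero, sub_eq_zero] at h3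
    exact h3

end spectral
end QI

namespace QI
open scoped InnerProductSpace Topology
open Filter

lemma exists_ulim (ω : Ultrafilter ℕ) (u : ℕ → ℝ) (M : ℝ) (h : ∀ n, |u n| ≤ M) :
    ∃ l, Tendsto u ω (𝓝 l) := by
  obtain ⟨l, _, hl⟩ := (isCompact_Icc (a := -M) (b := M)).ultrafilter_le_nhds (ω.map u) (by
    rw [le_principal_iff]
    exact Filter.mem_map.2 (Filter.Eventually.of_forall fun n => abs_le.1 (h n)))
  exact ⟨l, hl⟩

section key
variable {G : Type} [Group G] {H : Type} [NormedAddCommGroup H] [InnerProductSpace ℝ H]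

/-- cocycle condition -/
def IsCoc (π : G →* (H ≃ₗᵢ[ℝ] H)) (b : G → H) : Prop := ∀ g h, b (g * h) = b g + π g (b h)

lemma IsCoc.one {π : G →* (H ≃ₗᵢ[ℝ] H)} {b : G → H} (hb : IsCoc π b) : b 1 = 0 := by
  have := hb 1 1
  simpa using this

lemma pi_mul (π : G →* (H ≃ₗᵢ[ℝ] H)) (g h : G) (v : H) : π (g * h) v = π g (π h v) := by
  rw [map_mul]; rfl

lemma pi_one (π : G →* (H ≃ₗᵢ[ℝ] H)) (v : H) : π 1 v = v := by
  rw [map_one]; rfl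

lemma pi_inv_self (π : G →* (H ≃ₗᵢ[ℝ] H)) (g : G) (v : H) : π g⁻¹ (π g v) = v := by
  rw [← pi_mul, inv_mul_cancel, pi_one]

lemma pi_self_inv (π : G →* (H ≃ₗᵢ[ℝ] H)) (g : G) (v : H) : π g (π g⁻¹ v) = v := by
  rw [← pi_mul, mul_inv_cancel, pi_one]

lemma inner_pi (π : G →* (H ≃ₗᵢ[ℝ] H)) (g : G) (v w : H) : ⟪π g v, w⟫_ℝ = ⟪v, π g⁻¹ w⟫_ℝ := by
  rw [← (π g⁻¹).inner_map_map (π g v) w]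
  rw [pi_inv_self]

variable (S : Finset G) (π : G →* (H ≃ₗᵢ[ℝ] H)) (b : G → H)

noncomputable def bet (n : ℕ) (v w : H) : ℝ := EE S n (fun x => ⟪b x, v⟫_ℝ * ⟪b x, w⟫_ℝ)

variable {S π b}

lemma mean_zero (hb : IsCoc π b) (hh : ∑ s ∈ S, b s = 0) (n : ℕ) (w : H) :
    EE S n (fun x => ⟪b x, w⟫_ℝ) = 0 := by
  by_cases hS : S.Nonempty
  swap
  · rw [Finset.not_nonempty_iff_eq_empty] at hS
    cases n with
    | zero => simp [EE_zero, hb.one]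
    | succ n => simp [EE_succ, hS]
  induction n generalizing w with
  | zero => simp [EE_zero, hb.one]
  | succ n ih =>
    rw [EE_succ]
    have : ∀ s ∈ S, EE S n (fun x => ⟪b (s * x), w⟫_ℝ) = ⟪b s, w⟫_ℝ := by
      intro s _
      have e : (fun x => ⟪b (s * x), w⟫_ℝ) = fun x => ⟪b s, w⟫_ℝ + ⟪b x, π s⁻¹ w⟫_ℝ := by
        ext x; rw [hb s x, inner_add_left, inner_pi]
      rw [e, EE_add, EE_const S hS, ih, add_zero]
    rw [Finset.sum_congr rfl this, ← sum_inner, hh]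
    simp

lemma bet_zero (hb : IsCoc π b) (v w : H) : bet S b 0 v w = 0 := by
  simp [bet, EE_zero, hb.one]

lemma bet_succ (hS : S.Nonempty) (hb : IsCoc π b) (hh : ∑ s ∈ S, b s = 0) (n : ℕ) (v w : H) :
    bet S b (n+1) v w = (∑ s ∈ S, (⟪b s, v⟫_ℝ * ⟪b s, w⟫_ℝ + bet S b n (π s⁻¹ v) (π s⁻¹ w))) / S.card := by
  unfold bet
  rw [EE_succ]
  congr 1
  refine Finset.sum_congr rfl fun s _ => ?_
  have e : (fun x => ⟪b (s * x), v⟫_ℝ * ⟪b (s * x), w⟫_ℝ) = fun x => (⟪b s, v⟫_ℝ * ⟪b s, w⟫_ℝ + 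
      (⟪b s, v⟫_ℝ * ⟪b x, π s⁻¹ w⟫_ℝ + ⟪b s, w⟫_ℝ * ⟪b x, π s⁻¹ v⟫_ℝ)) + 
      ⟪b x, π s⁻¹ v⟫_ℝ * ⟪b x, π s⁻¹ w⟫_ℝ := by
    ext x; rw [hb s x, inner_add_left, inner_add_left, inner_pi, inner_pi]; ring
  simp only [e, EE_add, EE_smul, EE_const S hS, mean_zero hb hh]
  ring

variable (S b) in
/-- energy -/
noncomputable def ener : ℝ := (∑ s ∈ S, ‖b s‖^2) / S.card

lemma ener_nonneg : 0 ≤ ener S b := by unfold ener; positivity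

lemma avg_le {S : Finset G} (hS : S.Nonempty) {F : G → ℝ} {c : ℝ} (h : ∀ s ∈ S, F s ≤ c) : 
    (∑ s ∈ S, F s) / S.card ≤ c := by
  have hk : 0 < (S.card : ℝ) := by exact_mod_cast hS.card_pos
  rw [div_le_iff₀ hk, mul_comm, ← nsmul_eq_mul]
  exact Finset.sum_le_card_nsmul _ _ _ h

lemma quad_bound (v w : H) : 
    (∑ s ∈ S, |⟪b s, v⟫_ℝ * ⟪b s, w⟫_ℝ|) / S.card ≤ ener S b * (‖v‖ * ‖w‖) := by
  unfold ener
  rw [div_mul_eq_mul_div, Finset.sum_mul]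
  gcongr with s hs
  rw [abs_mul]
  calc _ ≤ (‖b s‖ * ‖v‖) * (‖b s‖ * ‖w‖) := by 
        gcongr <;> exact abs_real_inner_le_norm _ _
    _ = _ := by ring

lemma bet_bound (hS : S.Nonempty) (hb : IsCoc π b) (hh : ∑ s ∈ S, b s = 0) (n : ℕ) (v w : H) :
    |bet S b n v w| ≤ n * (ener S b * (‖v‖ * ‖w‖)) := by
  induction n generalizing v w with
  | zero => simp [bet_zero hb]
  | succ n ih =>
    rw [bet_succ hS hb hh, Finset.sum_add_distrib, add_div]
    refine (abs_add_le _ _).trans ?_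
    push_cast
    rw [add_mul, one_mul, add_comm]
    refine add_le_add ?_ ?_
    · rw [abs_div, Nat.abs_cast]
      refine le_trans ?_ (avg_le hS (F := fun s => |bet S b n (π s⁻¹ v) (π s⁻¹ w)|) ?_)
      · gcongr
        exact Finset.abs_sum_le_sum_abs _ _
      · intro s _
        refine (ih _ _).trans_eq ?_
        simp
    · rw [abs_div, Nat.abs_cast]
      refine le_trans ?_ (quad_bound v w)
      gcongr
      exact Finset.abs_sum_le_sum_abs _ _

lemma bet_diff (hS : S.Nonempty) (hb : IsCoc π b) (hh : ∑ s ∈ S, b s = 0) (n : ℕ) (v w : H) :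
    |bet S b (n+1) v w - bet S b n v w| ≤ ener S b * (‖v‖ * ‖w‖) := by
  induction n generalizing v w with
  | zero => 
    have := bet_bound hS hb hh 1 v w
    rw [bet_zero hb, sub_zero]
    simpa using this
  | succ n ih =>
    rw [bet_succ hS hb hh (n+1), bet_succ hS hb hh n, ← sub_div, ← Finset.sum_sub_distrib]
    rw [abs_div, Nat.abs_cast]
    refine le_trans ?_ (avg_le hS (F := fun s => |bet S b (n+1) (π s⁻¹ v) (π s⁻¹ w) - bet S b n (π s⁻¹ v) (π s⁻¹ w)|) ?_)
    · gcongr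
      refine (Finset.abs_sum_le_sum_abs _ _).trans_eq ?_
      refine Finset.sum_congr rfl fun s _ => ?_
      congr 1; ring
    · intro s _
      refine (ih _ _).trans_eq ?_
      simp

lemma bet_trace (hS : S.Nonempty) (hb : IsCoc π b) (hh : ∑ s ∈ S, b s = 0) (n : ℕ) {k : ℕ}
    (e : Fin k → H) (he : Orthonormal ℝ e) : ∑ i, bet S b n (e i) (e i) ≤ n * ener S b := by
  induction n generalizing e with
  | zero => simp [bet_zero hb]
  | succ n ih =>
    simp_rw [bet_succ hS hb hh]
    rw [← Finset.sum_div, Finset.sum_comm]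
    simp_rw [Finset.sum_add_distrib]
    rw [add_div]
    push_cast
    rw [add_mul, one_mul, add_comm]
    refine add_le_add ?_ ?_
    · refine avg_le hS fun s _ => ?_
      exact ih (fun i => π s⁻¹ (e i)) (he.comp_linearIsometryEquiv (π s⁻¹))
    · unfold ener
      gcongr with s hs
      have := he.sum_inner_products_le (x := b s) (s := Finset.univ)
      refine le_trans (le_of_eq ?_) this
      refine Finset.sum_congr rfl fun i _ => ?_
      rw [real_inner_comm, Real.norm_eq_abs, sq_abs, sq]

lemma bet_lower (hS : S.Nonempty) (hb : IsCoc π b) (hh : ∑ s ∈ S, b s = 0) (n : ℕ) (w : H) {t : G} 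
    (ht : t ∈ S) : ⟪b t, w⟫_ℝ^2 ≤ hel S n t * (2 * (S.card + 1) * bet S b (n+1) w w) := by
  have := hel_cs S hS n ht (fun x => ⟪b x, w⟫_ℝ)
  have e : (fun x => ⟪b (t * x), w⟫_ℝ) = fun x => ⟪b t, w⟫_ℝ + ⟪b x, π t⁻¹ w⟫_ℝ := by
    ext x; rw [hb t x, inner_add_left, inner_pi]
  rw [e, EE_add, EE_const S hS, mean_zero hb hh, mean_zero hb hh] at this
  simp only [add_zero, sub_zero] at this
  unfold bet
  simp_rw [← sq]
  exact this

lemma bet_add_left (n : ℕ) (v v' w : H) : bet S b n (v + v') w = bet S b n v w + bet S b n v' w := by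
  unfold bet
  rw [← EE_add]
  congr 1; ext x; rw [inner_add_right]; ring

lemma bet_smul_left (n : ℕ) (c : ℝ) (v w : H) : bet S b n (c • v) w = c * bet S b n v w := by
  unfold bet
  rw [← EE_smul]
  congr 1; ext x; rw [inner_smul_right]; ring

lemma bet_symm (n : ℕ) (v w : H) : bet S b n v w = bet S b n w v := by
  unfold bet
  congr 1; ext x; ring

lemma bet_nonneg (n : ℕ) (v : H) : 0 ≤ bet S b n v v := 
  EE_nonneg S n fun _ => mul_self_nonneg _

variable [CompleteSpace H]

theorem key (hS : S.Nonempty) (hG : IsWordGenSet S) (hb : IsCoc π b) (hh : ∑ s ∈ S, b s = 0) (K : ℝ) 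
    (hK : 0 < K)
    (good : ∃ᶠ n : ℕ in atTop, ∀ t ∈ S, hel S n t ≤ K / ((n:ℝ)+1)) (hne : ∃ s ∈ S, b s ≠ 0) :
    ∃ W : Submodule ℝ H, FiniteDimensional ℝ W ∧ W ≠ ⊥ ∧ (∀ g, ∀ w ∈ W, π g w ∈ W) ∧
      (∀ v, (∀ g, ⟪b g, v⟫_ℝ = 0) → ∀ w ∈ W, ⟪w, v⟫_ℝ = 0) := by
  have hk : 0 < (S.card : ℝ) := by exact_mod_cast hS.card_pos
  have hnb : (atTop ⊓ 𝓟 {n : ℕ | ∀ t ∈ S, hel S n t ≤ K / ((n:ℝ)+1)}).NeBot := 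
    Filter.frequently_mem_iff_neBot.1 good
  let ω : Ultrafilter ℕ := @Ultrafilter.of _ _ hnb
  have hω : (ω : Filter ℕ) ≤ atTop ⊓ 𝓟 {n : ℕ | ∀ t ∈ S, hel S n t ≤ K / ((n:ℝ)+1)} := 
    @Ultrafilter.of_le _ _ hnb
  have hω1 : (ω : Filter ℕ) ≤ atTop := hω.trans inf_le_left
  have hω2 : ∀ᶠ n in (ω : Filter ℕ), ∀ t ∈ S, hel S n t ≤ K / ((n:ℝ)+1) := 
    le_principal_iff.1 (hω.trans inf_le_right)
  have hpos : ∀ n : ℕ, (0:ℝ) < (n:ℝ) + 1 := fun n => by positivity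
  have hbound : ∀ v w, ∀ n : ℕ, |bet S b (n+1) v w / ((n:ℝ)+1)| ≤ ener S b * (‖v‖ * ‖w‖) := by
    intro v w n
    rw [abs_div, abs_of_pos (hpos n), div_le_iff₀ (hpos n)]
    have := bet_bound hS hb hh (n+1) v w
    push_cast at this
    linarith
  choose B hB using fun v w => exists_ulim ω (fun n => bet S b (n+1) v w / ((n:ℝ)+1)) _ (hbound v w)
  have hBb : ∀ v w, |B v w| ≤ ener S b * (‖v‖ * ‖w‖) := fun v w => 
    le_of_tendsto (hB v w).abs (Eventually.of_forall (hbound v w))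
  have hBadd : ∀ v v' w, B (v + v') w = B v w + B v' w := by
    intro v v' w
    refine tendsto_nhds_unique (hB _ _) (((hB v w).add (hB v' w)).congr fun n => ?_)
    rw [bet_add_left, add_div]
  have hBsmul : ∀ (c : ℝ) v w, B (c • v) w = c * B v w := by
    intro c v w
    refine tendsto_nhds_unique (hB _ _) (((hB v w).const_mul c).congr fun n => ?_)
    rw [bet_smul_left, mul_div_assoc]
  have hBsymm : ∀ v w, B v w = B w v := by
    intro v w
    refine tendsto_nhds_unique (hB _ _) ((hB w v).congr fun n => ?_)
    rw [bet_symm]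
  have hBpos : ∀ v, 0 ≤ B v v := fun v => 
    ge_of_tendsto (hB v v) (Eventually.of_forall fun n => div_nonneg (bet_nonneg _ _) (hpos n).le)
  have hBtr : ∀ (k : ℕ) (e : Fin k → H), Orthonormal ℝ e → ∑ i, B (e i) (e i) ≤ ener S b := by
    intro k e he
    refine le_of_tendsto (tendsto_finsetSum _ fun i _ => hB (e i) (e i)) (Eventually.of_forall fun n => ?_)
    rw [← Finset.sum_div, div_le_iff₀ (hpos n)]
    have := bet_trace hS hb hh (n+1) e he
    push_cast at this
    linarith
  have hBlow : ∀ w, ∀ t ∈ S, ⟪b t, w⟫_ℝ^2 ≤ K * (2 * (S.card + 1)) * B w w := by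
    intro w t ht
    refine ge_of_tendsto ((hB w w).const_mul _) (hω2.mono fun n hn => ?_)
    refine (bet_lower hS hb hh n w ht).trans ?_
    have h1 := hn t ht
    calc _ ≤ K / ((n:ℝ)+1) * (2 * (S.card + 1) * bet S b (n+1) w w) := by
          refine mul_le_mul_of_nonneg_right h1 ?_
          have := bet_nonneg (S := S) (b := b) (n+1) w
          positivity
      _ = _ := by ring
  have hBharm : ∀ v w, (∑ s ∈ S, B (π s⁻¹ v) (π s⁻¹ w)) / S.card = B v w := by
    intro v w
    have h1 : Tendsto (fun n : ℕ => (∑ s ∈ S, bet S b (n+1) (π s⁻¹ v) (π s⁻¹ w) / ((n:ℝ)+1)) / (S.card : ℝ)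
      - bet S b (n+1) v w / ((n:ℝ)+1)) ω (𝓝 ((∑ s ∈ S, B (π s⁻¹ v) (π s⁻¹ w)) / S.card - B v w)) :=
      ((tendsto_finsetSum _ fun s _ => hB (π s⁻¹ v) (π s⁻¹ w)).div_const _).sub (hB v w)
    have h2 : Tendsto (fun n : ℕ => (∑ s ∈ S, bet S b (n+1) (π s⁻¹ v) (π s⁻¹ w) / ((n:ℝ)+1)) / (S.card : ℝ)
      - bet S b (n+1) v w / ((n:ℝ)+1)) ω (𝓝 0) := by
      have h3 : Tendsto (fun n : ℕ => (2 * (ener S b * (‖v‖ * ‖w‖))) * (1 / ((n:ℝ)+1))) ω (𝓝 0) := by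
        have := (tendsto_one_div_add_atTop_nhds_zero_nat (𝕜 := ℝ)).const_mul (2 * (ener S b * (‖v‖ * ‖w‖)))
        rw [mul_zero] at this
        exact this.mono_left hω1
      refine squeeze_zero_norm (fun n => ?_) h3
      have e1 := bet_succ hS hb hh (n+1) v w
      rw [Finset.sum_add_distrib, add_div] at e1
      have e2 := bet_diff hS hb hh (n+1) v w
      have e3 : |(∑ s ∈ S, (⟪b s, v⟫_ℝ * ⟪b s, w⟫_ℝ)) / S.card| ≤ ener S b * (‖v‖ * ‖w‖) := by
        rw [abs_div, Nat.abs_cast]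
        refine le_trans ?_ (quad_bound v w)
        gcongr
        exact Finset.abs_sum_le_sum_abs _ _
      rw [← Finset.sum_div, div_right_comm, ← sub_div, Real.norm_eq_abs, abs_div, abs_of_pos (hpos n), 
        mul_one_div]
      gcongr
      rw [abs_le] at e2 e3 ⊢
      constructor <;> linarith
    have := tendsto_nhds_unique h1 h2
    linarith
  -- operator
  let Bl : H →ₗ[ℝ] H →ₗ[ℝ] ℝ := LinearMap.mk₂ ℝ B hBadd (fun c v w => by rw [hBsmul]; rfl)
    (fun v w w' => by rw [hBsymm, hBadd, hBsymm w v, hBsymm w' v]) 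
    (fun c v w => by rw [hBsymm, hBsmul, hBsymm w v]; rfl)
  let Bc : H →L[ℝ] H →L[ℝ] ℝ := Bl.mkContinuous₂ (ener S b) (fun v w => by
    have := hBb v w
    rw [← mul_assoc] at this
    exact this)
  let T : H →L[ℝ] H := InnerProductSpace.continuousLinearMapOfBilin (𝕜 := ℝ) Bc
  have hT : ∀ v w, ⟪T v, w⟫_ℝ = B v w := fun v w => 
    InnerProductSpace.continuousLinearMapOfBilin_apply (𝕜 := ℝ) Bc v w
  have hT0 : T ≠ 0 := by
    intro h0
    obtain ⟨s, hs, hbs⟩ := hne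
    have := hBlow (b s) s hs
    rw [← hT, h0] at this
    simp only [ContinuousLinearMap.zero_apply, inner_zero_left, mul_zero, real_inner_self_eq_norm_sq] at this
    have hp : 0 < ‖b s‖ := norm_pos_iff.2 hbs
    have : 0 < (‖b s‖^2)^2 := by positivity
    linarith
  obtain ⟨W, hW1, hW2, hW3, hW4⟩ := top_eigenspace T 
    (fun v w => by rw [hT, real_inner_comm, hT, hBsymm]) (fun v => by rw [hT]; exact hBpos v) (ener S b)
    (fun k e he => by simp_rw [hT]; exact hBtr k e he) hT0
  have hTn : 0 < ‖T‖ := norm_pos_iff.2 hT0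
  have hup : ∀ w, B w w ≤ ‖T‖ * ‖w‖^2 := by
    intro w
    rw [← hT]
    calc _ ≤ ‖T w‖ * ‖w‖ := real_inner_le_norm _ _
      _ ≤ (‖T‖ * ‖w‖) * ‖w‖ := by gcongr; exact T.le_opNorm _
      _ = _ := by ring
  have hinv1 : ∀ s ∈ S, ∀ w ∈ W, π s⁻¹ w ∈ W := by
    intro s hs w hw
    apply hW4
    rw [hT]
    have e1 : B w w = ‖T‖ * ‖w‖^2 := by
      rw [← hT, hW3 w hw, inner_smul_left, real_inner_self_eq_norm_sq]; rfl
    have e2 := hBharm w w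
    rw [div_eq_iff hk.ne', e1, LinearIsometryEquiv.norm_map] at *
    have e3 : ∑ s ∈ S, (‖T‖ * ‖w‖^2 - B (π s⁻¹ w) (π s⁻¹ w)) = 0 := by
      rw [Finset.sum_sub_distrib, e2]; simp; ring
    have e4 := (Finset.sum_eq_zero_iff_of_nonneg (fun s _ => by
      have := hup (π s⁻¹ w)
      rw [LinearIsometryEquiv.norm_map] at this
      linarith)).1 e3 s hs
    linarith
  refine ⟨W, hW1, hW2, ?_, ?_⟩
  · intro g
    obtain ⟨l, hl, rfl⟩ := exists_list hG g
    induction l with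
    | nil => intro w hw; simpa using hw
    | cons a l ih => 
      intro w hw
      rw [List.prod_cons, pi_mul]
      have := hinv1 a⁻¹ (hG.1 a (hl a (by simp))) _ (ih (fun x hx => hl x (by simp [hx])) w hw)
      simpa using this
  · intro v hv w hw
    have e1 : B w v = 0 := by
      refine tendsto_nhds_unique (hB w v) ?_
      have : (fun n : ℕ => bet S b (n+1) w v / ((n:ℝ)+1)) = fun _ => 0 := by
        ext n
        simp [bet, hv, EE]
      rw [this]
      exact tendsto_const_nhds
    rw [← hT, hW3 w hw, inner_smul_left] at e1
    have : ‖T‖ * ⟪w, v⟫_ℝ = 0 := e1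
    exact (mul_eq_zero.1 this).resolve_left hTn.ne'

end key
end QI

namespace QI
open scoped InnerProductSpace Topology
open Filter

section exh
variable {G : Type} [Group G] {H : Type} [NormedAddCommGroup H] [InnerProductSpace ℝ H]

def FDInv (π : G →* (H ≃ₗᵢ[ℝ] H)) (W : Submodule ℝ H) : Prop :=
  FiniteDimensional ℝ W ∧ ∀ g, ∀ w ∈ W, π g w ∈ W

lemma FDInv.sup {π : G →* (H ≃ₗᵢ[ℝ] H)} {W W' : Submodule ℝ H} (h : FDInv π W) (h' : FDInv π W') :
    FDInv π (W ⊔ W') := by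
  have := h.1
  have := h'.1
  refine ⟨inferInstance, fun g w hw => ?_⟩
  obtain ⟨y, hy, z, hz, rfl⟩ := Submodule.mem_sup.1 hw
  rw [map_add]
  exact Submodule.add_mem_sup (h.2 g y hy) (h'.2 g z hz)

lemma FDInv.bot {π : G →* (H ≃ₗᵢ[ℝ] H)} : FDInv π ⊥ := by
  refine ⟨inferInstance, fun g w hw => ?_⟩
  rw [Submodule.mem_bot] at hw
  simp [hw]

lemma proj_comm (π : G →* (H ≃ₗᵢ[ℝ] H)) (V : Submodule ℝ H) [V.HasOrthogonalProjection]
    (hV : ∀ g, ∀ w ∈ V, π g w ∈ V) (g : G) (v : H) :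
    V.starProjection (π g v) = π g (V.starProjection v) := by
  refine Submodule.eq_starProjection_of_mem_of_inner_eq_zero (hV g _ (Submodule.starProjection_apply_mem V v)) ?_
  intro w hw
  rw [← map_sub, inner_pi]
  exact Submodule.starProjection_inner_eq_zero v _ (hV _ _ hw)

lemma IsCoc.proj {π : G →* (H ≃ₗᵢ[ℝ] H)} {b : G → H} (hb : IsCoc π b) (V : Submodule ℝ H) 
    [V.HasOrthogonalProjection] (hV : ∀ g, ∀ w ∈ V, π g w ∈ V) : 
    IsCoc π (fun g => V.starProjection (b g)) := by
  intro g h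
  simp only []
  rw [hb g h, map_add, proj_comm π V hV]

lemma IsCoc.sub {π : G →* (H ≃ₗᵢ[ℝ] H)} {b b' : G → H} (hb : IsCoc π b) (hb' : IsCoc π b') :
    IsCoc π (fun g => b g - b' g) := by
  intro g h
  simp only []
  rw [hb g h, hb' g h, map_sub]; abel

lemma IsCoc.norm_le {S : Finset G} {π : G →* (H ≃ₗᵢ[ℝ] H)} {b : G → H} (hb : IsCoc π b) (hG : IsWordGenSet S)
    (ε : ℝ) (h : ∀ s ∈ S, ‖b s‖ ≤ ε) (g : G) : ‖b g‖ ≤ ε * len (S : Set G) g := by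
  refine le_len_of_step hG (fun g => ‖b g‖) ε (by simp [hb.one]) ?_ g
  intro g s hs
  rw [hb g s]
  refine (norm_add_le _ _).trans ?_
  rw [LinearIsometryEquiv.norm_map]
  have := h s hs
  linarith

variable [CompleteSpace H]

theorem harmonicize {S : Finset G} {π : G →* (H ≃ₗᵢ[ℝ] H)} {b : G → H} (hG : IsWordGenSet S) 
    (hb : IsCoc π b) : ∃ b' : G → H, IsCoc π b' ∧ ∑ s ∈ S, b' s = 0 ∧ 
      ∀ ε > 0, ∃ M : ℝ, ∀ g, ‖b g - b' g‖ ≤ ε * len (S : Set G) g + M := by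
  let D : H →ₗ[ℝ] PiLp 2 (fun _ : S => H) := 
    { toFun := fun v => WithLp.toLp 2 (fun s : S => π (s : G) v - v)
      map_add' := by
        intro v w; ext s; simp only [map_add, PiLp.add_apply]; abel
      map_smul' := by
        intro c v; ext s; simp [smul_sub] }
  have hD : ∀ v (s : S), D v s = π (s : G) v - v := fun _ _ => rfl
  let R := (LinearMap.range D).topologicalClosure
  have : CompleteSpace R := (LinearMap.range D).isClosed_topologicalClosure.completeSpace_coe
  let x : PiLp 2 (fun _ : S => H) := WithLp.toLp 2 (fun s : S => b (s : G))
  let q := R.starProjection x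
  have hq : q ∈ R := Submodule.starProjection_apply_mem R x
  obtain ⟨u, hu, hlim⟩ := mem_closure_iff_seq_limit.1 hq
  choose v hv using hu
  have hlim1 : ∀ s : S, Tendsto (fun k => π (s : G) (v k) - v k) atTop (𝓝 (q s)) := by
    intro s
    have : Tendsto (fun k => u k s) atTop (𝓝 (q s)) := 
      ((PiLp.continuous_apply 2 (fun _ : S => H) s).tendsto q).comp hlim
    refine this.congr fun k => ?_
    rw [← hv k, hD]
  have hlim2 : ∀ g, ∃ c, Tendsto (fun k => π g (v k) - v k) atTop (𝓝 c) := by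
    intro g
    obtain ⟨l, hl, rfl⟩ := exists_list hG g
    induction l with
    | nil => refine ⟨0, ?_⟩; simp
    | cons a l ih =>
      obtain ⟨c, hc⟩ := ih (fun x hx => hl x (by simp [hx]))
      refine ⟨π a c + q ⟨a, hl a (by simp)⟩, ?_⟩
      refine ((((π a).continuous.tendsto c).comp hc).add (hlim1 ⟨a, hl a (by simp)⟩)).congr fun k => ?_
      simp only [Function.comp, List.prod_cons, pi_mul, map_sub]
      abel
  choose c hc using hlim2
  have hcc : IsCoc π c := by
    intro g h
    refine tendsto_nhds_unique (hc (g * h)) 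
      (((hc g).add (((π g).continuous.tendsto _).comp (hc h))).congr fun k => ?_)
    simp only [Function.comp, pi_mul, map_sub]
    abel
  have hcs : ∀ s : S, c s = q s := fun s => tendsto_nhds_unique (hc s) (hlim1 s)
  have hb' := hb.sub hcc
  refine ⟨fun g => b g - c g, hb', ?_, ?_⟩
  · have horth : ∀ w, ∑ s ∈ S, ⟪b s - c s, π s w - w⟫_ℝ = 0 := by
      intro w
      have := Submodule.starProjection_inner_eq_zero (K := R) x (D w) 
        ((LinearMap.range D).le_topologicalClosure ⟨w, rfl⟩)
      rw [PiLp.inner_apply] at this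
      rw [← this, ← Finset.sum_coe_sort S]
      refine Finset.sum_congr rfl fun s _ => ?_
      rw [hD, hcs]; rfl
    set y := ∑ s ∈ S, (b s - c s) with hy
    have h2 : ∑ s ∈ S, ⟪b s - c s, π s y⟫_ℝ = - ⟪y, y⟫_ℝ := by
      have : ∀ s ∈ S, ⟪b s - c s, π s y⟫_ℝ = - ⟪b s⁻¹ - c s⁻¹, y⟫_ℝ := by
        intro s _
        rw [real_inner_comm, inner_pi, real_inner_comm, ← inner_neg_left]
        congr 1
        have := hb' s⁻¹ s
        have h1 := hb'.one
        rw [inv_mul_cancel] at this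
        simp only [] at this h1
        rw [h1] at this
        exact eq_neg_of_add_eq_zero_right this.symm
      rw [Finset.sum_congr rfl this, Finset.sum_neg_distrib, hy, ← hy, sum_inner]
      congr 1
      refine Finset.sum_nbij' (fun s => s⁻¹) (fun s => s⁻¹) (fun s hs => hG.1 s hs) (fun s hs => hG.1 s hs) 
        (by simp) (by simp) (by simp)
    have h3 := horth y
    simp_rw [inner_sub_right] at h3
    rw [Finset.sum_sub_distrib, h2, ← sum_inner, ← hy] at h3
    have : ⟪y, y⟫_ℝ = 0 := by linarith
    exact inner_self_eq_zero.1 this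
  · intro ε hε
    have h1 : ∀ᶠ k in atTop, ∀ s ∈ S, dist (π s (v k) - v k) (c s) < ε := by
      rw [Filter.eventually_all_finset]
      intro s _
      exact (Metric.tendsto_nhds.1 (hc s)) ε hε
    obtain ⟨k, hk⟩ := h1.exists
    refine ⟨2 * ‖v k‖, fun g => ?_⟩
    have hco : IsCoc π (fun g => π g (v k) - v k) := by
      intro g h
      simp only [pi_mul, map_sub]; abel
    have := (hcc.sub hco).norm_le hG ε (fun s hs => by
      have := hk s hs
      rw [dist_comm, dist_eq_norm] at this
      exact this.le) g
    rw [sub_sub_cancel]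
    calc ‖c g‖ = ‖(c g - (π g (v k) - v k)) + (π g (v k) - v k)‖ := by rw [sub_add_cancel]
      _ ≤ ‖c g - (π g (v k) - v k)‖ + ‖π g (v k) - v k‖ := norm_add_le _ _
      _ ≤ ε * len (S : Set G) g + (‖π g (v k)‖ + ‖v k‖) := add_le_add this (norm_sub_le _ _)
      _ = _ := by rw [LinearIsometryEquiv.norm_map]; ring

theorem exhaustion {S : Finset G} {π : G →* (H ≃ₗᵢ[ℝ] H)} {b : G → H} (hS : S.Nonempty) (hG : IsWordGenSet S) 
    (hb : IsCoc π b) (hh : ∑ s ∈ S, b s = 0) (K : ℝ) (hK : 0 < K)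
    (good : ∃ᶠ n : ℕ in atTop, ∀ t ∈ S, hel S n t ≤ K / ((n:ℝ)+1)) (ε : ℝ) (hε : 0 < ε) :
    ∃ W : Submodule ℝ H, FDInv π W ∧ ∀ s ∈ S, ∃ w ∈ W, ‖b s - w‖ ≤ ε := by
  set V0 : Submodule ℝ H := sSup {W | FDInv π W} with hV0
  have hdir : DirectedOn (· ≤ ·) {W | FDInv π W} := fun W hW W' hW' => 
    ⟨W ⊔ W', FDInv.sup hW hW', le_sup_left, le_sup_right⟩
  have hmem : ∀ x, x ∈ V0 ↔ ∃ W, FDInv π W ∧ x ∈ W := by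
    intro x
    rw [hV0, Submodule.mem_sSup_of_directed ⟨⊥, FDInv.bot⟩ hdir]
    rfl
  set V := V0.topologicalClosure with hV
  have hVc : IsClosed (V : Set H) := V0.isClosed_topologicalClosure
  have : CompleteSpace V := hVc.completeSpace_coe
  have hinv0 : ∀ g, ∀ w ∈ V0, π g w ∈ V0 := by
    intro g w hw
    obtain ⟨W, hW, hw⟩ := (hmem w).1 hw
    exact (hmem _).2 ⟨W, hW, hW.2 g w hw⟩
  have hinv : ∀ g, ∀ w ∈ V, π g w ∈ V := by
    intro g w hw
    exact map_mem_closure (π g).continuous hw (fun x hx => hinv0 g x hx)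
  have hbV : ∀ s ∈ S, b s ∈ V := by
    by_contra! hcon
    obtain ⟨s, hs, hbs⟩ := hcon
    obtain ⟨W, h1, h2, h3, h4⟩ := key (b := fun g => b g - V.starProjection (b g)) hS hG 
      (hb.sub (hb.proj V hinv)) (by 
        rw [Finset.sum_sub_distrib, ← map_sum, hh, map_zero, sub_zero]) K hK good ⟨s, hs, by
          intro h0
          apply hbs
          rw [sub_eq_zero.1 h0]
          exact Submodule.starProjection_apply_mem V _⟩
    apply h2
    rw [Submodule.eq_bot_iff]
    intro w hw
    have hwV : w ∈ V := V0.le_topologicalClosure ((hmem w).2 ⟨W, ⟨h1, h3⟩, hw⟩)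
    have := h4 w (fun g => Submodule.starProjection_inner_eq_zero _ _ hwV) w hw
    exact inner_self_eq_zero.1 this
  have hch : ∀ s : G, ∃ W, FDInv π W ∧ (s ∈ S → ∃ w ∈ W, ‖b s - w‖ ≤ ε) := by
    intro s
    by_cases hs : s ∈ S
    · obtain ⟨w, hw, hd⟩ := Metric.mem_closure_iff.1 (hbV s hs) ε hε
      obtain ⟨W, hW, hwW⟩ := (hmem w).1 hw
      exact ⟨W, hW, fun _ => ⟨w, hwW, by rw [← dist_eq_norm]; exact hd.le⟩⟩
    · exact ⟨⊥, FDInv.bot, fun h => absurd h hs⟩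
  choose Ws hW1 hW2 using hch
  refine ⟨S.sup Ws, ?_, ?_⟩
  · exact Finset.sup_induction FDInv.bot (fun _ h _ h' => h.sup h') (fun s _ => hW1 s)
  · intro s hs
    obtain ⟨w, hw, hd⟩ := hW2 s hs
    exact ⟨w, Finset.le_sup (f := Ws) hs hw, hd⟩

lemma norm_sub_proj_le (W : Submodule ℝ H) [W.HasOrthogonalProjection] (x w : H) (hw : w ∈ W) :
    ‖x - W.starProjection x‖ ≤ ‖x - w‖ := by
  rw [Submodule.starProjection_minimal]
  exact ciInf_le ⟨0, by rintro _ ⟨y, rfl⟩; exact norm_nonneg _⟩ (⟨w, hw⟩ : W)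

/-- restriction of a representation to an invariant subspace -/
def restr (π : G →* (H ≃ₗᵢ[ℝ] H)) (W : Submodule ℝ H) (hW : ∀ g, ∀ w ∈ W, π g w ∈ W) :
    G →* (W ≃ₗᵢ[ℝ] W) where
  toFun g := 
    { toFun := fun w => ⟨π g w, hW g w w.2⟩
      invFun := fun w => ⟨π g⁻¹ w, hW g⁻¹ w w.2⟩
      map_add' := by intro x y; ext; simp
      map_smul' := by intro c x; ext; simp
      left_inv := by intro x; ext; simp only [pi_inv_self]
      right_inv := by intro x; ext; simp only [pi_self_inv]
      norm_map' := by intro x; exact (π g).norm_map x }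
  map_one' := by ext x; exact pi_one π x
  map_mul' g h := by ext x; exact pi_mul π g h x

theorem fd_coc {S : Finset G} {π : G →* (H ≃ₗᵢ[ℝ] H)} {b : G → H} (hS : S.Nonempty) (hG : IsWordGenSet S) 
    (hb : IsCoc π b) (K : ℝ) (hK : 0 < K)
    (good : ∃ᶠ n : ℕ in atTop, ∀ t ∈ S, hel S n t ≤ K / ((n:ℝ)+1)) (c C : ℝ) (hc : 0 < c) 
    (hlow : ∀ g, c * len (S : Set G) g - C ≤ ‖b g‖) : 
    ∃ (W : Type) (_ : NormedAddCommGroup W) (_ : InnerProductSpace ℝ W) (_ : FiniteDimensional ℝ W)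
      (ρ : G →* (W ≃ₗᵢ[ℝ] W)) (β : G → W), IsCoc ρ β ∧ ∀ R : ℝ, {g | ‖β g‖ ≤ R}.Finite := by
  obtain ⟨b', hb', hh, hsub⟩ := harmonicize hG hb
  obtain ⟨M, hM⟩ := hsub (c/4) (by positivity)
  obtain ⟨W, hW, hWs⟩ := exhaustion hS hG hb' hh K hK good (c/4) (by positivity)
  have := hW.1
  have hβ := hb'.proj W hW.2
  have hd := (hb'.sub hβ).norm_le hG (c/4) (fun s hs => by
    obtain ⟨w, hw, h⟩ := hWs s hs
    exact (norm_sub_proj_le W _ w hw).trans h)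
  refine ⟨W, inferInstance, inferInstance, hW.1, restr π W hW.2, 
    fun g => ⟨W.starProjection (b' g), Submodule.starProjection_apply_mem W _⟩, ?_, ?_⟩
  · intro g h
    ext
    exact hβ g h
  · intro R
    obtain ⟨n, hn⟩ := exists_nat_ge ((R + C + M) / (c/2))
    refine (finite_len_le hG n).subset fun g hg => ?_
    have hg : ‖W.starProjection (b' g)‖ ≤ R := hg
    have h1 := hlow g
    have h2 := hM g
    have h3 := hd g
    have h4 : ‖b g‖ ≤ ‖b g - b' g‖ + ‖b' g - W.starProjection (b' g)‖ + ‖W.starProjection (b' g)‖ := by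
      calc ‖b g‖ = ‖(b g - b' g) + (b' g - W.starProjection (b' g)) + W.starProjection (b' g)‖ := by
            congr 1; abel
        _ ≤ _ := norm_add₃_le
    have h5 : (len (S : Set G) g : ℝ) ≤ n := by
      refine le_trans ?_ hn
      rw [le_div_iff₀ (by positivity)]
      linarith
    exact_mod_cast h5

end exh
end QI

namespace QI
open scoped InnerProductSpace Topology
open Filter UniformSpace

section mean
variable {G : Type} [Group G]

def Bdd (F : G → ℝ) : Prop := ∃ M : ℝ, ∀ x, |F x| ≤ M

theorem exists_mean {S : Finset G} (hG : IsWordGenSet S) (h1 : (1:G) ∈ S) (K : ℝ)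
    (good : ∃ᶠ n : ℕ in atTop, ∀ t ∈ S, hel S n t ≤ K / ((n:ℝ)+1)) : 
    ∃ m : (G → ℝ) → ℝ, (∀ F F', Bdd F → Bdd F' → m (fun x => F x + F' x) = m F + m F') ∧ 
      (∀ c F, Bdd F → m (fun x => c * F x) = c * m F) ∧ 
      (∀ F c, Bdd F → (∀ x, c ≤ F x) → c ≤ m F) ∧
      (∀ F g, Bdd F → m (fun x => F (g * x)) = m F) := by
  have hS : S.Nonempty := ⟨1, h1⟩
  have hnb : (atTop ⊓ 𝓟 {n : ℕ | ∀ t ∈ S, hel S n t ≤ K / ((n:ℝ)+1)}).NeBot := 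
    Filter.frequently_mem_iff_neBot.1 good
  let ω : Ultrafilter ℕ := @Ultrafilter.of _ _ hnb
  have hω : (ω : Filter ℕ) ≤ atTop ⊓ 𝓟 {n : ℕ | ∀ t ∈ S, hel S n t ≤ K / ((n:ℝ)+1)} := 
    @Ultrafilter.of_le _ _ hnb
  have hω1 : (ω : Filter ℕ) ≤ atTop := hω.trans inf_le_left
  have hω2 : ∀ᶠ n in (ω : Filter ℕ), ∀ t ∈ S, hel S n t ≤ K / ((n:ℝ)+1) := 
    le_principal_iff.1 (hω.trans inf_le_right)
  have hEb : ∀ (F : G → ℝ) (M : ℝ), (∀ x, |F x| ≤ M) → ∀ n, |EE S n F| ≤ M := by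
    intro F M hM n
    rw [abs_le]
    constructor
    · rw [← EE_const S hS n (-M)]
      exact EE_mono S n fun x => (abs_le.1 (hM x)).1
    · rw [← EE_const S hS n M]
      exact EE_mono S n fun x => (abs_le.1 (hM x)).2
  have hex : ∀ F : G → ℝ, ∃ l, Bdd F → Tendsto (fun n => EE S n F) ω (𝓝 l) := by
    intro F
    by_cases hF : Bdd F
    · obtain ⟨M, hM⟩ := hF
      obtain ⟨l, hl⟩ := exists_ulim ω (fun n => EE S n F) M (hEb F M hM)
      exact ⟨l, fun _ => hl⟩
    · exact ⟨0, fun h => absurd h hF⟩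
  choose m hm using hex
  have htr : ∀ F : G → ℝ, Bdd F → ∀ g : G, Bdd fun x => F (g * x) := 
    fun F ⟨M, hM⟩ g => ⟨M, fun x => hM _⟩
  refine ⟨m, ?_, ?_, ?_, ?_⟩
  · intro F F' hF hF'
    have hb : Bdd (fun x => F x + F' x) := by
      obtain ⟨M, hM⟩ := hF
      obtain ⟨M', hM'⟩ := hF'
      exact ⟨M + M', fun x => (abs_add_le _ _).trans (add_le_add (hM x) (hM' x))⟩
    refine tendsto_nhds_unique (hm _ hb) (((hm F hF).add (hm F' hF')).congr fun n => ?_)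
    rw [EE_add]
  · intro c F hF
    have hb : Bdd (fun x => c * F x) := by
      obtain ⟨M, hM⟩ := hF
      exact ⟨|c| * M, fun x => by rw [abs_mul]; exact mul_le_mul_of_nonneg_left (hM x) (abs_nonneg _)⟩
    refine tendsto_nhds_unique (hm _ hb) (((hm F hF).const_mul c).congr fun n => ?_)
    rw [EE_smul]
  · intro F c hF hc
    refine ge_of_tendsto (hm F hF) (Eventually.of_forall fun n => ?_)
    rw [← EE_const S hS n c]
    exact EE_mono S n hc
  · have hsq : ∀ F, Bdd F → ∀ t ∈ S, Tendsto (fun n => EE S n (fun x => F (t * x)) - EE S (n+1) F) ω (𝓝 0) := by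
      intro F ⟨M, hM⟩ t ht
      have h3 : Tendsto (fun n : ℕ => (K * (2 * (S.card + 1) * M^2)) * (1 / ((n:ℝ)+1))) ω (𝓝 0) := by
        have := (tendsto_one_div_add_atTop_nhds_zero_nat (𝕜 := ℝ)).const_mul (K * (2 * (S.card + 1) * M^2))
        rw [mul_zero] at this
        exact this.mono_left hω1
      have h4 : Tendsto (fun n => (EE S n (fun x => F (t * x)) - EE S (n+1) F)^2) ω (𝓝 0) := by
        refine squeeze_zero' (Eventually.of_forall fun n => sq_nonneg _) (hω2.mono fun n hn => ?_) h3
        refine (hel_cs S hS n ht F).trans ?_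
        have e1 : EE S (n+1) (fun x => F x ^ 2) ≤ M^2 := by
          rw [← EE_const S hS (n+1) (M^2)]
          refine EE_mono S _ fun x => ?_
          rw [← sq_abs]
          exact pow_le_pow_left₀ (abs_nonneg _) (hM x) 2
        have e0 : 0 ≤ EE S (n+1) (fun x => F x ^ 2) := EE_nonneg S _ fun x => sq_nonneg _
        have e2 : 0 ≤ hel S n t := tsum_nonneg fun x => sq_nonneg _
        calc _ ≤ hel S n t * (2 * (S.card + 1) * M^2) := by gcongr
          _ ≤ K / ((n:ℝ)+1) * (2 * (S.card + 1) * M^2) := by gcongr; exact hn t ht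
          _ = _ := by ring
      rw [tendsto_zero_iff_abs_tendsto_zero]
      have := h4.sqrt
      simp only [Real.sqrt_sq_eq_abs, Real.sqrt_zero] at this
      exact this
    have hinv : ∀ t ∈ S, ∀ F, Bdd F → m (fun x => F (t * x)) = m F := by
      intro t ht F hF
      have e1 := (hsq F hF t ht).sub (hsq F hF 1 h1)
      have e2 := (hm _ (htr F hF t)).sub (hm F hF)
      have : m (fun x => F (t * x)) - m F = 0 - 0 := by
        refine tendsto_nhds_unique e2 (e1.congr fun n => ?_)
        simp
      linarith
    intro F g
    obtain ⟨l, hl, rfl⟩ := exists_list hG g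
    induction l generalizing F with
    | nil => intro _; simp
    | cons a l ih =>
      intro hF
      have := ih (fun x => F (a * x)) (fun x hx => hl x (by simp [hx])) (htr F hF a)
      rw [hinv a (hl a (by simp)) F hF] at this
      rw [← this]
      simp [mul_assoc]
end mean

section gns
variable {G : Type} [Group G]

theorem gns (F : Type) [AddCommGroup F] [Module ℝ F] (cd : PreInnerProductSpace.Core ℝ F) 
    (σ : G → F →ₗ[ℝ] F) (h1 : ∀ x, σ 1 x = x) (hmul : ∀ g h x, σ (g * h) x = σ g (σ h x)) 
    (hiso : ∀ g x, cd.inner (σ g x) (σ g x) = cd.inner x x) (β : G → F) 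
    (hβ : ∀ g h, β (g * h) = β g + σ g (β h)) : 
    ∃ (H : Type) (_ : NormedAddCommGroup H) (_ : InnerProductSpace ℝ H) (_ : CompleteSpace H) 
      (π : G →* (H ≃ₗᵢ[ℝ] H)) (b : G → H), IsCoc π b ∧ ∀ g, ‖b g‖^2 = cd.inner (β g) (β g) := by
  let : SeminormedAddCommGroup F := @InnerProductSpace.Core.toSeminormedAddCommGroup ℝ F _ _ _ cd
  let : InnerProductSpace ℝ F := InnerProductSpace.ofCore cd
  have hn : ∀ x : F, ‖x‖^2 = cd.inner x x := fun x => by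
    rw [← real_inner_self_eq_norm_sq]
  have hσn : ∀ g x, ‖σ g x‖ = ‖x‖ := by
    intro g x
    have := hiso g x
    rw [← hn, ← hn] at this
    exact (sq_eq_sq₀ (norm_nonneg _) (norm_nonneg _)).1 this
  let τ : G → NormedAddGroupHom F F := fun g => 
    (σ g).toAddMonoidHom.mkNormedAddGroupHom 1 (fun x => by rw [one_mul]; exact (hσn g x).le)
  have hτ : ∀ g x, τ g x = σ g x := fun _ _ => rfl
  let T : G → Completion F → Completion F := fun g => (τ g).completion
  have hT : ∀ g (x : F), T g (x : Completion F) = (σ g x : F) := fun g x => 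
    NormedAddGroupHom.completion_coe _ _
  have hTc : ∀ g, Continuous (T g) := fun g => (τ g).completion.continuous
  have hT1 : ∀ x, T 1 x = x := by
    intro x
    induction x using Completion.induction_on with
    | hp => exact isClosed_eq (hTc 1) continuous_id
    | ih a => rw [hT, h1]
  have hTm : ∀ g h x, T (g * h) x = T g (T h x) := by
    intro g h x
    induction x using Completion.induction_on with
    | hp => exact isClosed_eq (hTc _) ((hTc g).comp (hTc h))
    | ih a => rw [hT, hT, hT, hmul]
  have hTn : ∀ g x, ‖T g x‖ = ‖x‖ := by
    intro g x
    induction x using Completion.induction_on with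
    | hp => exact isClosed_eq (hTc g).norm continuous_norm
    | ih a => rw [hT, Completion.norm_coe, Completion.norm_coe, hσn]
  let TL : G → Completion F →L[ℝ] Completion F := fun g => 
    (τ g).completion.toAddMonoidHom.toRealLinearMap (hTc g)
  have hTL : ∀ g x, TL g x = T g x := fun _ _ => rfl
  let π : G →* (Completion F ≃ₗᵢ[ℝ] Completion F) := 
    { toFun := fun g => 
        { toFun := T g
          invFun := T g⁻¹
          map_add' := (TL g).map_add
          map_smul' := (TL g).map_smul
          left_inv := fun x => by rw [← hTm, inv_mul_cancel, hT1]
          right_inv := fun x => by rw [← hTm, mul_inv_cancel, hT1]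
          norm_map' := hTn g }
      map_one' := by ext x; exact hT1 x
      map_mul' := fun g h => by ext x; exact hTm g h x }
  have hπ : ∀ g x, π g x = T g x := fun _ _ => rfl
  refine ⟨Completion F, inferInstance, inferInstance, inferInstance, π, fun g => (β g : Completion F), ?_, ?_⟩
  · intro g h
    simp only []
    rw [hπ, hT, hβ, Completion.coe_add]
  · intro g
    rw [Completion.norm_coe, hn]

/-- bounded functions -/
def BF (G E : Type) [NormedAddCommGroup E] [InnerProductSpace ℝ E] : Submodule ℝ (G → E) where
  carrier := {F | ∃ M : ℝ, ∀ x, ‖F x‖ ≤ M}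
  add_mem' := by
    rintro F F' ⟨M, hM⟩ ⟨M', hM'⟩
    exact ⟨M + M', fun x => (norm_add_le _ _).trans (add_le_add (hM x) (hM' x))⟩
  zero_mem' := ⟨0, by simp⟩
  smul_mem' := by
    rintro c F ⟨M, hM⟩
    refine ⟨|c| * M, fun x => ?_⟩
    rw [Pi.smul_apply, norm_smul, Real.norm_eq_abs]
    exact mul_le_mul_of_nonneg_left (hM x) (abs_nonneg _)

lemma BF_bdd {E : Type} [NormedAddCommGroup E] [InnerProductSpace ℝ E] (F F' : BF G E) : 
    Bdd (fun x => ⟪F.1 x, F'.1 x⟫_ℝ) := by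
  obtain ⟨F, M, hM⟩ := F
  obtain ⟨F', M', hM'⟩ := F'
  exact ⟨M * M', fun x => (abs_real_inner_le_norm _ _).trans 
    (mul_le_mul (hM x) (hM' x) (norm_nonneg _) ((norm_nonneg _).trans (hM x)))⟩

theorem proper_coc {S : Finset G} (hG : IsWordGenSet S) (h1 : (1:G) ∈ S) (K : ℝ)
    (good : ∃ᶠ n : ℕ in atTop, ∀ t ∈ S, hel S n t ≤ K / ((n:ℝ)+1)) {E : Type} [NormedAddCommGroup E] 
    [InnerProductSpace ℝ E] (φ : G → E) (hup : ∀ g, ∃ M, ∀ x, ‖φ (x * g) - φ x‖ ≤ M) (c C : ℝ) 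
    (hlow : ∀ x g, c * len (S : Set G) g - C ≤ ‖φ (x * g) - φ x‖) :
    ∃ (H : Type) (_ : NormedAddCommGroup H) (_ : InnerProductSpace ℝ H) (_ : CompleteSpace H) 
      (π : G →* (H ≃ₗᵢ[ℝ] H)) (b : G → H), IsCoc π b ∧ ∀ g, c * len (S : Set G) g - C ≤ ‖b g‖ := by
  obtain ⟨m, madd, msmul, mpos, minv⟩ := exists_mean hG h1 K good
  let cd : PreInnerProductSpace.Core ℝ (BF G E) := 
    { inner := fun F F' => m (fun x => ⟪F.1 x, F'.1 x⟫_ℝ)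
      conj_inner_symm := by
        intro F F'
        simp only [conj_trivial]
        congr 1; ext x; exact real_inner_comm _ _
      re_inner_nonneg := by
        intro F
        simp only [RCLike.re_to_real]
        exact mpos _ 0 (BF_bdd F F) (fun x => real_inner_self_nonneg)
      add_left := by
        intro F F' F''
        rw [← madd _ _ (BF_bdd F F'') (BF_bdd F' F'')]
        congr 1; ext x; exact inner_add_left _ _ _
      smul_left := by
        intro F F' r
        simp only [conj_trivial]
        rw [← msmul r _ (BF_bdd F F')]
        congr 1; ext x; exact real_inner_smul_left _ _ _ }
  let σ : G → BF G E →ₗ[ℝ] BF G E := fun g => 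
    { toFun := fun F => ⟨fun x => F.1 (g⁻¹ * x), by
        obtain ⟨F, M, hM⟩ := F
        exact ⟨M, fun x => hM _⟩⟩
      map_add' := fun F F' => rfl
      map_smul' := fun c F => rfl }
  let β : G → BF G E := fun g => ⟨fun x => φ (x⁻¹ * g) - φ x⁻¹, by
    obtain ⟨M, hM⟩ := hup g
    exact ⟨M, fun x => hM _⟩⟩
  obtain ⟨H, i1, i2, i3, π, b, hb, hnb⟩ := gns (BF G E) cd σ (fun F => by
      ext x; simp [σ]) (fun g h F => by ext x; simp [σ, mul_assoc]) (fun g F => by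
      exact minv (fun x => ⟪F.1 x, F.1 x⟫_ℝ) g⁻¹ (BF_bdd F F)) β (fun g h => by
      ext x
      simp [σ, β, mul_assoc])
  refine ⟨H, i1, i2, i3, π, b, hb, fun g => ?_⟩
  rcases le_total (c * len (S : Set G) g - C) 0 with h | h
  · exact h.trans (norm_nonneg _)
  · refine le_of_sq_le_sq ?_ (norm_nonneg _)
    rw [hnb]
    refine mpos _ _ (BF_bdd _ _) fun x => ?_
    rw [real_inner_self_eq_norm_sq]
    exact pow_le_pow_left₀ h (hlow _ _) 2
end gns
end QI

namespace QI

lemma abf_of_abelian_finiteIndex {G : Type*} [Group G] (N : Subgroup G) [N.FiniteIndex] 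
    (h : ∀ a b : G, a ∈ N → b ∈ N → a * b = b * a) : AbelianByFinite G :=
  ⟨N.normalCore, inferInstance, fun a b ha hb => h a b (N.normalCore_le ha) (N.normalCore_le hb), 
    inferInstance⟩

lemma abf_of_finiteIndex {G : Type*} [Group G] (K : Subgroup G) [K.FiniteIndex] (h : AbelianByFinite K) :
    AbelianByFinite G := by
  obtain ⟨N, hN, hab, hfin⟩ := h
  have hNi : N.FiniteIndex := Subgroup.finiteIndex_of_finite_quotient
  have : (N.map K.subtype).FiniteIndex := by
    refine ⟨?_⟩
    rw [Subgroup.index_map_subtype]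
    exact mul_ne_zero hNi.index_ne_zero Subgroup.FiniteIndex.index_ne_zero
  refine abf_of_abelian_finiteIndex (N.map K.subtype) ?_
  rintro _ _ ⟨a, ha, rfl⟩ ⟨b, hb, rfl⟩
  rw [← map_mul, hab a b ha hb, map_mul]

lemma abf_of_hom {G : Type*} [Group G] (hfg : Group.FG G) {V : Type*} [AddCommGroup V] (b : G → V)
    (hb : ∀ g h, b (g * h) = b g + b h) (hfin : {g | b g = 0}.Finite) : AbelianByFinite G := by
  have h1 : b 1 = 0 := by simpa using hb 1 1
  have hinv : ∀ g, b g⁻¹ = - b g := fun g => by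
    have := hb g g⁻¹
    rw [mul_inv_cancel, h1] at this
    exact (neg_eq_of_add_eq_zero_right this.symm).symm
  have : Finite (commutatorSet G) := by
    refine Set.Finite.to_subtype (hfin.subset ?_)
    rintro _ ⟨g, h, rfl⟩
    simp only [Set.mem_setOf_eq, commutatorElement_def, hb, hinv]
    abel
  have : (Subgroup.center G).FiniteIndex := inferInstance
  refine abf_of_abelian_finiteIndex (Subgroup.center G) ?_
  intro a c ha _
  exact (Subgroup.mem_center_iff.1 ha c).symm
end QI

namespace QI
open scoped InnerProductSpace Topology commutatorElement

section bieb
variable {G : Type} [Group G] {V : Type} [NormedAddCommGroup V] [InnerProductSpace ℝ V]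

noncomputable def UU (π : G →* (V ≃ₗᵢ[ℝ] V)) (g : G) : V →L[ℝ] V := (π g).toLinearIsometry.toContinuousLinearMap

lemma UU_apply (π : G →* (V ≃ₗᵢ[ℝ] V)) (g : G) (v : V) : UU π g v = π g v := rfl

lemma UU_mul (π : G →* (V ≃ₗᵢ[ℝ] V)) (g h : G) : UU π (g * h) = UU π g * UU π h := by
  ext v; exact pi_mul π g h v

lemma UU_one (π : G →* (V ≃ₗᵢ[ℝ] V)) : UU π 1 = 1 := by
  ext v; exact pi_one π v

lemma UU_norm (π : G →* (V ≃ₗᵢ[ℝ] V)) (g : G) : ‖UU π g‖ ≤ 1 :=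
  ContinuousLinearMap.opNorm_le_bound _ zero_le_one (fun v => by rw [UU_apply, LinearIsometryEquiv.norm_map, one_mul])

noncomputable def rr (π : G →* (V ≃ₗᵢ[ℝ] V)) (g : G) : ℝ := ‖UU π g - 1‖

lemma rr_nonneg (π : G →* (V ≃ₗᵢ[ℝ] V)) (g : G) : 0 ≤ rr π g := norm_nonneg _

lemma rr_le (π : G →* (V ≃ₗᵢ[ℝ] V)) (g : G) (v : V) : ‖π g v - v‖ ≤ rr π g * ‖v‖ := 
  (UU π g - 1).le_opNorm v

lemma rr_zero {π : G →* (V ≃ₗᵢ[ℝ] V)} {g : G} (h : rr π g = 0) (v : V) : π g v = v := by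
  have := rr_le π g v
  rw [h, zero_mul] at this
  exact sub_eq_zero.1 (norm_le_zero_iff.1 this)

lemma rr_div (π : G →* (V ≃ₗᵢ[ℝ] V)) (g h : G) : rr π (g⁻¹ * h) ≤ ‖UU π g - UU π h‖ := by
  have : UU π (g⁻¹ * h) - 1 = UU π g⁻¹ * (UU π h - UU π g) := by
    rw [mul_sub, ← UU_mul, ← UU_mul, inv_mul_cancel, UU_one]
  unfold rr
  rw [this, norm_sub_rev (UU π g)]
  calc _ ≤ ‖UU π g⁻¹‖ * ‖UU π h - UU π g‖ := norm_mul_le _ _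
    _ ≤ 1 * ‖UU π h - UU π g‖ := by gcongr; exact UU_norm _ _
    _ = _ := one_mul _

lemma rr_comm (π : G →* (V ≃ₗᵢ[ℝ] V)) (g h : G) : rr π ⁅g, h⁆ ≤ 2 * rr π g * rr π h := by
  have : UU π ⁅g, h⁆ - 1 = ((UU π g - 1) * (UU π h - 1) - (UU π h - 1) * (UU π g - 1)) * UU π (g⁻¹ * h⁻¹) := by
    have e : (UU π g - 1) * (UU π h - 1) - (UU π h - 1) * (UU π g - 1) = UU π (g * h) - UU π (h * g) := by
      rw [UU_mul, UU_mul]; noncomm_ring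
    rw [e, sub_mul, ← UU_mul, ← UU_mul]
    have e1 : h * g * (g⁻¹ * h⁻¹) = 1 := by group
    rw [e1, UU_one, commutatorElement_def]
    simp only [mul_assoc]
  unfold rr
  rw [this]
  calc _ ≤ ‖(UU π g - 1) * (UU π h - 1) - (UU π h - 1) * (UU π g - 1)‖ * ‖UU π (g⁻¹ * h⁻¹)‖ := norm_mul_le _ _
    _ ≤ (‖(UU π g - 1) * (UU π h - 1)‖ + ‖(UU π h - 1) * (UU π g - 1)‖) * 1 := by
      gcongr
      · exact norm_sub_le _ _
      · exact UU_norm _ _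
    _ ≤ (‖UU π g - 1‖ * ‖UU π h - 1‖ + ‖UU π h - 1‖ * ‖UU π g - 1‖) * 1 := by
      gcongr <;> exact norm_mul_le _ _
    _ = _ := by ring

lemma b_comm {π : G →* (V ≃ₗᵢ[ℝ] V)} {b : G → V} (hb : IsCoc π b) (g h : G) : 
    b ⁅g, h⁆ = (π g (b h) - b h) - (π h (b g) - b g) - (π ⁅g, h⁆ (b (h * g)) - b (h * g)) := by
  have h1 := hb ⁅g, h⁆ (h * g)
  have h2 : ⁅g, h⁆ * (h * g) = g * h := by rw [commutatorElement_def]; group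
  rw [h2, hb g h] at h1
  have h3 := hb h g
  rw [h3] at h1 ⊢
  have h4 : b ⁅g, h⁆ = b g + π g (b h) - π ⁅g, h⁆ (b h + π h (b g)) := by rw [h1]; abel
  rw [h4]; abel

lemma b_comm_norm {π : G →* (V ≃ₗᵢ[ℝ] V)} {b : G → V} (hb : IsCoc π b) (g h : G) (R : ℝ) 
    (hg : rr π g ≤ 1/8) (hh : rr π h ≤ 1/8) (hg' : ‖b g‖ ≤ R) (hh' : ‖b h‖ ≤ R) : ‖b ⁅g, h⁆‖ ≤ R := by
  have hR : 0 ≤ R := (norm_nonneg _).trans hg'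
  have h1 : ‖π g (b h) - b h‖ ≤ 1/8 * R := (rr_le π g (b h)).trans (by gcongr)
  have h2 : ‖π h (b g) - b g‖ ≤ 1/8 * R := (rr_le π h (b g)).trans (by gcongr)
  have h3 : ‖b (h * g)‖ ≤ 2 * R := by
    rw [hb h g]
    refine (norm_add_le _ _).trans ?_
    rw [LinearIsometryEquiv.norm_map]; linarith
  have h4 : rr π ⁅g, h⁆ ≤ 1/32 := by
    have e := rr_nonneg π g
    have e' := rr_nonneg π h
    have := rr_comm π g h
    nlinarith
  have h5 : ‖π ⁅g, h⁆ (b (h * g)) - b (h * g)‖ ≤ 1/32 * (2 * R) := (rr_le π _ _).trans (by gcongr)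
  rw [b_comm hb]
  have := norm_sub_le ((π g (b h) - b h) - (π h (b g) - b g)) (π ⁅g, h⁆ (b (h * g)) - b (h * g))
  have := norm_sub_le (π g (b h) - b h) (π h (b g) - b g)
  linarith

variable [FiniteDimensional ℝ V]

theorem bieb_core (hfg : Group.FG G) {π : G →* (V ≃ₗᵢ[ℝ] V)} {b : G → V} (hb : IsCoc π b) 
    (hprop : ∀ R : ℝ, {g | ‖b g‖ ≤ R}.Finite) (A : Set G) (hA : Subgroup.closure A = ⊤) (hAf : A.Finite)
    (hr : ∀ g ∈ A, rr π g ≤ 1/8) (hAc : ∀ g ∈ A, ∀ h ∈ A, ⁅g, h⁆ ∈ A) 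
    (hfix : ∀ g ∈ A, ∀ c, (∀ v, π c v = v) → π g (b c) = b c)
    (IH : ∀ (W : Submodule ℝ V), Module.finrank ℝ W < Module.finrank ℝ V → ∀ (ρ : G →* (W ≃ₗᵢ[ℝ] W)) (β : G → W),
      IsCoc ρ β → (∀ R : ℝ, {g | ‖β g‖ ≤ R}.Finite) → AbelianByFinite G) : AbelianByFinite G := by
  by_cases h0 : ∀ g ∈ A, rr π g = 0
  · have htriv : ∀ g, ∀ v, π g v = v := by
      intro g
      have hg : g ∈ Subgroup.closure A := by rw [hA]; trivial
      induction hg using Subgroup.closure_induction with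
      | mem x hx => exact rr_zero (h0 x hx)
      | one => exact pi_one π
      | mul x y _ _ hx hy => intro v; rw [pi_mul, hy, hx]
      | inv x _ hx => 
        intro v
        conv_lhs => rw [← hx v]
        exact pi_inv_self π x v
    refine abf_of_hom hfg b (fun g h => by rw [hb g h, htriv]) ((hprop 0).subset ?_)
    intro g hg
    have hg : b g = 0 := hg
    simp [hg]
  push Not at h0
  obtain ⟨z0, hz0, hz0'⟩ := h0
  obtain ⟨z, ⟨hzA, hz⟩, hmin⟩ := Set.exists_min_image {g ∈ A | rr π g ≠ 0} (rr π) (hAf.subset (Set.sep_subset _ _)) ⟨z0, hz0, hz0'⟩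
  have hzpos : 0 < rr π z := lt_of_le_of_ne (rr_nonneg _ _) (Ne.symm hz)
  have hc : ∀ s ∈ A, ∀ v, π ⁅z, s⁆ v = v := by
    intro s hs
    apply rr_zero
    by_contra hne
    have h1 := hmin _ ⟨hAc z hzA s hs, hne⟩
    have h2 := rr_comm π z s
    have h3 := hr s hs
    have h4 := rr_nonneg π s
    nlinarith
  have hcomm : ∀ g v, π z (π g v) = π g (π z v) := by
    intro g
    have hg : g ∈ Subgroup.closure A := by rw [hA]; trivial
    induction hg using Subgroup.closure_induction with
    | mem x hx => 
      intro v
      have := hc x hx (π x (π z v))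
      rw [← pi_mul, ← pi_mul, commutatorElement_def] at this
      rw [← this, ← pi_mul]
      congr 2; group
    | one => intro v; simp [pi_one]
    | mul x y _ _ hx hy => intro v; rw [pi_mul, hx, hy, ← pi_mul]
    | inv x _ hx => 
      intro v
      have := hx (π x⁻¹ v)
      rw [pi_self_inv] at this
      rw [this, pi_inv_self]
  let V0 : Submodule ℝ V := 
    { carrier := {v | π z v = v}
      add_mem' := by
        intro v w (hv : π z v = v) (hw : π z w = w)
        change π z (v + w) = v + w
        rw [map_add, hv, hw]
      zero_mem' := map_zero (π z)
      smul_mem' := by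
        intro c v (hv : π z v = v)
        change π z (c • v) = c • v
        rw [map_smul, hv] }
  have hV0 : ∀ v, v ∈ V0 ↔ π z v = v := fun _ => Iff.rfl
  have hinv : ∀ g, ∀ w ∈ V0, π g w ∈ V0 := by
    intro g w hw
    rw [hV0] at hw ⊢
    rw [hcomm, hw]
  have hdim : Module.finrank ℝ V0 < Module.finrank ℝ V := by
    apply Submodule.finrank_lt
    intro htop
    apply hz
    have : UU π z = 1 := by
      ext v
      have : v ∈ V0 := by rw [htop]; trivial
      exact this
    simp [rr, this]
  have hβ := hb.proj V0 hinv
  have hd := hb.sub hβ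
  have hzinv : ∀ u ∈ V0, π z⁻¹ u = u := by
    intro u hu
    conv_lhs => rw [← (hV0 u).1 hu]
    exact pi_inv_self π z u
  have hort : ∀ x ∈ V0ᗮ, π z x - x ∈ V0ᗮ := by
    intro x hx
    rw [Submodule.mem_orthogonal'] at hx ⊢
    intro u hu
    rw [inner_sub_left, inner_pi, hzinv u hu, sub_self]
  let D : V0ᗮ →ₗ[ℝ] V0ᗮ := 
    { toFun := fun x => ⟨π z x - x, hort x x.2⟩
      map_add' := by intro x y; ext; simp; abel
      map_smul' := by intro c x; ext; simp [smul_sub] }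
  have hDinj : Function.Injective D := by
    rw [injective_iff_map_eq_zero]
    intro x hx
    have h1 : π z x - x = 0 := congrArg Subtype.val hx
    have h2 : (x : V) ∈ V0 := sub_eq_zero.1 h1
    ext
    exact inner_self_eq_zero.1 ((Submodule.mem_orthogonal V0 _).1 x.2 x h2)
  have hDsurj : Function.Surjective D := LinearMap.injective_iff_surjective.1 hDinj
  have hmem : ∀ g, b g - V0.starProjection (b g) ∈ V0ᗮ := fun g => Submodule.sub_starProjection_mem_orthogonal _
  obtain ⟨w, hw⟩ := hDsurj ⟨_, hmem z⟩
  have hw' : π z (w : V) - w = b z - V0.starProjection (b z) := congrArg Subtype.val hw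
  have hco : IsCoc π (fun g => π g (w : V) - w) := by
    intro g h
    simp only [pi_mul, map_sub]; abel
  have hdd := hd.sub hco
  have hort' : ∀ g, ∀ x ∈ V0ᗮ, π g x ∈ V0ᗮ := by
    intro g x hx
    rw [Submodule.mem_orthogonal'] at hx ⊢
    intro u hu
    rw [inner_pi]
    exact hx _ (hinv _ _ hu)
  have hgen : ∀ s ∈ A, b s - V0.starProjection (b s) - (π s (w : V) - w) = 0 := by
    intro s hs
    set x := b s - V0.starProjection (b s) - (π s (w : V) - w) with hx
    have hxo : x ∈ V0ᗮ := sub_mem (hmem s) (sub_mem (hort' s _ w.2) w.2)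
    suffices hx0 : x ∈ V0 from inner_self_eq_zero.1 ((Submodule.mem_orthogonal V0 _).1 hxo x hx0)
    have h1 := hfix z hzA _ (hc s hs)
    have h2 : V0.starProjection (b ⁅z, s⁆) = b ⁅z, s⁆ := Submodule.starProjection_eq_self_iff.2 h1
    rw [b_comm hb z s, hc s hs, sub_self, sub_zero] at h2
    simp only [map_sub, proj_comm π V0 hinv] at h2
    rw [hV0, hx]
    simp only [map_sub]
    rw [hcomm s w]
    have h3 : π z (w : V) = w + (b z - V0.starProjection (b z)) := by rw [← hw']; abel
    rw [h3]
    simp only [map_add, map_sub]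
    have h4 : π z (b s) = b s + (π s (b z) - b z) + ((π z (V0.starProjection (b s)) - V0.starProjection (b s)) - 
      (π s (V0.starProjection (b z)) - V0.starProjection (b z))) := by rw [h2]; abel
    rw [h4]
    abel
  have hall : ∀ g, b g - V0.starProjection (b g) - (π g (w : V) - w) = 0 := by
    intro g
    have hg : g ∈ Subgroup.closure A := by rw [hA]; trivial
    induction hg using Subgroup.closure_induction with
    | mem x hx => exact hgen x hx
    | one => exact hdd.one
    | mul x y _ _ hx hy => 
      have := hdd x y
      simp only [hx, hy, map_zero, add_zero] at this
      exact this
    | inv x _ hx => 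
      have := hdd x⁻¹ x
      have h1 := hdd.one
      simp only [hx, map_zero, add_zero, inv_mul_cancel] at this h1
      rw [← this, h1]
  refine IH V0 hdim (restr π V0 hinv) (fun g => ⟨V0.starProjection (b g), Submodule.starProjection_apply_mem V0 _⟩)
    (fun g h => by ext; exact hβ g h) ?_
  intro R
  refine (hprop (R + (‖(w:V)‖ + ‖(w:V)‖))).subset fun g hg => ?_
  have hg : ‖V0.starProjection (b g)‖ ≤ R := hg
  have h1 : b g = V0.starProjection (b g) + (π g (w : V) - w) := by
    rw [← sub_eq_zero, ← hall g]; abel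
  have h2 := norm_add_le (V0.starProjection (b g)) (π g (w : V) - w)
  have h3 := norm_sub_le (π g (w : V)) w
  rw [LinearIsometryEquiv.norm_map] at h3
  change ‖b g‖ ≤ _
  rw [h1]
  linarith

lemma finiteIndex_of_map (K : Subgroup G) {X : Type*} (f : G → X) (hf : (Set.range f).Finite) 
    (h : ∀ g g', f g = f g' → g⁻¹ * g' ∈ K) : K.FiniteIndex := by
  have : Finite (Set.range f) := hf
  have : Finite (G ⧸ K) := by
    refine Finite.of_injective (β := Set.range f) (fun q => ⟨f q.out, _, rfl⟩) ?_
    intro q q' hqq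
    have := h _ _ (congrArg Subtype.val hqq)
    rw [← QuotientGroup.eq, QuotientGroup.out_eq', QuotientGroup.out_eq'] at this
    exact this
  exact Subgroup.finiteIndex_of_finite_quotient

/-- stabilizer -/
def stb (π : G →* (V ≃ₗᵢ[ℝ] V)) (v : V) : Subgroup G where
  carrier := {g | π g v = v}
  one_mem' := pi_one π v
  mul_mem' := by
    intro g h (hg : π g v = v) (hh : π h v = v)
    change π (g * h) v = v
    rw [pi_mul, hh, hg]
  inv_mem' := by
    intro g (hg : π g v = v)
    change π g⁻¹ v = v
    conv_lhs => rw [← hg]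
    exact pi_inv_self π g v

lemma exists_G1 {π : G →* (V ≃ₗᵢ[ℝ] V)} {b : G → V} (hb : IsCoc π b) 
    (hprop : ∀ R : ℝ, {g | ‖b g‖ ≤ R}.Finite) : ∃ K : Subgroup G, K.FiniteIndex ∧ 
      ∀ g ∈ K, ∀ c, (∀ v, π c v = v) → π g (b c) = b c := by
  let L : Set V := {x | ∃ c, (∀ v, π c v = v) ∧ b c = x}
  obtain ⟨s, hsL, hspan⟩ := (Submodule.fg_span_iff_fg_span_finset_subset (R := ℝ) L).1 (IsNoetherian.noetherian _)
  have hstab : ∀ x ∈ L, (stb π x).FiniteIndex := by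
    rintro x ⟨c, hc, rfl⟩
    refine finiteIndex_of_map _ (fun g => π g (b c)) (((hprop ‖b c‖).image b).subset ?_) ?_
    · rintro _ ⟨g, rfl⟩
      have h1 : b (g * c * g⁻¹) = π g (b c) := by
        rw [hb, hb, pi_mul, hc]
        have := hb g g⁻¹
        rw [mul_inv_cancel, hb.one] at this
        rw [add_right_comm, ← this, zero_add]
      exact ⟨g * c * g⁻¹, by simp [h1], h1⟩
    · intro g g' hgg
      change π (g⁻¹ * g') (b c) = b c
      rw [pi_mul, ← hgg, pi_inv_self]
  refine ⟨⨅ x : s, stb π x, ?_, ?_⟩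
  · have : ∀ x : s, (stb π (x:V)).FiniteIndex := fun x => hstab x (hsL x.2)
    exact Subgroup.finiteIndex_iInf this
  · intro g hg c hc
    have h1 : b c ∈ Submodule.span ℝ (s : Set V) := by
      rw [← hspan]; exact Submodule.subset_span ⟨c, hc, rfl⟩
    rw [Subgroup.mem_iInf] at hg
    generalize b c = x at h1 ⊢
    induction h1 using Submodule.span_induction with
    | mem x hx => exact hg ⟨x, hx⟩
    | zero => exact map_zero _
    | add x y _ _ hx hy => rw [map_add, hx, hy]
    | smul a x _ hx => rw [map_smul, hx]

lemma exists_K2 (hfg : Group.FG G) {π : G →* (V ≃ₗᵢ[ℝ] V)} (b : G → V) (K : Subgroup G) (hK : K.FiniteIndex) : 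
    ∃ R : ℝ, (Subgroup.closure {g | g ∈ K ∧ rr π g ≤ 1/8 ∧ ‖b g‖ ≤ R}).FiniteIndex := by
  set A : Set G := {g | g ∈ K ∧ rr π g ≤ 1/8} with hA
  have h1 : (Subgroup.closure A).FiniteIndex := by
    have : ProperSpace (V →L[ℝ] V) := FiniteDimensional.proper ℝ _
    have htb := (isCompact_closedBall (0 : V →L[ℝ] V) 1).totallyBounded
    obtain ⟨t, ht, hcov⟩ := Metric.totallyBounded_iff.1 htb (1/16) (by norm_num)
    have hch : ∀ g, ∃ y ∈ t, dist (UU π g) y < 1/16 := by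
      intro g
      have := hcov (show UU π g ∈ Metric.closedBall 0 1 by simpa using UU_norm π g)
      simpa using this
    choose y hy hyd using hch
    refine finiteIndex_of_map _ (fun g => ((g : G ⧸ K), y g)) 
      (Set.Finite.subset (s := (Set.univ : Set (G ⧸ K)) ×ˢ t) (Set.finite_univ.prod ht) ?_) ?_
    · rintro _ ⟨g, rfl⟩
      exact ⟨trivial, hy g⟩
    · intro g g' hgg
      apply Subgroup.subset_closure
      have e1 : (g : G ⧸ K) = (g' : G ⧸ K) := congrArg Prod.fst hgg
      have e2 : y g = y g' := congrArg Prod.snd hgg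
      refine ⟨QuotientGroup.eq.1 e1, (rr_div π g g').trans ?_⟩
      rw [← dist_eq_norm]
      have d1 := hyd g
      have d2 := hyd g'
      rw [← e2] at d2
      have := dist_triangle_right (UU π g) (UU π g') (y g)
      linarith
  have h2 : (Subgroup.closure A).FG := (Group.fg_iff_subgroup_fg _).1 inferInstance
  obtain ⟨T, hT⟩ := h2
  have hmono : ∀ R R' : ℝ, R ≤ R' → Subgroup.closure {g | g ∈ K ∧ rr π g ≤ 1/8 ∧ ‖b g‖ ≤ R} ≤ 
      Subgroup.closure {g | g ∈ K ∧ rr π g ≤ 1/8 ∧ ‖b g‖ ≤ R'} := fun R R' h => 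
    Subgroup.closure_mono fun g hg => ⟨hg.1, hg.2.1, hg.2.2.trans h⟩
  have h3 : ∀ x ∈ Subgroup.closure A, ∃ R : ℝ, x ∈ Subgroup.closure {g | g ∈ K ∧ rr π g ≤ 1/8 ∧ ‖b g‖ ≤ R} := by
    intro x hx
    induction hx using Subgroup.closure_induction with
    | mem x hx => exact ⟨‖b x‖, Subgroup.subset_closure ⟨hx.1, hx.2, le_rfl⟩⟩
    | one => exact ⟨0, one_mem _⟩
    | mul x y _ _ hx hy => 
      obtain ⟨R, hR⟩ := hx
      obtain ⟨R', hR'⟩ := hy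
      exact ⟨max R R', mul_mem (hmono _ _ (le_max_left _ _) hR) (hmono _ _ (le_max_right _ _) hR')⟩
    | inv x _ hx => 
      obtain ⟨R, hR⟩ := hx
      exact ⟨R, inv_mem hR⟩
  have h4 : ∀ x : G, ∃ R : ℝ, x ∈ T → x ∈ Subgroup.closure {g | g ∈ K ∧ rr π g ≤ 1/8 ∧ ‖b g‖ ≤ R} := by
    intro x
    by_cases hx : x ∈ T
    · obtain ⟨R, hR⟩ := h3 x (by rw [← hT]; exact Subgroup.subset_closure hx)
      exact ⟨R, fun _ => hR⟩
    · exact ⟨0, fun h => absurd h hx⟩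
  choose Rf hRf using h4
  obtain ⟨R, hR⟩ := (T.image Rf).bddAbove
  refine ⟨R, ?_⟩
  have hle : Subgroup.closure A ≤ Subgroup.closure {g | g ∈ K ∧ rr π g ≤ 1/8 ∧ ‖b g‖ ≤ R} := by
    rw [← hT, Subgroup.closure_le]
    intro x hx
    exact hmono _ _ (hR (by simpa using ⟨x, hx, rfl⟩)) (hRf x hx)
  exact Subgroup.finiteIndex_of_le hle

end bieb

theorem bieb (n : ℕ) : ∀ (G : Type) [Group G] (_ : Group.FG G) (V : Type) [NormedAddCommGroup V] 
    [InnerProductSpace ℝ V] [FiniteDimensional ℝ V] (π : G →* (V ≃ₗᵢ[ℝ] V)) (b : G → V) (_ : IsCoc π b) 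
    (_ : ∀ R : ℝ, {g | ‖b g‖ ≤ R}.Finite), Module.finrank ℝ V = n → AbelianByFinite G := by
  induction n using Nat.strong_induction_on with
  | _ n ih =>
  intro G _ hfg V _ _ _ π b hb hprop hn
  obtain ⟨K, hK, hKfix⟩ := exists_G1 hb hprop
  obtain ⟨R, hR⟩ := exists_K2 (π := π) hfg b K hK
  set A : Set G := {g | g ∈ K ∧ rr π g ≤ 1/8 ∧ ‖b g‖ ≤ R} with hA
  set K2 := Subgroup.closure A with hK2
  have hfg2 : Group.FG K2 := inferInstance
  apply abf_of_finiteIndex K2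
  have hb2 : IsCoc (π.comp K2.subtype) (fun g : K2 => b g) := fun g h => hb g h
  have hprop2 : ∀ R : ℝ, {g : K2 | ‖b g‖ ≤ R}.Finite := fun R => 
    (hprop R).preimage (f := (Subtype.val : K2 → G)) Subtype.val_injective.injOn
  have hrr : ∀ g : K2, rr (π.comp K2.subtype) g = rr π g := fun g => rfl
  have hAf : A.Finite := (hprop R).subset fun g hg => hg.2.2
  refine bieb_core hfg2 hb2 hprop2 ((Subtype.val : K2 → G) ⁻¹' A) ?_ 
    (hAf.preimage Subtype.val_injective.injOn) (fun g hg => hg.2.1) ?_ ?_ ?_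
  · exact Subgroup.closure_closure_coe_preimage
  · intro g hg h hh
    refine ⟨?_, ?_, ?_⟩
    · change ((g * h * g⁻¹ * h⁻¹ : K2) : G) ∈ K
      push_cast
      exact mul_mem (mul_mem (mul_mem hg.1 hh.1) (inv_mem hg.1)) (inv_mem hh.1)
    · have h1 := rr_comm π g h
      have h2 : rr π g ≤ 1/8 := hg.2.1
      have h3 : rr π h ≤ 1/8 := hh.2.1
      have h4 := rr_nonneg π (g:G)
      have h5 := rr_nonneg π (h:G)
      change rr π ⁅(g:G), (h:G)⁆ ≤ 1/8
      nlinarith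
    · exact b_comm_norm hb g h R hg.2.1 hh.2.1 hg.2.2 hh.2.2
  · intro g hg c hc
    exact hKfix g hg.1 c hc
  · intro W hW ρ β hβ hβp
    exact ih _ (hn ▸ hW) K2 hfg2 W ρ β hβ hβp rfl
end QI

namespace QI
open Filter

section fwd
variable {G : Type} [Group G]

lemma supp_pw {S : Finset G} (hS : IsWordGenSet S) (n : ℕ) (x : G) (hx : pw S n x ≠ 0) : 
    len (S : Set G) x ≤ n := by
  induction n generalizing x with
  | zero =>
    have : x = 1 := by
      by_contra h
      exact hx (by simp [pw, h])
    rw [this, len_one]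
  | succ n ih =>
    have : ∃ s ∈ S, pw S n (s⁻¹ * x) ≠ 0 := by
      by_contra! h
      exact hx (by simp only [pw]; rw [Finset.sum_eq_zero h, zero_div])
    obtain ⟨s, hs, h⟩ := this
    have h1 := ih _ h
    have h2 := len_mul_le hS s (s⁻¹ * x)
    have h3 := len_mem_le hs
    rw [mul_inv_cancel_left] at h2
    omega

theorem fwd_core {S : Finset G} (hS : IsWordGenSet S) (h1 : (1:G) ∈ S) {ι : Type} [Fintype ι] (φ : G → ι → ℤ) 
    (M : ℕ) (hup : ∀ x, ∀ s ∈ S, ∀ i, |φ (x * s) i - φ x i| ≤ M) (c C : ℝ) (hc : 0 < c)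
    (hlow : ∀ x g, c * len (S : Set G) g - C ≤ ∑ i, |((φ (x * g) i - φ x i : ℤ) : ℝ)|) : 
    AbelianByFinite G := by
  classical
  set r := Fintype.card ι with hr
  have hfg : Group.FG G := ⟨⟨S, hS.2⟩⟩
  have hup' : ∀ x g i, |((φ (x * g) i - φ x i : ℤ) : ℝ)| ≤ M * len (S : Set G) g := by
    intro x g i
    refine le_len_of_step hS (fun g => |((φ (x * g) i - φ x i : ℤ) : ℝ)|) M (by simp) ?_ g
    intro g s hs
    have h := hup (x * g) s hs i
    have h' : |((φ (x * g * s) i - φ (x * g) i : ℤ) : ℝ)| ≤ M := by exact_mod_cast h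
    have h2 := abs_add_le ((φ (x * g) i - φ x i : ℤ) : ℝ) ((φ (x * g * s) i - φ (x * g) i : ℤ) : ℝ)
    have h3 : ((φ (x * g) i - φ x i : ℤ) : ℝ) + ((φ (x * g * s) i - φ (x * g) i : ℤ) : ℝ) = 
      ((φ (x * (g * s)) i - φ x i : ℤ) : ℝ) := by rw [← mul_assoc]; push_cast; ring
    rw [h3] at h2
    linarith
  -- growth
  have hgr : ∃ C' : ℝ, ∀ n : ℕ, ((Function.support (pw S n)).ncard : ℝ) ≤ C' * ((n:ℝ) + 1)^r := by
    let N : ℕ := ⌈C / c⌉₊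
    have hNf := finite_len_le hS N
    refine ⟨(hNf.toFinset.card : ℝ) * (2 * M + 1)^r, fun n => ?_⟩
    have hB := finite_len_le hS n
    have e1 : (Function.support (pw S n)).ncard ≤ hB.toFinset.card := by
      rw [← Set.ncard_eq_toFinset_card _ hB]
      exact Set.ncard_le_ncard (fun x hx => supp_pw hS n x hx) hB
    let box : Finset (ι → ℤ) := Fintype.piFinset fun _ => Finset.Icc (-((M*n : ℕ):ℤ)) ((M*n : ℕ):ℤ)
    have e2 : hB.toFinset.card ≤ hNf.toFinset.card * box.card := by
      refine Finset.card_le_mul_card_image_of_maps_to (f := fun x => φ x - φ 1) ?_ _ ?_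
      · intro x hx
        replace hx : len (S : Set G) x ≤ n := by simpa using hx
        simp only [box, Finset.mem_coe, Fintype.mem_piFinset, Finset.mem_Icc, ← abs_le]
        intro i
        have := hup' 1 x i
        rw [one_mul] at this
        have h2 : (M:ℝ) * len (S : Set G) x ≤ M * n := by
          gcongr
        have := this.trans h2
        simp only [Pi.sub_apply]
        exact_mod_cast this
      · intro y hy
        by_cases hne : (hB.toFinset.filter fun x => φ x - φ 1 = y).Nonempty
        · obtain ⟨x0, hx0⟩ := hne
          refine Finset.card_le_card_of_injOn (fun x => x0⁻¹ * x) ?_ ?_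
          · intro x hx
            simp only [Finset.coe_filter, Finset.mem_filter, Set.mem_ofPred_eq] at hx hx0
            have hxx : φ x = φ x0 := by
              have := hx.2.trans hx0.2.symm
              simpa using this
            have h3 := hlow x0 (x0⁻¹ * x)
            rw [mul_inv_cancel_left, hxx] at h3
            simp only [sub_self, Int.cast_zero, abs_zero, Finset.sum_const_zero] at h3
            rw [Set.Finite.coe_toFinset]
            have h4 : (len (S : Set G) (x0⁻¹ * x) : ℝ) ≤ C / c := by
              rw [le_div_iff₀ hc]; linarith
            have := h4.trans (Nat.le_ceil _)
            change _ ≤ N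
            exact_mod_cast this
          · intro a _ b _ hab
            simpa using hab
        · rw [Finset.not_nonempty_iff_eq_empty] at hne
          rw [hne]; simp
    have e3 : box.card = (2 * (M * n) + 1)^r := by
      simp only [box, Fintype.card_piFinset, Int.card_Icc, Finset.prod_const, Finset.card_univ, ← hr]
      congr 1
      omega
    have e4 : ((Function.support (pw S n)).ncard : ℝ) ≤ hNf.toFinset.card * (2 * (M * n) + 1)^r := by
      rw [e3] at e2
      exact_mod_cast e1.trans e2
    refine e4.trans ?_
    rw [mul_assoc, ← mul_pow]
    gcongr
    nlinarith [(Nat.cast_nonneg n : (0:ℝ) ≤ n), (Nat.cast_nonneg M : (0:ℝ) ≤ M)]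
  obtain ⟨C', hgr⟩ := hgr
  obtain ⟨K, hK, good⟩ := exists_good S ⟨1, h1⟩ C' r hgr
  let φE : G → EuclideanSpace ℝ (ι) := fun x => WithLp.toLp 2 fun i => (φ x i : ℝ)
  have hcoord : ∀ x g i, (φE (x * g) - φE x) i = ((φ (x * g) i - φ x i : ℤ) : ℝ) := by
    intro x g i; simp [φE]
  have hE1 : ∀ v : EuclideanSpace ℝ (ι), ∑ i, |v i| ≤ ((r:ℝ) + 1) * ‖v‖ := by
    intro v
    have : ∑ i, |v i| ≤ ∑ i : ι, ‖v‖ := Finset.sum_le_sum fun i _ => by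
      simpa using PiLp.norm_apply_le v i
    refine this.trans ?_
    rw [Finset.sum_const, Finset.card_univ, ← hr, nsmul_eq_mul]
    nlinarith [norm_nonneg v]
  have hE2 : ∀ v : EuclideanSpace ℝ (ι), ‖v‖ ≤ ∑ i, |v i| := by
    intro v
    rw [EuclideanSpace.norm_eq]
    apply Real.sqrt_le_iff.2
    refine ⟨Finset.sum_nonneg fun i _ => abs_nonneg _, ?_⟩
    simp only [Real.norm_eq_abs]
    exact Finset.sum_sq_le_sq_sum_of_nonneg fun i _ => abs_nonneg _
  obtain ⟨H, _, _, _, π, b, hb, hbl⟩ := proper_coc hS h1 K good φE (by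
    intro g
    refine ⟨∑ i : ι, M * len (S : Set G) g, fun x => (hE2 _).trans (Finset.sum_le_sum fun i _ => ?_)⟩
    rw [hcoord]; exact hup' x g i) (c / (r + 1)) (C / (r + 1)) (by
    intro x g
    have h2 := hE1 (φE (x * g) - φE x)
    have h3 := hlow x g
    simp only [hcoord] at h2
    have h4 : c / (r + 1) * len (S : Set G) g - C / (r + 1) = (c * len (S : Set G) g - C) / (r + 1) := by ring
    rw [h4, div_le_iff₀ (by positivity)]
    linarith)
  obtain ⟨W, _, _, _, ρ, β, hβ, hβp⟩ := fd_coc ⟨1, h1⟩ hS hb K hK good (c / (r + 1)) (C / (r + 1)) (by positivity) hbl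
  exact bieb _ G hfg W ρ β hβ hβp rfl


lemma len_inv {A : Type*} [Group A] {T : Finset A} (hT : IsWordGenSet T) (a : A) : 
    len (T : Set A) a⁻¹ ≤ len (T : Set A) a := by
  obtain ⟨l, hl, h1, h2⟩ := exists_list_len hT a
  rw [← h1, ← h2, List.prod_inv_reverse]
  refine (len_le_of_list _ ?_).trans (by simp)
  intro a ha
  simp only [List.mem_reverse, List.mem_map] at ha
  obtain ⟨c, hc, rfl⟩ := ha
  exact hT.1 _ (hl c hc)

lemma len_pow {A : Type*} [Group A] {T : Finset A} (hT : IsWordGenSet T) (a : A) (n : ℕ) : 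
    len (T : Set A) (a ^ n) ≤ n * len (T : Set A) a := by
  induction n with
  | zero => simp [len_one]
  | succ n ih =>
    rw [pow_succ]
    have := len_mul_le hT (a ^ n) a
    linarith

lemma len_zpow {A : Type*} [Group A] {T : Finset A} (hT : IsWordGenSet T) (a : A) (n : ℤ) : 
    len (T : Set A) (a ^ n) ≤ n.natAbs * len (T : Set A) a := by
  obtain ⟨m, rfl | rfl⟩ := n.eq_nat_or_neg
  · simpa using len_pow hT a m
  · have h1 := len_pow hT a m
    have h2 := len_inv hT (a ^ m)
    simpa using h2.trans h1

lemma len_prod {A : Type*} [CommGroup A] {T : Finset A} (hT : IsWordGenSet T) {ι : Type*} (s : Finset ι) (f : ι → A) : 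
    len (T : Set A) (∏ i ∈ s, f i) ≤ ∑ i ∈ s, len (T : Set A) (f i) := by
  classical
  induction s using Finset.induction_on with
  | empty => simp [len_one]
  | insert a s ha ih =>
    rw [Finset.prod_insert ha, Finset.sum_insert ha]
    have := len_mul_le hT (f a) (∏ i ∈ s, f i)
    omega

/-- coordinates on a f.g. abelian group -/
lemma exists_coords (A : Type) [CommGroup A] (hA : Group.FG A) : 
    ∃ (ι : Type) (_ : Fintype ι) (ψ : A → ι → ℤ) (u : ι → A) (F : Set A), F.Finite ∧ 
      (∀ a b i, ψ (a * b) i = ψ a i + ψ b i) ∧ ∀ a, ∃ t ∈ F, a = t * ∏ i, u i ^ ψ a i := by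
  classical
  obtain ⟨κ, ι, _, _, p, hp, e, ⟨E⟩⟩ := CommGroup.equiv_free_prod_prod_multiplicative_zmod A
  have hfin : Finite ((i : κ) → Multiplicative (ZMod (p i ^ e i))) := by
    have : ∀ i, Finite (Multiplicative (ZMod (p i ^ e i))) := fun i => by
      have : NeZero (p i ^ e i) := ⟨pow_ne_zero _ (hp i).ne_zero⟩
      have : Finite (ZMod (p i ^ e i)) := inferInstance
      exact Finite.of_equiv _ Multiplicative.ofAdd
    infer_instance
  refine ⟨ι, inferInstance, fun a i => Multiplicative.toAdd ((E a).1 i), 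
    fun i => E.symm (Pi.mulSingle i (Multiplicative.ofAdd 1), 1), Set.range fun z => E.symm (1, z), 
    Set.finite_range _, ?_, ?_⟩
  · intro a b i; simp
  · intro a
    refine ⟨_, ⟨(E a).2, rfl⟩, ?_⟩
    apply E.injective
    simp only [map_mul, map_prod, map_zpow, MulEquiv.apply_symm_apply]
    ext i
    · simp [Prod.fst_prod, Pi.mulSingle_apply, Finset.prod_ite_eq]
    · simp [Prod.snd_prod]

theorem fwd {S : Finset G} (hS : IsWordGenSet S) (A : Type) [CommGroup A] (hA : Group.FG A) (T : Finset A) 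
    (hT : IsWordGenSet T) (f : G → A) (L C : ℝ) (hL : 1 ≤ L) (hC : 0 ≤ C) (h : ∀ x y : G,
          L⁻¹ * (wordDist (S : Set G) x y : ℝ) - C ≤ (wordDist (T : Set A) (f x) (f y) : ℝ) ∧
          (wordDist (T : Set A) (f x) (f y) : ℝ) ≤ L * (wordDist (S : Set G) x y : ℝ) + C) : 
    AbelianByFinite G := by
  classical
  obtain ⟨ι, _, ψ, u, F, hF, hψ, hrep⟩ := exists_coords A hA
  have hψ1 : ∀ i, ψ 1 i = 0 := fun i => by
    have := hψ 1 1 i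
    rw [one_mul] at this; linarith
  -- upper bound for ψ
  obtain ⟨D, hD0, hD⟩ : ∃ D : ℕ, 0 < D ∧ ∀ a i, |(ψ a i : ℝ)| ≤ D * len (T : Set A) a := by
    refine ⟨1 + ∑ t ∈ T, ∑ i, (ψ t i).natAbs, by omega, fun a i => ?_⟩
    refine le_len_of_step hT (fun a => |(ψ a i : ℝ)|) _ (by simp [hψ1]) ?_ a
    intro g s hs
    have h1 : (ψ s i).natAbs ≤ 1 + ∑ t ∈ T, ∑ i, (ψ t i).natAbs := by
      have h1 := Finset.single_le_sum (f := fun i => (ψ s i).natAbs) (fun i _ => Nat.zero_le _) (Finset.mem_univ i)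
      have h2 := Finset.single_le_sum (f := fun t => ∑ i, (ψ t i).natAbs) (fun i _ => Nat.zero_le _) hs
      omega
    have h2 : |(ψ s i : ℝ)| ≤ ((1 + ∑ t ∈ T, ∑ i, (ψ t i).natAbs : ℕ) : ℝ) := by
      have : |(ψ s i : ℝ)| = ((ψ s i).natAbs : ℝ) := by rw [Nat.cast_natAbs]; simp
      rw [this]
      exact_mod_cast h1
    have h3 := abs_add_le (ψ g i : ℝ) (ψ s i : ℝ)
    simp only [hψ]
    push_cast at h2 h3 ⊢
    linarith
  -- lower bound
  obtain ⟨P, Q, hP, hPQ⟩ : ∃ P Q : ℝ, 0 < P ∧ ∀ a, (len (T : Set A) a : ℝ) ≤ P * ∑ i, |(ψ a i : ℝ)| + Q := by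
    obtain ⟨Q, hQ⟩ := (hF.image (fun t => len (T : Set A) t)).bddAbove
    refine ⟨1 + ∑ i, len (T : Set A) (u i), Q, by positivity, fun a => ?_⟩
    obtain ⟨t, ht, hat⟩ := hrep a
    have h1 := len_mul_le hT t (∏ i, u i ^ ψ a i)
    rw [← hat] at h1
    have h2 := len_prod hT Finset.univ (fun i => u i ^ ψ a i)
    have h3 : len (T : Set A) t ≤ Q := hQ ⟨t, ht, rfl⟩
    have h4 : ∑ i, len (T : Set A) (u i ^ ψ a i) ≤ ∑ i, (ψ a i).natAbs * (1 + ∑ i, len (T : Set A) (u i)) := by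
      refine Finset.sum_le_sum fun i _ => (len_zpow hT _ _).trans (Nat.mul_le_mul_left _ ?_)
      have := Finset.single_le_sum (f := fun i => len (T : Set A) (u i)) (fun i _ => Nat.zero_le _) (Finset.mem_univ i)
      omega
    rw [← Finset.sum_mul] at h4
    have h5 : len (T : Set A) a ≤ (∑ i, (ψ a i).natAbs) * (1 + ∑ i, len (T : Set A) (u i)) + Q := by omega
    have h6 : (len (T : Set A) a : ℝ) ≤ (∑ i, ((ψ a i).natAbs:ℝ)) * (1 + ∑ i, (len (T : Set A) (u i) : ℝ)) + Q := by
      exact_mod_cast h5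
    have h7 : ∀ i, ((ψ a i).natAbs:ℝ) = |(ψ a i : ℝ)| := fun i => by rw [Nat.cast_natAbs]; simp
    simp only [h7] at h6
    push_cast
    linarith
  have hS0 : IsWordGenSet (insert 1 S) := by
    refine ⟨?_, ?_⟩
    · intro a ha
      rcases Finset.mem_insert.1 ha with rfl | h
      · simp
      · exact Finset.mem_insert_of_mem (hS.1 a h)
    · rw [eq_top_iff, ← hS.2]
      exact Subgroup.closure_mono (by simp)
  have hlen : ∀ g, len ((insert 1 S : Finset G) : Set G) g ≤ len (S : Set G) g := by
    intro g
    obtain ⟨l, hl, h1, h2⟩ := exists_list_len hS g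
    rw [← h1]
    conv_lhs => rw [← h2]
    exact len_le_of_list l fun a ha => Finset.mem_insert_of_mem (hl a ha)
  have hdiff : ∀ x y i, ψ (f y) i - ψ (f x) i = ψ ((f x)⁻¹ * f y) i := by
    intro x y i
    have := hψ (f x) ((f x)⁻¹ * f y) i
    rw [mul_inv_cancel_left] at this
    linarith
  have hL0 : 0 < L := by linarith
  refine fwd_core hS0 (Finset.mem_insert_self _ _) (fun x => ψ (f x)) (D * ⌈L + C⌉₊) ?_ (L⁻¹ / P) ((C + Q) / P) (by positivity) ?_
  · intro x s hs i
    rw [hdiff]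
    have h1 := hD ((f x)⁻¹ * f (x * s)) i
    have h2 := (h x (x * s)).2
    rw [wordDist_eq_len, wordDist_eq_len, inv_mul_cancel_left] at h2
    have h3 : len (S : Set G) s ≤ 1 := by
      rcases Finset.mem_insert.1 hs with rfl | h
      · simp [len_one]
      · exact len_mem_le h
    have h3' : (len (S : Set G) s : ℝ) ≤ 1 := by exact_mod_cast h3
    have h4 : (len (T : Set A) ((f x)⁻¹ * f (x * s)) : ℝ) ≤ ⌈L + C⌉₊ := by
      refine le_trans ?_ (Nat.le_ceil _)
      nlinarith
    have h5 : |(ψ ((f x)⁻¹ * f (x * s)) i : ℝ)| ≤ D * ⌈L + C⌉₊ := h1.trans (by gcongr)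
    exact_mod_cast h5
  · intro x g
    have h1 := hPQ ((f x)⁻¹ * f (x * g))
    have h2 := (h x (x * g)).1
    rw [wordDist_eq_len, wordDist_eq_len, inv_mul_cancel_left] at h2
    simp only [hdiff]
    have h3 : (len ((insert 1 S : Finset G) : Set G) g : ℝ) ≤ len (S : Set G) g := by exact_mod_cast hlen g
    have h4 : L⁻¹ / P * len ((insert 1 S : Finset G) : Set G) g - (C + Q) / P = 
      (L⁻¹ * len ((insert 1 S : Finset G) : Set G) g - (C + Q)) / P := by ring
    rw [h4, div_le_iff₀ hP]
    have h5 := mul_le_mul_of_nonneg_left h3 (inv_nonneg.2 hL0.le)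
    linarith

end fwd
end QI

namespace QI

section conv
variable {G : Type} [Group G]

theorem conv {S : Finset G} (hfg : Group.FG G) (hS : IsWordGenSet S) (hab : AbelianByFinite G) : 
    (∃ (A : Type) (_ : CommGroup A), Group.FG A ∧
      ∃ T : Finset A, IsWordGenSet T ∧
        ∃ f : G → A, ∃ L C : ℝ, 1 ≤ L ∧ 0 ≤ C ∧ ∀ x y : G,
          L⁻¹ * (wordDist (S : Set G) x y : ℝ) - C ≤ (wordDist (T : Set A) (f x) (f y) : ℝ) ∧
          (wordDist (T : Set A) (f x) (f y) : ℝ) ≤ L * (wordDist (S : Set G) x y : ℝ) + C) := by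
  classical
  obtain ⟨N, hN, hcomm, hfin⟩ := hab
  have hFI : N.FiniteIndex := Subgroup.finiteIndex_of_finite_quotient
  have hNfg : Group.FG N := inferInstance
  let inst : CommGroup N := { (inferInstance : Group N) with 
    mul_comm := fun a b => Subtype.ext (hcomm a b a.2 b.2) }
  obtain ⟨T0, hT0⟩ := hNfg.1
  have hT : IsWordGenSet (T0 ∪ T0.image (·⁻¹) : Finset N) := by
    refine ⟨?_, ?_⟩
    · intro a ha
      simp only [Finset.mem_union, Finset.mem_image] at ha ⊢
      rcases ha with h | ⟨b, hb, rfl⟩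
      · exact Or.inr ⟨a, h, rfl⟩
      · left; simpa using hb
    · rw [eq_top_iff, ← hT0]
      exact Subgroup.closure_mono (by simp)
  generalize T0 ∪ T0.image (·⁻¹) = T at hT
  -- transversal
  let τ : G → G := fun g => (Quotient.out (g : G ⧸ N) : G)
  have hτ : ∀ g, g * (τ g)⁻¹ ∈ N := by
    intro g
    have h1 : (τ g)⁻¹ * g ∈ N := QuotientGroup.eq.1 (QuotientGroup.out_eq' (g : G ⧸ N))
    have := hN.mem_comm h1
    exact this
  let f : G → N := fun g => ⟨g * (τ g)⁻¹, hτ g⟩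
  have hτfin : (Set.range τ).Finite := by
    have : Set.range τ ⊆ Set.range (Quotient.out : G ⧸ N → G) := by
      rintro _ ⟨g, rfl⟩; exact ⟨_, rfl⟩
    exact (Set.finite_range _).subset this
  obtain ⟨M, hM⟩ := (hτfin.image (fun t => len (S : Set G) t)).bddAbove
  have hM' : ∀ g, len (S : Set G) (τ g) ≤ M := fun g => hM ⟨τ g, ⟨g, rfl⟩, rfl⟩
  -- inclusion is Lipschitz
  obtain ⟨B, hB⟩ := ((T.finite_toSet).image (fun t : N => len (S : Set G) (t : G))).bddAbove
  have hincl : ∀ a : N, (len (S : Set G) (a : G) : ℝ) ≤ B * len (T : Set N) a := by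
    intro a
    refine le_len_of_step hT (fun a => (len (S : Set G) (a : G) : ℝ)) B (by simp [len_one]) ?_ a
    intro g s hs
    have h1 := len_mul_le hS (g : G) (s : G)
    have h2 : len (S : Set G) (s : G) ≤ B := hB ⟨s, hs, rfl⟩
    have h3 : len (S : Set G) ((g * s : N) : G) ≤ len (S : Set G) (g : G) + B := by
      rw [Subgroup.coe_mul]; omega
    exact_mod_cast h3
  -- f is Lipschitz
  have hstepfin : {a : N | ∃ g, ∃ s ∈ S, (f g)⁻¹ * f (g * s) = a}.Finite := by
    have : {a : N | ∃ g, ∃ s ∈ S, (f g)⁻¹ * f (g * s) = a} ⊆ 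
      (Subtype.val : N → G) ⁻¹' ((fun p : (G × G) × G => p.1.1 * p.2 * p.1.2⁻¹) '' ((Set.range τ ×ˢ Set.range τ) ×ˢ (S : Set G))) := by
      rintro a ⟨g, s, hs, rfl⟩
      refine ⟨((τ g, τ (g * s)), s), ⟨⟨⟨g, rfl⟩, ⟨_, rfl⟩⟩, hs⟩, ?_⟩
      simp only [Subgroup.coe_mul, Subgroup.coe_inv, f]
      group
    exact Set.Finite.subset (Set.Finite.preimage Subtype.val_injective.injOn 
      (((hτfin.prod hτfin).prod S.finite_toSet).image _)) this
  obtain ⟨D, hD⟩ := (hstepfin.image (fun a => len (T : Set N) a)).bddAbove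
  have hf : ∀ x g, (len (T : Set N) ((f x)⁻¹ * f (x * g)) : ℝ) ≤ D * len (S : Set G) g := by
    intro x g
    refine le_len_of_step hS (fun g => (len (T : Set N) ((f x)⁻¹ * f (x * g)) : ℝ)) D (by simp [len_one]) ?_ g
    intro g s hs
    have h1 := len_mul_le hT ((f x)⁻¹ * f (x * g)) ((f (x * g))⁻¹ * f (x * g * s))
    have h2 : len (T : Set N) ((f (x * g))⁻¹ * f (x * g * s)) ≤ D := hD ⟨_, ⟨x * g, s, hs, rfl⟩, rfl⟩
    have h4 : (f x)⁻¹ * f (x * g) * ((f (x * g))⁻¹ * f (x * g * s)) = (f x)⁻¹ * f (x * (g * s)) := by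
      rw [← mul_assoc x g s]; group
    rw [h4] at h1
    have h3 : len (T : Set N) ((f x)⁻¹ * f (x * (g * s))) ≤ len (T : Set N) ((f x)⁻¹ * f (x * g)) + D := by omega
    exact_mod_cast h3
  have hlow : ∀ x y, (len (S : Set G) (x⁻¹ * y) : ℝ) ≤ 2 * M + B * len (T : Set N) ((f x)⁻¹ * f y) := by
    intro x y
    have h0 : x⁻¹ * y = (τ x)⁻¹ * ((((f x)⁻¹ * f y : N) : G) * τ y) := by
      simp only [Subgroup.coe_mul, Subgroup.coe_inv, f]
      group
    have h1 := len_mul_le hS (τ x)⁻¹ ((((f x)⁻¹ * f y : N) : G) * τ y)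
    have h2 := len_mul_le hS (((f x)⁻¹ * f y : N) : G) (τ y)
    have h3 := len_inv hS (τ x)
    have h4 := hM' x
    have h5 := hM' y
    rw [← h0] at h1
    have h6 : len (S : Set G) (x⁻¹ * y) ≤ 2 * M + len (S : Set G) (((f x)⁻¹ * f y : N) : G) := by omega
    have h7 : (len (S : Set G) (x⁻¹ * y) : ℝ) ≤ 2 * M + len (S : Set G) (((f x)⁻¹ * f y : N) : G) := by exact_mod_cast h6
    have := hincl ((f x)⁻¹ * f y)
    linarith
  refine ⟨N, inst, hNfg, T, hT, f, 1 + B + D, 2 * M, by linarith [(Nat.cast_nonneg B : (0:ℝ) ≤ B), (Nat.cast_nonneg D : (0:ℝ) ≤ D)], 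
    by positivity, fun x y => ⟨?_, ?_⟩⟩
  · rw [wordDist_eq_len, wordDist_eq_len]
    have h1 := hlow x y
    have hLp : (1:ℝ) ≤ 1 + B + D := by linarith [(Nat.cast_nonneg B : (0:ℝ) ≤ B), (Nat.cast_nonneg D : (0:ℝ) ≤ D)]
    rw [sub_le_iff_le_add, inv_mul_le_iff₀ (by linarith)]
    refine h1.trans ?_
    have a1 : (0:ℝ) ≤ len (T : Set N) ((f x)⁻¹ * f y) := Nat.cast_nonneg _
    have a2 : (0:ℝ) ≤ D := Nat.cast_nonneg _
    have a3 : (0:ℝ) ≤ B := Nat.cast_nonneg _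
    have a4 : (0:ℝ) ≤ M := Nat.cast_nonneg _
    have b1 := mul_nonneg a1 a2
    have b2 := mul_nonneg a4 a2
    have b3 := mul_nonneg a4 a3
    nlinarith
  · rw [wordDist_eq_len, wordDist_eq_len]
    have h1 := hf x (x⁻¹ * y)
    rw [mul_inv_cancel_left] at h1
    have a1 : (0:ℝ) ≤ len (S : Set G) (x⁻¹ * y) := Nat.cast_nonneg _
    have a3 : (0:ℝ) ≤ B := Nat.cast_nonneg _
    have a4 : (0:ℝ) ≤ M := Nat.cast_nonneg _
    have b1 := mul_nonneg a1 a3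
    nlinarith

end conv
end QI

/-- A finitely generated group `G` admits a quasi-isometric embedding into a finitely
generated abelian group (with respect to word metrics, for any choice of finite
symmetric generating set of `G`) iff `G` is abelian-by-finite. -/
theorem qi_embeds_into_fg_abelian_iff_abelianByFinite
    (G : Type) [Group G] (hfg : Group.FG G) (S : Finset G) (hS : IsWordGenSet S) :
    (∃ (A : Type) (_ : CommGroup A), Group.FG A ∧
      ∃ T : Finset A, IsWordGenSet T ∧
        ∃ f : G → A, ∃ L C : ℝ, 1 ≤ L ∧ 0 ≤ C ∧ ∀ x y : G,
          L⁻¹ * (wordDist (S : Set G) x y : ℝ) - C ≤ (wordDist (T : Set A) (f x) (f y) : ℝ) ∧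
          (wordDist (T : Set A) (f x) (f y) : ℝ) ≤ L * (wordDist (S : Set G) x y : ℝ) + C) ↔
    AbelianByFinite G := by
  constructor
  · rintro ⟨A, _, hA, T, hT, f, L, C, hL, hC, h⟩
    exact QI.fwd hS A hA T hT f L C hL hC h
  · intro h
    exact QI.conv hfg hS h
end
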